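/- arXiv:1207.5218 — 3 statements merged into one kernel-verified Lean document; each statement's English description precedes it below -/
import Mathlib

section
/- Weighted Sobolev estimate: there exists a constant C such that for every smooth compactly supported function u : ℝ³ → ℝ and every x ∈ ℝ³, ⟨|x|⟩^{1/2} |u(x)| ≤ C Σ_{|α|≤1} ‖∂ Γ^α u‖_{L²(ℝ³)}, where Γ ranges over (∂, Ω) and the right-hand side is the square root of the second-order energy E₂ at fixed time (only spatial derivatives and rotations are needed). -/
open MeasureTheory

/-- Spatial partial derivative `∂_i` on `ℝ³`. -/
noncomputable def pd3 (i : Fin 3) (u : EuclideanSpace ℝ (Fin 3) → ℝ) :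
    EuclideanSpace ℝ (Fin 3) → ℝ :=
  fun x => fderiv ℝ u x (EuclideanSpace.single i 1)

/-- Rotation vector field `Ω_{ij} = xⁱ ∂_j - xʲ ∂_i` on `ℝ³`. -/
noncomputable def rot3 (i j : Fin 3) (u : EuclideanSpace ℝ (Fin 3) → ℝ) :
    EuclideanSpace ℝ (Fin 3) → ℝ :=
  fun x => x i * pd3 j u x - x j * pd3 i u x

/-- `‖∂u‖_{L²(ℝ³)}` : the L² norm of the full gradient. -/
noncomputable def gradL2 (u : EuclideanSpace ℝ (Fin 3) → ℝ) : ℝ :=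
  (∫ x, ‖fderiv ℝ u x‖ ^ 2) ^ ((1 : ℝ) / 2)

section WeightedSobolev

open Metric Set
open scoped ENNReal NNReal

local notation "ℝ³" => EuclideanSpace ℝ (Fin 3)

lemma lintegral_comp_smul_of_pos {f : ℝ³ → ℝ≥0∞} (hf : Measurable f) {s : ℝ} (hs : 0 < s) :
    ∫⁻ a, f (s • a) = ENNReal.ofReal (s ^ 3)⁻¹ * ∫⁻ a, f a := by
  rw [← lintegral_map hf (measurable_const_smul s),
    Measure.map_addHaar_smul volume hs.ne', lintegral_smul_measure, finrank_euclideanSpace,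
    Fintype.card_fin, abs_of_pos (by positivity), smul_eq_mul]

lemma setLIntegral_ball_comp_add_smul_le {H : ℝ³ → ℝ≥0∞} (hH : Measurable H) (x : ℝ³) (ρ : ℝ)
    {s : ℝ} (hs : 0 < s) (hs1 : s ≤ 1) :
    ∫⁻ a in ball 0 ρ, H (x + s • a) ≤ ENNReal.ofReal (s ^ 3)⁻¹ * ∫⁻ y in ball x ρ, H y := by
  have hscale := lintegral_comp_smul_of_pos (f := fun a => (ball x ρ).indicator H (x + a))
    ((hH.indicator measurableSet_ball).comp (measurable_const_add x)) hs
  rw [← lintegral_indicator measurableSet_ball, ← lintegral_indicator measurableSet_ball,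
    ← lintegral_add_left_eq_self ((ball x ρ).indicator H) x, ← hscale]
  refine lintegral_mono fun a => ?_
  refine indicator_apply_le' (fun ha => ?_) fun _ => zero_le
  rw [indicator_of_mem]
  rw [mem_ball_zero_iff] at ha
  rw [mem_ball, dist_self_add_left, norm_smul, Real.norm_of_nonneg hs.le]
  exact (mul_le_of_le_one_left (norm_nonneg a) hs1).trans_lt ha

lemma lintegral_Ioc_rpow :
    ∫⁻ s in Ioc (0 : ℝ) 1, ENNReal.ofReal (s ^ (-(3 / 4) : ℝ)) = 4 := by
  have hint : IntegrableOn (fun s : ℝ => s ^ (-(3 / 4) : ℝ)) (Ioc 0 1) :=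
    (intervalIntegrable_iff_integrableOn_Ioc_of_le zero_le_one).1
      (intervalIntegral.intervalIntegrable_rpow' (by norm_num))
  rw [← ofReal_integral_eq_lintegral_ofReal hint, ← intervalIntegral.integral_of_le zero_le_one,
    integral_rpow (Or.inl (by norm_num))]
  · norm_num
  · filter_upwards [self_mem_ae_restrict measurableSet_Ioc] with s hs
    exact Real.rpow_nonneg hs.1.le _

lemma setLIntegral_ball_comp_add_smul_le_rpow {H : ℝ³ → ℝ≥0∞} (hH : Measurable H) (x : ℝ³)
    (ρ : ℝ) {s : ℝ} (hs : 0 < s) (hs1 : s ≤ 1) :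
    ∫⁻ a in ball 0 ρ, H (x + s • a) ≤ ENNReal.ofReal (s ^ (-(3 / 4) : ℝ)) *
      ((∫⁻ y in ball x ρ, H y ^ 4) ^ (1 / 4 : ℝ) * volume (ball x ρ) ^ (3 / 4 : ℝ)) := by
  have hq : (4 : ℝ).HolderConjugate (4 / 3) := by
    rw [Real.holderConjugate_iff]; norm_num
  have hm : Measurable fun a => H (x + s • a) := by fun_prop
  have hold := ENNReal.lintegral_mul_le_Lp_mul_Lq (volume.restrict (ball (0 : ℝ³) ρ)) hq
    hm.aemeasurable (aemeasurable_const (b := (1 : ℝ≥0∞)))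
  have hvol : volume (ball x ρ) = volume (ball (0 : ℝ³) ρ) := Measure.addHaar_ball_center _ _ _
  simp only [Pi.mul_apply, mul_one, ENNReal.one_rpow, lintegral_const, one_mul,
    Measure.restrict_apply_univ, ← hvol] at hold
  refine hold.trans ?_
  rw [← mul_assoc]
  have h4 : ∀ z : ℝ≥0∞, z ^ (4 : ℝ) = z ^ 4 := fun z => by
    rw [← ENNReal.rpow_natCast]; norm_num
  have key := setLIntegral_ball_comp_add_smul_le (hH.pow_const 4) x ρ hs hs1
  have : ENNReal.ofReal (s ^ (-(3 / 4) : ℝ)) = ENNReal.ofReal (s ^ 3)⁻¹ ^ (1 / 4 : ℝ) := by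
    rw [ENNReal.ofReal_rpow_of_nonneg (by positivity) (by norm_num), ← Real.rpow_natCast,
      ← Real.rpow_neg hs.le, ← Real.rpow_mul hs.le]
    norm_num
  rw [this, ← ENNReal.mul_rpow_of_nonneg _ _ (by norm_num)]
  simp only [h4]
  rw [show (1 : ℝ) / (4 / 3) = 3 / 4 by norm_num]
  gcongr

/-- Morrey's inequality for `W^{1,4}` on a ball of `ℝ³`, at the centre of the ball. -/
lemma enorm_pow_four_mul_volume_ball_le {F : ℝ³ → ℝ} {H : ℝ³ → ℝ≥0∞} {x : ℝ³} {ρ : ℝ}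
    (hρ : 0 < ρ) (hF : ContDiffOn ℝ 1 F (ball x ρ)) (hH : Measurable H)
    (hFH : ∀ y ∈ ball x ρ, ‖F y‖ₑ ≤ H y)
    (hDH : ∀ y ∈ ball x ρ, ENNReal.ofReal ρ * ‖fderiv ℝ F y‖ₑ ≤ H y) :
    ‖F x‖ₑ ^ 4 * volume (ball x ρ) ≤ 625 * ∫⁻ y in ball x ρ, H y ^ 4 := by
  set V := volume (ball x ρ) with hV
  set I := ∫⁻ y in ball x ρ, H y ^ 4
  have hV0 : V ≠ 0 := (measure_ball_pos volume x hρ).ne'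
  have hVt : V ≠ ∞ := measure_ball_lt_top.ne
  have hmem : ∀ a ∈ ball (0 : ℝ³) ρ, ∀ s ∈ Icc (0 : ℝ) 1, x + s • a ∈ ball x ρ := by
    intro a ha s hs
    rw [mem_ball_zero_iff] at ha
    rw [mem_ball, dist_self_add_left, norm_smul, Real.norm_of_nonneg hs.1]
    exact (mul_le_of_le_one_left (norm_nonneg a) hs.2).trans_lt ha
  have hpt : ∀ a ∈ ball (0 : ℝ³) ρ,
      ‖F x‖ₑ ≤ H (x + (1 : ℝ) • a) + ∫⁻ s in Ioc (0 : ℝ) 1, H (x + s • a) := by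
    intro a ha
    have hγ : ContDiff ℝ 1 fun s : ℝ => x + s • a := by fun_prop
    have h1 := enorm_sub_le_lintegral_deriv_of_contDiffOn_Icc
      (hF.comp hγ.contDiffOn (hmem a ha)) zero_le_one
    simp only [Function.comp_apply, zero_smul, add_zero] at h1
    have h2 : ∫⁻ s in Icc (0 : ℝ) 1, ‖deriv (F ∘ fun s : ℝ => x + s • a) s‖ₑ
        ≤ ∫⁻ s in Icc (0 : ℝ) 1, H (x + s • a) := by
      refine setLIntegral_mono' measurableSet_Icc fun s hs => ?_
      have hy := hmem a ha s hs
      have hd : DifferentiableAt ℝ F (x + s • a) :=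
        (hF.contDiffAt (isOpen_ball.mem_nhds hy)).differentiableAt one_ne_zero
      have hγ' : HasDerivAt (fun s : ℝ => x + s • a) a s := by
        simpa using ((hasDerivAt_id s).smul_const a).const_add x
      rw [(hd.hasFDerivAt.comp_hasDerivAt s hγ').deriv]
      refine le_trans ?_ (hDH _ hy)
      refine (ContinuousLinearMap.le_opENorm _ _).trans ?_
      rw [mul_comm]
      gcongr
      rw [← ofReal_norm]
      exact ENNReal.ofReal_le_ofReal (mem_ball_zero_iff.1 ha).le
    rw [restrict_Ioc_eq_restrict_Icc]
    have h3 : ‖F x‖ₑ ≤ ‖F (x + (1 : ℝ) • a)‖ₑ + ‖F (x + (1 : ℝ) • a) - F x‖ₑ := by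
      have := enorm_sub_le (a := F (x + (1 : ℝ) • a)) (b := F (x + (1 : ℝ) • a) - F x)
      simpa using this
    exact h3.trans (add_le_add (hFH _ (hmem a ha 1 (by simp))) (h1.trans h2))
  have hint : ‖F x‖ₑ * V ≤ 5 * (I ^ (1 / 4 : ℝ) * V ^ (3 / 4 : ℝ)) := by
    calc ‖F x‖ₑ * V = ∫⁻ _ in ball (0 : ℝ³) ρ, ‖F x‖ₑ := by
          rw [setLIntegral_const, hV, Measure.addHaar_ball_center]
      _ ≤ ∫⁻ a in ball (0 : ℝ³) ρ,
          (H (x + (1 : ℝ) • a) + ∫⁻ s in Ioc (0 : ℝ) 1, H (x + s • a)) :=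
        setLIntegral_mono' measurableSet_ball hpt
      _ = (∫⁻ a in ball (0 : ℝ³) ρ, H (x + (1 : ℝ) • a)) +
          ∫⁻ s in Ioc (0 : ℝ) 1, ∫⁻ a in ball (0 : ℝ³) ρ, H (x + s • a) := by
        rw [lintegral_add_left (by fun_prop), lintegral_lintegral_swap]
        refine Measurable.aemeasurable ?_
        change Measurable fun p : ℝ³ × ℝ => H (x + p.2 • p.1)
        fun_prop
      _ ≤ (I ^ (1 / 4 : ℝ) * V ^ (3 / 4 : ℝ)) +
          ∫⁻ s in Ioc (0 : ℝ) 1, ENNReal.ofReal (s ^ (-(3 / 4) : ℝ)) *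
            (I ^ (1 / 4 : ℝ) * V ^ (3 / 4 : ℝ)) := by
        gcongr ?_ + ?_
        · have h1 := setLIntegral_ball_comp_add_smul_le_rpow hH x ρ one_pos le_rfl
          rwa [Real.one_rpow, ENNReal.ofReal_one, one_mul] at h1
        · exact setLIntegral_mono' measurableSet_Ioc fun s hs =>
            setLIntegral_ball_comp_add_smul_le_rpow hH x ρ hs.1 hs.2
      _ = 5 * (I ^ (1 / 4 : ℝ) * V ^ (3 / 4 : ℝ)) := by
        rw [lintegral_mul_const _ (by fun_prop), lintegral_Ioc_rpow]
        ring
  have hpow := pow_le_pow_left' hint 4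
  have e1 : (I ^ (1 / 4 : ℝ)) ^ 4 = I := by
    rw [← ENNReal.rpow_natCast, ← ENNReal.rpow_mul]; norm_num
  have e2 : (V ^ (3 / 4 : ℝ)) ^ 4 = V ^ 3 := by
    rw [← ENNReal.rpow_natCast, ← ENNReal.rpow_mul, ← ENNReal.rpow_natCast]; norm_num
  rw [mul_pow, mul_pow, mul_pow, e1, e2] at hpow
  refine (ENNReal.mul_le_mul_iff_left (pow_ne_zero 3 hV0) (ENNReal.pow_ne_top hVt)).1 ?_
  calc ‖F x‖ₑ ^ 4 * V * V ^ 3 = ‖F x‖ₑ ^ 4 * V ^ 4 := by ring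
    _ ≤ 5 ^ 4 * (I * V ^ 3) := hpow
    _ = 625 * I * V ^ 3 := by ring

lemma exists_lintegral_enorm_pow_six_le :
    ∃ K : ℝ≥0, ∀ w : ℝ³ → ℝ, ContDiff ℝ 1 w → HasCompactSupport w →
      ∫⁻ x, ‖w x‖ₑ ^ 6 ≤ K * (∫⁻ x, ‖fderiv ℝ w x‖ₑ ^ 2) ^ 3 := by
  refine ⟨SNormLESNormFDerivOfEqConst ℝ (volume : Measure ℝ³) 2 ^ 6, fun w hw hc => ?_⟩
  have h := eLpNorm_le_eLpNorm_fderiv_of_eq (volume : Measure ℝ³) hw hc (p := 2) (p' := 6)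
    (by norm_num) (by simp) (by simp; norm_num)
  rw [eLpNorm_eq_lintegral_rpow_enorm_toReal (by simp) (by simp),
    eLpNorm_eq_lintegral_rpow_enorm_toReal (by simp) (by simp)] at h
  have h' := pow_le_pow_left' h 6
  simp only [ENNReal.coe_toReal, NNReal.coe_ofNat] at h'
  have e6 : ∀ z : ℝ≥0∞, z ^ (6 : ℝ) = z ^ 6 := fun z => by
    rw [← ENNReal.rpow_natCast]; norm_num
  have e2 : ∀ z : ℝ≥0∞, z ^ (2 : ℝ) = z ^ 2 := fun z => by
    rw [← ENNReal.rpow_natCast]; norm_num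
  have e1 : ∀ z : ℝ≥0∞, (z ^ (1 / 6 : ℝ)) ^ 6 = z := fun z => by
    rw [← ENNReal.rpow_natCast, ← ENNReal.rpow_mul]; norm_num
  have e3 : ∀ z : ℝ≥0∞, (z ^ (1 / 2 : ℝ)) ^ 6 = z ^ 3 := fun z => by
    rw [← ENNReal.rpow_natCast, ← ENNReal.rpow_mul, ← ENNReal.rpow_natCast]; norm_num
  simpa only [e6, e2, e1, mul_pow, e3, ENNReal.coe_pow] using h'

lemma exists_lintegral_enorm_pow_three_mul_le :
    ∃ K : ℝ≥0, ∀ w : ℝ³ → ℝ, ContDiff ℝ 1 w → HasCompactSupport w →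
      ∫⁻ x, ‖w x‖ₑ ^ 3 * ‖fderiv ℝ w x‖ₑ ≤ K * (∫⁻ x, ‖fderiv ℝ w x‖ₑ ^ 2) ^ 2 := by
  obtain ⟨K, hK⟩ := exists_lintegral_enorm_pow_six_le
  refine ⟨K ^ (1 / 2 : ℝ), fun w hw hc => ?_⟩
  have hwm : Measurable fun x => ‖w x‖ₑ ^ 3 := by
    have := hw.continuous.measurable
    fun_prop
  have hdm : Measurable fun x => ‖fderiv ℝ w x‖ₑ :=
    (hw.continuous_fderiv one_ne_zero).measurable.enorm
  have hold := ENNReal.lintegral_mul_le_Lp_mul_Lq volume Real.HolderConjugate.two_two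
    hwm.aemeasurable hdm.aemeasurable
  have e2 : ∀ z : ℝ≥0∞, z ^ (2 : ℝ) = z ^ 2 := fun z => by
    rw [← ENNReal.rpow_natCast]; norm_num
  simp only [Pi.mul_apply, e2, ← pow_mul, Nat.reduceMul] at hold
  refine hold.trans ?_
  calc _ ≤ (K * (∫⁻ x, ‖fderiv ℝ w x‖ₑ ^ 2) ^ 3) ^ (1 / 2 : ℝ) *
        (∫⁻ x, ‖fderiv ℝ w x‖ₑ ^ 2) ^ (1 / 2 : ℝ) := by
        gcongr
        exact hK w hw hc
    _ = _ := by
        rw [ENNReal.mul_rpow_of_nonneg _ _ (by norm_num), mul_assoc,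
          ← ENNReal.coe_rpow_of_nonneg _ (by norm_num), ← ENNReal.rpow_natCast,
          ← ENNReal.rpow_natCast, ← ENNReal.rpow_mul,
          ← ENNReal.rpow_add_of_nonneg _ _ (by norm_num) (by norm_num)]
        norm_num

lemma exists_setLIntegral_ball_enorm_pow_four_le :
    ∃ K : ℝ≥0, ∀ w : ℝ³ → ℝ, ContDiff ℝ 1 w → HasCompactSupport w → ∀ x : ℝ³,
      ∫⁻ y in ball x 1, ‖w y‖ₑ ^ 4 ≤ K * (∫⁻ x, ‖fderiv ℝ w x‖ₑ ^ 2) ^ 2 := by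
  obtain ⟨K, hK⟩ := exists_lintegral_enorm_pow_six_le
  refine ⟨K ^ (2 / 3 : ℝ) * (volume (ball (0 : ℝ³) 1)).toNNReal ^ (1 / 3 : ℝ),
    fun w hw hc x => ?_⟩
  have hwm : Measurable fun x => ‖w x‖ₑ ^ 4 := by
    have := hw.continuous.measurable
    fun_prop
  have hq : (3 / 2 : ℝ).HolderConjugate 3 := by
    rw [Real.holderConjugate_iff]; norm_num
  have hold := ENNReal.lintegral_mul_le_Lp_mul_Lq (volume.restrict (ball x 1)) hq
    hwm.aemeasurable (aemeasurable_const (b := (1 : ℝ≥0∞)))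
  have e6 : ∀ z : ℝ≥0∞, (z ^ 4) ^ (3 / 2 : ℝ) = z ^ 6 := fun z => by
    rw [← ENNReal.rpow_natCast, ← ENNReal.rpow_natCast, ← ENNReal.rpow_mul]; norm_num
  simp only [Pi.mul_apply, mul_one, ENNReal.one_rpow, lintegral_const, one_mul, e6,
    Measure.restrict_apply_univ, Measure.addHaar_ball_center (volume : Measure ℝ³) x] at hold
  refine hold.trans ?_
  calc _ ≤ (K * (∫⁻ x, ‖fderiv ℝ w x‖ₑ ^ 2) ^ 3) ^ (1 / (3 / 2) : ℝ) *
        volume (ball (0 : ℝ³) 1) ^ (1 / 3 : ℝ) := by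
        gcongr
        exact (setLIntegral_le_lintegral _ _).trans (hK w hw hc)
    _ = _ := by
        rw [ENNReal.mul_rpow_of_nonneg _ _ (by norm_num), ENNReal.coe_mul,
          ENNReal.coe_rpow_of_nonneg _ (by norm_num), ENNReal.coe_rpow_of_nonneg _ (by norm_num),
          ENNReal.coe_toNNReal measure_ball_lt_top.ne, ← ENNReal.rpow_natCast,
          ← ENNReal.rpow_natCast, ← ENNReal.rpow_mul]
        norm_num
        ring

lemma lintegral_Ioi_lintegral_comp_smul {G : ℝ³ → ℝ≥0∞} (hG : Measurable G) :
    ∫⁻ τ in Ioi (2 / 3 : ℝ), ∫⁻ y, G (τ • y) = ENNReal.ofReal (9 / 8) * ∫⁻ y, G y := by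
  have hint : ∫⁻ τ in Ioi (2 / 3 : ℝ), ENNReal.ofReal (τ ^ 3)⁻¹ = ENNReal.ofReal (9 / 8) := by
    have e : ∀ τ ∈ Ioi (2 / 3 : ℝ), (τ ^ 3)⁻¹ = τ ^ (-3 : ℝ) := fun τ hτ => by
      rw [Real.rpow_neg (le_trans (by norm_num) (le_of_lt hτ))]
      norm_cast
    rw [setLIntegral_congr_fun (g := fun τ : ℝ => ENNReal.ofReal (τ ^ (-3 : ℝ)))
        measurableSet_Ioi (fun τ hτ => congrArg ENNReal.ofReal (e τ hτ)),
      ← ofReal_integral_eq_lintegral_ofReal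
        (integrableOn_Ioi_rpow_of_lt (by norm_num) (by norm_num)),
      integral_Ioi_rpow_of_lt (by norm_num) (by norm_num)]
    · congr 1
      rw [show (-3 + 1 : ℝ) = ((-2 : ℤ) : ℝ) by norm_num, Real.rpow_intCast]
      norm_num
    · filter_upwards [self_mem_ae_restrict measurableSet_Ioi] with τ hτ
      exact Real.rpow_nonneg (le_trans (by norm_num) (le_of_lt hτ)) _
  rw [← hint, ← lintegral_mul_const _ (by fun_prop)]
  exact setLIntegral_congr_fun measurableSet_Ioi fun τ hτ =>
    lintegral_comp_smul_of_pos hG (lt_trans (by norm_num) hτ)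

lemma enorm_pow_four_comp_smul_le {w : ℝ³ → ℝ} (hw : ContDiff ℝ 1 w) (hc : HasCompactSupport w)
    {y : ℝ³} (hy : y ≠ 0) (t : ℝ) :
    ‖w (t • y)‖ₑ ^ 4 ≤
      ∫⁻ τ in Ici t, 4 * ‖y‖ₑ * (‖w (τ • y)‖ₑ ^ 3 * ‖fderiv ℝ w (τ • y)‖ₑ) := by
  obtain ⟨R, hR⟩ := hc.isCompact.isBounded.subset_closedBall (0 : ℝ³)
  have hy' : 0 < ‖y‖ := norm_pos_iff.2 hy
  set T := max t ((|R| + 1) / ‖y‖)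
  have hwT : w (T • y) = 0 := by
    by_contra hne
    have hmem := hR (subset_tsupport _ hne)
    rw [mem_closedBall_zero_iff, norm_smul] at hmem
    have h1 : |R| + 1 ≤ ‖T‖ * ‖y‖ := by
      rw [← div_le_iff₀ hy']
      exact (le_max_right _ _).trans (Real.le_norm_self _)
    linarith [le_abs_self R]
  have hg : ContDiff ℝ 1 fun τ : ℝ => w (τ • y) ^ 4 := by fun_prop
  have h1 := enorm_sub_le_lintegral_deriv_of_contDiffOn_Icc hg.contDiffOn
    (le_max_left t ((|R| + 1) / ‖y‖))
  change ‖w (T • y) ^ 4 - w (t • y) ^ 4‖ₑ ≤ _ at h1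
  rw [hwT, zero_pow four_ne_zero, zero_sub, enorm_neg, enorm_pow] at h1
  refine h1.trans ((lintegral_mono_set Icc_subset_Ici_self).trans (lintegral_mono fun τ => ?_))
  have hγ : HasDerivAt (fun τ : ℝ => τ • y) y τ := by
    simpa using (hasDerivAt_id τ).smul_const y
  have hd := (((hw.differentiable one_ne_zero) (τ • y)).hasFDerivAt.comp_hasDerivAt τ hγ).pow 4
  have hd' : deriv (fun τ : ℝ => w (τ • y) ^ 4) τ
      = 4 * w (τ • y) ^ 3 * fderiv ℝ w (τ • y) y := by
    refine hd.deriv.trans ?_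
    simp
  rw [hd', enorm_mul, enorm_mul, enorm_pow]
  calc _ ≤ ‖(4 : ℝ)‖ₑ * ‖w (τ • y)‖ₑ ^ 3 * (‖fderiv ℝ w (τ • y)‖ₑ * ‖y‖ₑ) := by
        gcongr
        exact ContinuousLinearMap.le_opENorm _ _
    _ = 4 * ‖y‖ₑ * (‖w (τ • y)‖ₑ ^ 3 * ‖fderiv ℝ w (τ • y)‖ₑ) := by
        rw [Real.enorm_eq_ofReal (by norm_num)]
        norm_num
        ring

lemma setLIntegral_ball_sphere_proj_le {w : ℝ³ → ℝ} (hw : ContDiff ℝ 1 w)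
    (hc : HasCompactSupport w) {x : ℝ³} (hx : x ≠ 0) :
    ∫⁻ y in ball x (‖x‖ / 2), ‖w ((‖x‖ / ‖y‖) • y)‖ₑ ^ 4 ≤
      ENNReal.ofReal (7 * ‖x‖) * ∫⁻ y, ‖w y‖ₑ ^ 3 * ‖fderiv ℝ w y‖ₑ := by
  have hx' : 0 < ‖x‖ := norm_pos_iff.2 hx
  set G : ℝ³ → ℝ≥0∞ := fun y => ‖w y‖ₑ ^ 3 * ‖fderiv ℝ w y‖ₑ
  have hG : Measurable G := by
    have h1 := hw.continuous.measurable
    have h2 := (hw.continuous_fderiv one_ne_zero).measurable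
    fun_prop
  have hpt : ∀ y ∈ ball x (‖x‖ / 2), ‖w ((‖x‖ / ‖y‖) • y)‖ₑ ^ 4 ≤
      ∫⁻ τ in Ioi (2 / 3 : ℝ), ENNReal.ofReal (6 * ‖x‖) * G (τ • y) := by
    intro y hy
    rw [mem_ball, dist_eq_norm] at hy
    have hlo : ‖x‖ / 2 < ‖y‖ := by
      have := norm_sub_norm_le x y
      rw [norm_sub_rev] at this
      linarith
    have hhi : ‖y‖ < 3 / 2 * ‖x‖ := by
      have := norm_sub_norm_le y x
      linarith
    have hy0 : 0 < ‖y‖ := by linarith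
    refine (enorm_pow_four_comp_smul_le hw hc (norm_pos_iff.1 hy0) (‖x‖ / ‖y‖)).trans ?_
    refine (lintegral_mono_set (Ici_subset_Ioi.2 ?_)).trans (lintegral_mono fun τ => ?_)
    · rw [lt_div_iff₀ hy0]
      linarith
    · refine mul_le_mul_left ?_ (G (τ • y))
      rw [← ofReal_norm, ← ENNReal.ofReal_ofNat 4, ← ENNReal.ofReal_mul (by norm_num)]
      exact ENNReal.ofReal_le_ofReal (by linarith)
  calc _ ≤ ∫⁻ y in ball x (‖x‖ / 2),
        ∫⁻ τ in Ioi (2 / 3 : ℝ), ENNReal.ofReal (6 * ‖x‖) * G (τ • y) :=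
        setLIntegral_mono' measurableSet_ball hpt
    _ ≤ ∫⁻ y, ∫⁻ τ in Ioi (2 / 3 : ℝ), ENNReal.ofReal (6 * ‖x‖) * G (τ • y) :=
        setLIntegral_le_lintegral _ _
    _ = ∫⁻ τ in Ioi (2 / 3 : ℝ), ∫⁻ y, ENNReal.ofReal (6 * ‖x‖) * G (τ • y) := by
        rw [lintegral_lintegral_swap]
        refine Measurable.aemeasurable ?_
        change Measurable fun p : ℝ³ × ℝ => ENNReal.ofReal (6 * ‖x‖) * G (p.2 • p.1)
        fun_prop
    _ = ENNReal.ofReal (6 * ‖x‖) * (ENNReal.ofReal (9 / 8) * ∫⁻ y, G y) := by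
        rw [← lintegral_Ioi_lintegral_comp_smul hG,
          ← lintegral_const_mul' _ _ ENNReal.ofReal_ne_top]
        simp_rw [lintegral_const_mul' _ _ ENNReal.ofReal_ne_top]
    _ ≤ ENNReal.ofReal (7 * ‖x‖) * ∫⁻ y, G y := by
        rw [← mul_assoc, ← ENNReal.ofReal_mul (by positivity)]
        gcongr ENNReal.ofReal ?_ * _
        linarith

lemma fderiv_apply_eq_sum_pd3 (u : ℝ³ → ℝ) (x a : ℝ³) :
    fderiv ℝ u x a = ∑ i, a i * pd3 i u x := by
  have ha : a = ∑ i, a i • EuclideanSpace.single i (1 : ℝ) := by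
    simpa using ((EuclideanSpace.basisFun (Fin 3) ℝ).sum_repr a).symm
  conv_lhs => rw [ha, map_sum]
  simp [pd3]

lemma norm_fderiv_le_sum_pd3 (u : ℝ³ → ℝ) (x : ℝ³) :
    ‖fderiv ℝ u x‖ ≤ ∑ i, |pd3 i u x| := by
  refine ContinuousLinearMap.opNorm_le_bound _ (by positivity) fun a => ?_
  rw [fderiv_apply_eq_sum_pd3, Finset.sum_mul]
  refine (norm_sum_le _ _).trans (Finset.sum_le_sum fun i _ => ?_)
  rw [norm_mul, mul_comm, Real.norm_eq_abs (pd3 i u x)]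
  gcongr
  exact PiLp.norm_apply_le a i

lemma norm_fderiv_sphere_proj_le {u : ℝ³ → ℝ} (hu : Differentiable ℝ u) {r : ℝ} (hr : 0 < r)
    {y : ℝ³} (hy : y ≠ 0) :
    ‖fderiv ℝ (fun z => u ((r / ‖z‖) • z)) y‖ ≤
      2 / ‖y‖ * (|rot3 0 1 u ((r / ‖y‖) • y)| + |rot3 0 2 u ((r / ‖y‖) • y)| +
        |rot3 1 2 u ((r / ‖y‖) • y)|) := by
  have hy0 : 0 < ‖y‖ := norm_pos_iff.2 hy
  refine ContinuousLinearMap.opNorm_le_bound _ (by positivity) fun a => ?_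
  have hline : HasDerivAt (fun s : ℝ => y + s • a) a 0 := by
    simpa using ((hasDerivAt_id (0 : ℝ)).smul_const a).const_add y
  have hnsq : HasDerivAt (fun s : ℝ => ‖y + s • a‖ ^ 2) (2 * inner ℝ y a) 0 := by
    simpa using hline.norm_sq
  have hn : HasDerivAt (fun s : ℝ => ‖y + s • a‖) (inner ℝ y a / ‖y‖) 0 := by
    have h := hnsq.sqrt (by simpa using hy)
    simp only [Real.sqrt_sq (norm_nonneg _), zero_smul, add_zero] at h
    convert h using 1
    field_simp
  have hcoef : HasDerivAt (fun s : ℝ => r / ‖y + s • a‖)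
      (-(r * inner ℝ y a / ‖y‖ ^ 3)) 0 := by
    have h := (hasDerivAt_const (0 : ℝ) r).div hn (by simpa using hy)
    refine h.congr_deriv ?_
    simp only [zero_smul, add_zero]
    field_simp
    ring
  have hpath : HasDerivAt (fun s : ℝ => (r / ‖y + s • a‖) • (y + s • a))
      ((r / ‖y‖) • a + (-(r * inner ℝ y a / ‖y‖ ^ 3)) • y) 0 := by
    refine (hcoef.smul hline).congr_deriv ?_
    simp
  have hU : DifferentiableAt ℝ (fun z : ℝ³ => u ((r / ‖z‖) • z)) y := by
    have h1 : DifferentiableAt ℝ (fun z : ℝ³ => ‖z‖) y :=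
      (differentiableAt_fun_id (𝕜 := ℝ)).norm ℝ hy
    have h2 : DifferentiableAt ℝ (fun z : ℝ³ => (r / ‖z‖) • z) y :=
      ((h1.fun_inv hy0.ne').const_mul r).fun_smul differentiableAt_fun_id
    exact (hu _).comp y h2
  have hyy : y = y + (0 : ℝ) • a := by simp
  have hz : (r / ‖y‖) • y = (r / ‖y + (0 : ℝ) • a‖) • (y + (0 : ℝ) • a) := by simp
  have hl := (hyy ▸ hU.hasFDerivAt : HasFDerivAt (fun z : ℝ³ => u ((r / ‖z‖) • z))
    (fderiv ℝ (fun z : ℝ³ => u ((r / ‖z‖) • z)) y) (y + (0 : ℝ) • a)).comp_hasDerivAt 0 hline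
  have hr' := (hz ▸ (hu ((r / ‖y‖) • y)).hasFDerivAt : HasFDerivAt u
    (fderiv ℝ u ((r / ‖y‖) • y))
    ((r / ‖y + (0 : ℝ) • a‖) • (y + (0 : ℝ) • a))).comp_hasDerivAt 0 hpath
  have hsq : ‖y‖ ^ 2 = y 0 ^ 2 + y 1 ^ 2 + y 2 ^ 2 := by
    rw [EuclideanSpace.real_norm_sq_eq, Fin.sum_univ_three]
  have hin : inner ℝ y a = y 0 * a 0 + y 1 * a 1 + y 2 * a 2 := by
    simp [PiLp.inner_apply, Fin.sum_univ_three, mul_comm]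
  have hmain : fderiv ℝ (fun z : ℝ³ => u ((r / ‖z‖) • z)) y a = 1 / ‖y‖ ^ 2 *
      ((y 0 * a 1 - y 1 * a 0) * rot3 0 1 u ((r / ‖y‖) • y) +
       (y 0 * a 2 - y 2 * a 0) * rot3 0 2 u ((r / ‖y‖) • y) +
       (y 1 * a 2 - y 2 * a 1) * rot3 1 2 u ((r / ‖y‖) • y)) := by
    rw [hl.unique hr', fderiv_apply_eq_sum_pd3, Fin.sum_univ_three]
    simp only [rot3, PiLp.add_apply, PiLp.smul_apply, smul_eq_mul]
    generalize pd3 0 u ((r / ‖y‖) • y) = p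
    generalize pd3 1 u ((r / ‖y‖) • y) = q
    generalize pd3 2 u ((r / ‖y‖) • y) = s
    rw [hin]
    field_simp
    rw [hsq]
    ring
  have hcomp : ∀ i j : Fin 3, |y i * a j - y j * a i| ≤ 2 * (‖y‖ * ‖a‖) := by
    intro i j
    have h1 : |y i * a j| ≤ ‖y‖ * ‖a‖ := by
      rw [abs_mul]
      exact mul_le_mul (PiLp.norm_apply_le y i) (PiLp.norm_apply_le a j) (abs_nonneg _)
        (norm_nonneg _)
    have h2 : |y j * a i| ≤ ‖y‖ * ‖a‖ := by
      rw [abs_mul]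
      exact mul_le_mul (PiLp.norm_apply_le y j) (PiLp.norm_apply_le a i) (abs_nonneg _)
        (norm_nonneg _)
    linarith [abs_sub (y i * a j) (y j * a i)]
  rw [hmain, Real.norm_eq_abs, abs_mul, abs_of_pos (by positivity : 0 < 1 / ‖y‖ ^ 2)]
  calc _ ≤ 1 / ‖y‖ ^ 2 * (2 * (‖y‖ * ‖a‖) * |rot3 0 1 u ((r / ‖y‖) • y)| +
        2 * (‖y‖ * ‖a‖) * |rot3 0 2 u ((r / ‖y‖) • y)| +
        2 * (‖y‖ * ‖a‖) * |rot3 1 2 u ((r / ‖y‖) • y)|) := by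
        gcongr
        refine (abs_add_three _ _ _).trans ?_
        simp only [abs_mul (_ - _)]
        gcongr <;> exact hcomp _ _
    _ = _ := by
        field_simp

lemma contDiff_pd3 {u : ℝ³ → ℝ} (hu : ContDiff ℝ (⊤ : ℕ∞) u) (i : Fin 3) :
    ContDiff ℝ (⊤ : ℕ∞) (pd3 i u) :=
  (hu.fderiv_right (m := (⊤ : ℕ∞)) (by norm_cast)).clm_apply contDiff_const

lemma contDiff_rot3 {u : ℝ³ → ℝ} (hu : ContDiff ℝ (⊤ : ℕ∞) u) (i j : Fin 3) :
    ContDiff ℝ (⊤ : ℕ∞) (rot3 i j u) := by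
  have h1 := contDiff_pd3 hu i
  have h2 := contDiff_pd3 hu j
  unfold rot3
  fun_prop

lemma hasCompactSupport_pd3 {u : ℝ³ → ℝ} (hu : HasCompactSupport u) (i : Fin 3) :
    HasCompactSupport (pd3 i u) :=
  hu.fderiv_apply ℝ _

lemma hasCompactSupport_rot3 {u : ℝ³ → ℝ} (hu : HasCompactSupport u) (i j : Fin 3) :
    HasCompactSupport (rot3 i j u) :=
  ((hasCompactSupport_pd3 hu j).mul_left (f := fun x : ℝ³ => x i)).sub
    ((hasCompactSupport_pd3 hu i).mul_left (f := fun x : ℝ³ => x j))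

lemma gradL2_nonneg (w : ℝ³ → ℝ) : 0 ≤ gradL2 w :=
  Real.rpow_nonneg (integral_nonneg fun _ => by positivity) _

lemma lintegral_enorm_fderiv_sq_eq {w : ℝ³ → ℝ} (hw : ContDiff ℝ 1 w) (hc : HasCompactSupport w) :
    ∫⁻ x, ‖fderiv ℝ w x‖ₑ ^ 2 = ENNReal.ofReal (gradL2 w) ^ 2 := by
  have hcont := hw.continuous_fderiv one_ne_zero
  have hint : Integrable fun x => ‖fderiv ℝ w x‖ ^ 2 := by
    refine Continuous.integrable_of_hasCompactSupport (by fun_prop) ?_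
    exact (hc.fderiv (𝕜 := ℝ)).comp_left (g := fun z => ‖z‖ ^ 2) (by simp)
  rw [← ENNReal.ofReal_pow (gradL2_nonneg w), gradL2, ← Real.sqrt_eq_rpow,
    Real.sq_sqrt (integral_nonneg fun _ => by positivity),
    ofReal_integral_eq_lintegral_ofReal hint (Filter.Eventually.of_forall fun _ => by positivity)]
  simp only [ENNReal.ofReal_pow (norm_nonneg _), ofReal_norm]

lemma ENNReal.add_four_pow_four_le (a b c d : ℝ≥0∞) :
    (a + b + c + d) ^ 4 ≤ 256 * (a ^ 4 + b ^ 4 + c ^ 4 + d ^ 4) := by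
  have two : ∀ a b : ℝ≥0∞, (a + b) ^ 4 ≤ 16 * (a ^ 4 + b ^ 4) := by
    intro a b
    rcases le_total a b with h | h
    · calc (a + b) ^ 4 ≤ (b + b) ^ 4 := by gcongr
        _ = 16 * b ^ 4 := by ring
        _ ≤ _ := by gcongr; exact le_add_self
    · calc (a + b) ^ 4 ≤ (a + a) ^ 4 := by gcongr
        _ = 16 * a ^ 4 := by ring
        _ ≤ _ := by gcongr; exact le_self_add
  calc (a + b + c + d) ^ 4 = ((a + b) + (c + d)) ^ 4 := by ring
    _ ≤ 16 * (16 * (a ^ 4 + b ^ 4) + 16 * (c ^ 4 + d ^ 4)) :=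
      (two _ _).trans (by gcongr <;> exact two _ _)
    _ = _ := by ring

lemma exists_enorm_pow_four_le :
    ∃ K : ℝ≥0, ∀ u : ℝ³ → ℝ, ContDiff ℝ (⊤ : ℕ∞) u → HasCompactSupport u → ∀ x : ℝ³, ∀ N : ℝ,
      gradL2 u ≤ N → (∀ i, gradL2 (pd3 i u) ≤ N) →
      ‖u x‖ₑ ^ 4 ≤ K * ENNReal.ofReal N ^ 4 := by
  obtain ⟨K, hK⟩ := exists_setLIntegral_ball_enorm_pow_four_le
  refine ⟨640000 * K, fun u hu hc x N hN hNi => ?_⟩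
  have hu1 : ContDiff ℝ 1 u := hu.of_le (by norm_cast)
  have hp1 : ∀ i, ContDiff ℝ 1 (pd3 i u) := fun i =>
    (contDiff_pd3 hu i).of_le (by norm_cast)
  have hbd : ∀ w : ℝ³ → ℝ, ContDiff ℝ 1 w → HasCompactSupport w → gradL2 w ≤ N →
      ∫⁻ y in ball x 1, ‖w y‖ₑ ^ 4 ≤ K * ENNReal.ofReal N ^ 4 := by
    intro w hw hwc hwN
    refine (hK w hw hwc x).trans ?_
    rw [lintegral_enorm_fderiv_sq_eq hw hwc, ← pow_mul]
    gcongr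
  have hm := hu1.continuous.measurable
  have hmi := fun i => (hp1 i).continuous.measurable
  have hmor := enorm_pow_four_mul_volume_ball_le (F := u) (x := x) one_pos hu1.contDiffOn
    (H := fun y => ‖u y‖ₑ + ‖pd3 0 u y‖ₑ + ‖pd3 1 u y‖ₑ + ‖pd3 2 u y‖ₑ) (by fun_prop)
    (fun y _ => by simp only [add_assoc]; exact le_self_add)
    (fun y _ => by
      have h := norm_fderiv_le_sum_pd3 u y
      rw [Fin.sum_univ_three] at h
      have h' := ENNReal.ofReal_le_ofReal h
      rw [ENNReal.ofReal_add (by positivity) (by positivity),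
        ENNReal.ofReal_add (by positivity) (by positivity), ofReal_norm] at h'
      simp only [← Real.enorm_eq_ofReal_abs] at h'
      rw [ENNReal.ofReal_one, one_mul]
      refine h'.trans ?_
      simp only [add_assoc]
      exact le_add_self)
  have hvol : 1 ≤ volume (ball x 1) := by
    rw [EuclideanSpace.volume_ball_fin_three, ENNReal.ofReal_one, one_pow, one_mul,
      ← ENNReal.ofReal_one]
    exact ENNReal.ofReal_le_ofReal (by linarith [Real.pi_gt_three])
  calc ‖u x‖ₑ ^ 4 ≤ ‖u x‖ₑ ^ 4 * volume (ball x 1) := le_mul_of_one_le_right' hvol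
    _ ≤ 625 * ∫⁻ y in ball x 1, 256 * (‖u y‖ₑ ^ 4 + ‖pd3 0 u y‖ₑ ^ 4 + ‖pd3 1 u y‖ₑ ^ 4 +
        ‖pd3 2 u y‖ₑ ^ 4) := by
      refine hmor.trans ?_
      gcongr
      exact ENNReal.add_four_pow_four_le _ _ _ _
    _ = 625 * (256 * ((∫⁻ y in ball x 1, ‖u y‖ₑ ^ 4) + (∫⁻ y in ball x 1, ‖pd3 0 u y‖ₑ ^ 4) +
        (∫⁻ y in ball x 1, ‖pd3 1 u y‖ₑ ^ 4) + ∫⁻ y in ball x 1, ‖pd3 2 u y‖ₑ ^ 4)) := by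
      rw [lintegral_const_mul _ (by fun_prop), lintegral_add_left (by fun_prop),
        lintegral_add_left (by fun_prop), lintegral_add_left (by fun_prop)]
    _ ≤ 625 * (256 * (K * ENNReal.ofReal N ^ 4 + K * ENNReal.ofReal N ^ 4 +
        K * ENNReal.ofReal N ^ 4 + K * ENNReal.ofReal N ^ 4)) := by
      gcongr
      · exact hbd u hu1 hc hN
      all_goals exact hbd _ (hp1 _) (hasCompactSupport_pd3 hc _) (hNi _)
    _ = _ := by
      push_cast
      ring

lemma exists_norm_sq_mul_enorm_pow_four_le :
    ∃ K : ℝ≥0, ∀ u : ℝ³ → ℝ, ContDiff ℝ (⊤ : ℕ∞) u → HasCompactSupport u → ∀ x : ℝ³, ∀ N : ℝ,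
      gradL2 u ≤ N → (∀ i j, i < j → gradL2 (rot3 i j u) ≤ N) →
      ENNReal.ofReal ‖x‖ ^ 2 * ‖u x‖ₑ ^ 4 ≤ K * ENNReal.ofReal N ^ 4 := by
  obtain ⟨K, hK⟩ := exists_lintegral_enorm_pow_three_mul_le
  refine ⟨2 * 7 * 7840000 * K, fun u hu hc x N hN hNi => ?_⟩
  rcases eq_or_ne x 0 with rfl | hx
  · simp
  have hx' : 0 < ‖x‖ := norm_pos_iff.2 hx
  have hu1 : ContDiff ℝ 1 u := hu.of_le (by norm_cast)
  have hp1 : ∀ i j, ContDiff ℝ 1 (rot3 i j u) := fun i j =>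
    (contDiff_rot3 hu i j).of_le (by norm_cast)
  set P : ℝ³ → ℝ³ := fun y => (‖x‖ / ‖y‖) • y with hP
  have hPm : Measurable P := by fun_prop
  set M := ENNReal.ofReal (7 * ‖x‖) * (K * ENNReal.ofReal N ^ 4) with hM
  set B := ball x (‖x‖ / 2) with hB
  have hbd : ∀ w : ℝ³ → ℝ, ContDiff ℝ 1 w → HasCompactSupport w → gradL2 w ≤ N →
      ∫⁻ y in B, ‖w (P y)‖ₑ ^ 4 ≤ M := by
    intro w hw hwc hwN
    refine (setLIntegral_ball_sphere_proj_le hw hwc hx).trans ?_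
    rw [hM]
    gcongr
    refine (hK w hw hwc).trans ?_
    rw [lintegral_enorm_fderiv_sq_eq hw hwc, ← pow_mul]
    gcongr
  have hbdr : ∀ i j, i < j → ∫⁻ y in B, ‖rot3 i j u (P y)‖ₑ ^ 4 ≤ M := fun i j hij =>
    hbd _ (hp1 i j) (hasCompactSupport_rot3 hc i j) (hNi i j hij)
  have hm := hu1.continuous.measurable
  have hmi := fun i j => (hp1 i j).continuous.measurable
  have hylo : ∀ y ∈ B, ‖x‖ / 2 < ‖y‖ := by
    intro y hy
    rw [hB, mem_ball, dist_eq_norm] at hy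
    have := norm_sub_norm_le x y
    rw [norm_sub_rev] at this
    linarith
  have hcd : ContDiffOn ℝ 1 (fun y => u (P y)) B := by
    intro y hy
    have hy0 : y ≠ 0 := norm_pos_iff.1 (by linarith [hylo y hy])
    have h1 : ContDiffAt ℝ 1 (fun z : ℝ³ => ‖z‖) y := contDiffAt_norm ℝ hy0
    have h2 : ContDiffAt ℝ 1 P y :=
      (contDiffAt_const.div h1 (norm_ne_zero_iff.2 hy0)).smul contDiffAt_id
    exact (hu1.contDiffAt.comp y h2).contDiffWithinAt
  have hmor := enorm_pow_four_mul_volume_ball_le (F := fun y => u (P y)) (x := x)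
    (half_pos hx') hcd
    (H := fun y => ‖u (P y)‖ₑ + 2 * ‖rot3 0 1 u (P y)‖ₑ + 2 * ‖rot3 0 2 u (P y)‖ₑ +
      2 * ‖rot3 1 2 u (P y)‖ₑ) (by fun_prop)
    (fun y _ => by simp only [add_assoc]; exact le_self_add)
    (fun y hy => by
      have hy' := hylo y hy
      have hy0 : 0 < ‖y‖ := by linarith
      have h := norm_fderiv_sphere_proj_le (hu1.differentiable one_ne_zero) hx'
        (norm_pos_iff.1 hy0)
      have h2 : ‖x‖ / 2 * ‖fderiv ℝ (fun y => u (P y)) y‖ ≤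
          2 * |rot3 0 1 u (P y)| + 2 * |rot3 0 2 u (P y)| + 2 * |rot3 1 2 u (P y)| := by
        refine (mul_le_mul_of_nonneg_left h (half_pos hx').le).trans ?_
        rw [← mul_assoc, ← mul_add, ← mul_add]
        gcongr
        rw [mul_div_assoc', div_le_iff₀ hy0]
        linarith
      have h' := ENNReal.ofReal_le_ofReal h2
      rw [ENNReal.ofReal_add (by positivity) (by positivity),
        ENNReal.ofReal_add (by positivity) (by positivity),
        ENNReal.ofReal_mul (by positivity), ENNReal.ofReal_mul (by positivity),
        ENNReal.ofReal_mul (by positivity), ENNReal.ofReal_mul (by positivity), ofReal_norm,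
        ENNReal.ofReal_ofNat] at h'
      simp only [← Real.enorm_eq_ofReal_abs] at h'
      refine h'.trans ?_
      simp only [add_assoc]
      exact le_add_self)
  have hPx : P x = x := by simp [hP, div_self hx'.ne']
  have hvol : ENNReal.ofReal (‖x‖ ^ 3 / 2) ≤ volume B := by
    rw [hB, EuclideanSpace.volume_ball_fin_three, ← ENNReal.ofReal_pow (by positivity),
      ← ENNReal.ofReal_mul (by positivity)]
    refine ENNReal.ofReal_le_ofReal ?_
    nlinarith [Real.pi_gt_three, pow_pos hx' 3]
  have hchain : ‖u x‖ₑ ^ 4 * ENNReal.ofReal (‖x‖ ^ 3 / 2) ≤ 7840000 * M := by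
    calc ‖u x‖ₑ ^ 4 * ENNReal.ofReal (‖x‖ ^ 3 / 2) ≤ ‖u (P x)‖ₑ ^ 4 * volume B := by
          rw [hPx]
          gcongr
      _ ≤ 625 * ∫⁻ y in B, 256 * (‖u (P y)‖ₑ ^ 4 + 16 * ‖rot3 0 1 u (P y)‖ₑ ^ 4 +
          16 * ‖rot3 0 2 u (P y)‖ₑ ^ 4 + 16 * ‖rot3 1 2 u (P y)‖ₑ ^ 4) := by
        refine hmor.trans ?_
        gcongr with y
        refine (ENNReal.add_four_pow_four_le _ _ _ _).trans_eq ?_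
        ring
      _ = 625 * (256 * ((∫⁻ y in B, ‖u (P y)‖ₑ ^ 4) +
          16 * (∫⁻ y in B, ‖rot3 0 1 u (P y)‖ₑ ^ 4) +
          16 * (∫⁻ y in B, ‖rot3 0 2 u (P y)‖ₑ ^ 4) +
          16 * ∫⁻ y in B, ‖rot3 1 2 u (P y)‖ₑ ^ 4)) := by
        rw [lintegral_const_mul _ (by fun_prop), lintegral_add_left (by fun_prop),
          lintegral_add_left (by fun_prop), lintegral_add_left (by fun_prop),
          lintegral_const_mul _ (by fun_prop), lintegral_const_mul _ (by fun_prop),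
          lintegral_const_mul _ (by fun_prop)]
      _ ≤ 625 * (256 * (M + 16 * M + 16 * M + 16 * M)) := by
        gcongr
        exacts [hbd u hu1 hc hN, hbdr 0 1 (by decide), hbdr 0 2 (by decide), hbdr 1 2 (by decide)]
      _ = _ := by ring
  have hr0 : ENNReal.ofReal ‖x‖ ≠ 0 := by simpa using hx
  refine (ENNReal.mul_le_mul_iff_left hr0 ENNReal.ofReal_ne_top).1 ?_
  have e3 : ENNReal.ofReal ‖x‖ ^ 3 = 2 * ENNReal.ofReal (‖x‖ ^ 3 / 2) := by
    have h := ENNReal.ofReal_mul (q := ‖x‖ ^ 3 / 2) (zero_le_two : (0 : ℝ) ≤ 2)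
    rwa [mul_div_cancel₀ _ two_ne_zero, ENNReal.ofReal_ofNat, ENNReal.ofReal_pow hx'.le] at h
  calc ENNReal.ofReal ‖x‖ ^ 2 * ‖u x‖ₑ ^ 4 * ENNReal.ofReal ‖x‖
      = ‖u x‖ₑ ^ 4 * ENNReal.ofReal ‖x‖ ^ 3 := by ring
    _ = 2 * (‖u x‖ₑ ^ 4 * ENNReal.ofReal (‖x‖ ^ 3 / 2)) := by rw [e3]; ring
    _ ≤ 2 * (7840000 * M) := by gcongr
    _ = _ := by
      rw [hM, ENNReal.ofReal_mul (by norm_num), ENNReal.ofReal_ofNat]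
      push_cast
      ring

end WeightedSobolev

/-- Weighted Sobolev estimate: `⟨|x|⟩^(1/2) |u(x)| ≤ C Σ_{|α|≤1} ‖∂ Γ^α u‖_{L²}`
with `Γ` ranging over the spatial derivatives and rotations. -/
theorem stmt_9 :
    ∃ C : ℝ, 0 < C ∧ ∀ u : EuclideanSpace ℝ (Fin 3) → ℝ,
      ContDiff ℝ (⊤ : ℕ∞) u → HasCompactSupport u →
      ∀ x : EuclideanSpace ℝ (Fin 3),
        Real.sqrt (1 + ‖x‖ ^ 2) ^ ((1 : ℝ) / 2) * |u x| ≤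
          C * (gradL2 u + (∑ i : Fin 3, gradL2 (pd3 i u)) +
            ∑ i : Fin 3, ∑ j : Fin 3, if i < j then gradL2 (rot3 i j u) else 0) := by
  obtain ⟨K₁, h₁⟩ := exists_enorm_pow_four_le
  obtain ⟨K₂, h₂⟩ := exists_norm_sq_mul_enorm_pow_four_le
  refine ⟨1 + K₁ + K₂, by positivity, fun u hu hc x => ?_⟩
  obtain ⟨N, hN⟩ : ∃ N, N = gradL2 u + (∑ i : Fin 3, gradL2 (pd3 i u)) +
    ∑ i : Fin 3, ∑ j : Fin 3, if i < j then gradL2 (rot3 i j u) else 0 := ⟨_, rfl⟩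
  rw [← hN]
  have hterm : ∀ i j : Fin 3, 0 ≤ if i < j then gradL2 (rot3 i j u) else 0 := fun i j => by
    split_ifs
    exacts [gradL2_nonneg _, le_rfl]
  have hrow : ∀ i : Fin 3, 0 ≤ ∑ j : Fin 3, if i < j then gradL2 (rot3 i j u) else 0 :=
    fun i => Finset.sum_nonneg fun j _ => hterm i j
  have hu0 := gradL2_nonneg u
  have hpd := Finset.sum_nonneg fun (i : Fin 3) (_ : i ∈ Finset.univ) => gradL2_nonneg (pd3 i u)
  have hrot := Finset.sum_nonneg fun (i : Fin 3) (_ : i ∈ Finset.univ) => hrow i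
  have hN0 : 0 ≤ N := by linarith
  have hNu : gradL2 u ≤ N := by linarith
  have hNp : ∀ i, gradL2 (pd3 i u) ≤ N := fun i => by
    have := Finset.single_le_sum (fun (k : Fin 3) _ => gradL2_nonneg (pd3 k u))
      (Finset.mem_univ i)
    linarith
  have hNr : ∀ i j, i < j → gradL2 (rot3 i j u) ≤ N := fun i j hij => by
    have h1 := Finset.single_le_sum (fun (k : Fin 3) _ => hterm i k) (Finset.mem_univ j)
    have h2 := Finset.single_le_sum (fun (k : Fin 3) _ => hrow k) (Finset.mem_univ i)
    rw [if_pos hij] at h1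
    linarith
  have hreal : ∀ {a : ℝ} {K : NNReal}, 0 ≤ a →
      ENNReal.ofReal a * ‖u x‖ₑ ^ 4 ≤ K * ENNReal.ofReal N ^ 4 → a * |u x| ^ 4 ≤ K * N ^ 4 := by
    intro a K ha h
    rw [Real.enorm_eq_ofReal_abs, ← ENNReal.ofReal_pow (abs_nonneg _),
      ← ENNReal.ofReal_pow hN0, ← ENNReal.ofReal_mul ha, ← ENNReal.ofReal_coe_nnreal,
      ← ENNReal.ofReal_mul K.coe_nonneg] at h
    exact (ENNReal.ofReal_le_ofReal_iff (by positivity)).1 h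
  have e₁ : 1 * |u x| ^ 4 ≤ K₁ * N ^ 4 :=
    hreal zero_le_one (by simpa using h₁ u hu hc x N hNu hNp)
  have e₂ : ‖x‖ ^ 2 * |u x| ^ 4 ≤ K₂ * N ^ 4 :=
    hreal (by positivity)
      (by simpa [ENNReal.ofReal_pow] using h₂ u hu hc x N hNu hNr)
  have hweight : (Real.sqrt (1 + ‖x‖ ^ 2) ^ ((1 : ℝ) / 2)) ^ 4 = 1 + ‖x‖ ^ 2 := by
    rw [← Real.sqrt_eq_rpow, show 4 = 2 * 2 from rfl, pow_mul, Real.sq_sqrt (Real.sqrt_nonneg _),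
      Real.sq_sqrt (by positivity)]
  refine le_of_pow_le_pow_left₀ four_ne_zero (by positivity) ?_
  rw [mul_pow, mul_pow, hweight]
  have hC : (1 : ℝ) + K₁ + K₂ ≤ (1 + K₁ + K₂) ^ 4 :=
    le_self_pow₀ (by linarith [K₁.coe_nonneg, K₂.coe_nonneg]) four_ne_zero
  calc (1 + ‖x‖ ^ 2) * |u x| ^ 4 ≤ (1 + K₁ + K₂) * N ^ 4 := by
        nlinarith [pow_nonneg hN0 4]
    _ ≤ _ := by gcongr
end

section
/- Weighted Sobolev decay: there exists C such that for smooth compactly supported u : ℝ³ → ℝ, ⟨|x|⟩ |∂u(x)| ≤ C Σ_{|α| ≤ 2} ‖∂ Γ^α u‖_{L²(ℝ³)}, where Γ^α ranges over products of at most two of the fields (∂₁, ∂₂, ∂₃, Ω₁₂, Ω₁₃, Ω₂₃). -/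
open MeasureTheory

/-- The six vector fields `(∂₁, ∂₂, ∂₃, Ω₁₂, Ω₁₃, Ω₂₃)`, indexed by
translations and ordered pairs of rotations. -/
noncomputable def gfield3 (a : Fin 3 ⊕ {p : Fin 3 × Fin 3 // p.1 < p.2})
    (u : EuclideanSpace ℝ (Fin 3) → ℝ) : EuclideanSpace ℝ (Fin 3) → ℝ :=
  match a with
  | Sum.inl i => pd3 i u
  | Sum.inr p => rot3 p.val.1 p.val.2 u

/-- The index set of the fields `∂₁, ∂₂, ∂₃, Ω₁₂, Ω₁₃, Ω₂₃`. -/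
abbrev FieldIndex := Fin 3 ⊕ {p : Fin 3 × Fin 3 // p.1 < p.2}

/-- The vector at `y` of the field with index `a`. -/
noncomputable def fieldVec (a : FieldIndex) (y : EuclideanSpace ℝ (Fin 3)) :
    EuclideanSpace ℝ (Fin 3) :=
  match a with
  | Sum.inl i => EuclideanSpace.single i 1
  | Sum.inr p => y p.val.1 • EuclideanSpace.single p.val.2 1
      - y p.val.2 • EuclideanSpace.single p.val.1 1

/-- The linear part of the affine field with index `a`. -/
noncomputable def fieldLin (a : FieldIndex) :
    EuclideanSpace ℝ (Fin 3) →L[ℝ] EuclideanSpace ℝ (Fin 3) :=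
  match a with
  | Sum.inl _ => 0
  | Sum.inr p =>
      (EuclideanSpace.proj p.val.1 : EuclideanSpace ℝ (Fin 3) →L[ℝ] ℝ).smulRight
        (EuclideanSpace.single p.val.2 1)
      - (EuclideanSpace.proj p.val.2 : EuclideanSpace ℝ (Fin 3) →L[ℝ] ℝ).smulRight
        (EuclideanSpace.single p.val.1 1)

/-- The derivative of `u` in the constant direction `v`. -/
noncomputable def dirDeriv (v : EuclideanSpace ℝ (Fin 3)) (u : EuclideanSpace ℝ (Fin 3) → ℝ) :
    EuclideanSpace ℝ (Fin 3) → ℝ :=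
  fun x => fderiv ℝ u x v

lemma gfield3_apply (a : FieldIndex) (u : EuclideanSpace ℝ (Fin 3) → ℝ)
    (x : EuclideanSpace ℝ (Fin 3)) : gfield3 a u x = fderiv ℝ u x (fieldVec a x) := by
  rcases a with i | p
  · rfl
  · simp [gfield3, fieldVec, rot3, pd3]

lemma hasFDerivAt_fieldVec (a : FieldIndex) (x : EuclideanSpace ℝ (Fin 3)) :
    HasFDerivAt (fieldVec a) (fieldLin a) x := by
  rcases a with i | p
  · exact hasFDerivAt_const _ _
  · exact (fieldLin (Sum.inr p)).hasFDerivAt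

lemma norm_fieldLin_le (a : FieldIndex) (v : EuclideanSpace ℝ (Fin 3)) :
    ‖fieldLin a v‖ ≤ 2 * ‖v‖ := by
  rcases a with i | p
  · simp [fieldLin]
  · have h1 := PiLp.norm_apply_le v p.val.1
    have h2 := PiLp.norm_apply_le v p.val.2
    have h3 := norm_sub_le (v p.val.1 • EuclideanSpace.single p.val.2 (1 : ℝ))
      (v p.val.2 • EuclideanSpace.single p.val.1 (1 : ℝ))
    simp only [norm_smul, PiLp.norm_single, norm_one, mul_one] at h3
    have h4 : fieldLin (Sum.inr p) v = v p.val.1 • EuclideanSpace.single p.val.2 (1 : ℝ)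
      - v p.val.2 • EuclideanSpace.single p.val.1 (1 : ℝ) := rfl
    rw [h4]
    linarith

lemma contDiff_fieldVec (a : FieldIndex) : ContDiff ℝ (⊤ : ℕ∞) (fieldVec a) := by
  rcases a with i | p
  · exact contDiff_const
  · exact (fieldLin (Sum.inr p)).contDiff

lemma ContDiff.gfield3 {u : EuclideanSpace ℝ (Fin 3) → ℝ} (hu : ContDiff ℝ (⊤ : ℕ∞) u)
    (a : FieldIndex) : ContDiff ℝ (⊤ : ℕ∞) (gfield3 a u) := by
  rw [show _root_.gfield3 a u = fun x => fderiv ℝ u x (fieldVec a x) from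
    funext (gfield3_apply a u)]
  exact (hu.fderiv_right (by simp)).clm_apply (contDiff_fieldVec a)

lemma HasCompactSupport.gfield3 {u : EuclideanSpace ℝ (Fin 3) → ℝ} (hu : HasCompactSupport u)
    (a : FieldIndex) : HasCompactSupport (gfield3 a u) := by
  refine (hu.fderiv (𝕜 := ℝ)).mono fun x hx => ?_
  contrapose! hx
  rw [Function.notMem_support] at hx ⊢
  rw [gfield3_apply, hx, zero_apply]

lemma ContDiff.dirDeriv {u : EuclideanSpace ℝ (Fin 3) → ℝ} (hu : ContDiff ℝ (⊤ : ℕ∞) u)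
    (v : EuclideanSpace ℝ (Fin 3)) : ContDiff ℝ (⊤ : ℕ∞) (dirDeriv v u) :=
  (hu.fderiv_right (by simp)).clm_apply contDiff_const

lemma gfield3_sub {f g : EuclideanSpace ℝ (Fin 3) → ℝ} (hf : ContDiff ℝ (⊤ : ℕ∞) f)
    (hg : ContDiff ℝ (⊤ : ℕ∞) g) (a : FieldIndex) :
    gfield3 a (f - g) = gfield3 a f - gfield3 a g := by
  ext x
  simp only [gfield3_apply, Pi.sub_apply]
  rw [fderiv_sub (hf.differentiable (by simp) x) (hg.differentiable (by simp) x)]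
  rfl

lemma gfield3_dirDeriv {u : EuclideanSpace ℝ (Fin 3) → ℝ} (hu : ContDiff ℝ (⊤ : ℕ∞) u)
    (a : FieldIndex) (v : EuclideanSpace ℝ (Fin 3)) :
    gfield3 a (dirDeriv v u) = dirDeriv v (gfield3 a u) - dirDeriv (fieldLin a v) u := by
  ext x
  have hd : DifferentiableAt ℝ (fderiv ℝ u) x :=
    (hu.fderiv_right (m := (⊤ : ℕ∞)) (by simp)).differentiable (by simp) x
  have he : gfield3 a u = fun x => fderiv ℝ u x (fieldVec a x) := funext (gfield3_apply a u)
  have h1 := hd.hasFDerivAt.clm_apply (hasFDerivAt_fieldVec a x)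
  have h2 := hd.hasFDerivAt.clm_apply (hasFDerivAt_const v x)
  have hs : IsSymmSndFDerivAt ℝ u x :=
    hu.contDiffAt.isSymmSndFDerivAt (by simpa using WithTop.coe_le_coe.2 (le_top : (2 : ℕ∞) ≤ ⊤))
  simp only [Pi.sub_apply]
  rw [gfield3_apply, he]
  unfold dirDeriv
  rw [h1.fderiv, h2.fderiv]
  simp [hs.eq v (fieldVec a x)]

lemma gfield3_gfield3_dirDeriv {u : EuclideanSpace ℝ (Fin 3) → ℝ}
    (hu : ContDiff ℝ (⊤ : ℕ∞) u) (a b : FieldIndex) (v : EuclideanSpace ℝ (Fin 3)) :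
    gfield3 b (gfield3 a (dirDeriv v u)) =
      dirDeriv v (gfield3 b (gfield3 a u)) - dirDeriv (fieldLin b v) (gfield3 a u)
        - (dirDeriv (fieldLin a v) (gfield3 b u) - dirDeriv (fieldLin b (fieldLin a v)) u) := by
  rw [gfield3_dirDeriv hu, gfield3_sub ((hu.gfield3 a).dirDeriv v) (hu.dirDeriv _),
    gfield3_dirDeriv (hu.gfield3 a), gfield3_dirDeriv hu]

/-- The pointwise third order energy density of `u`. -/
noncomputable def gradSum (u : EuclideanSpace ℝ (Fin 3) → ℝ) (x : EuclideanSpace ℝ (Fin 3)) : ℝ :=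
  ‖fderiv ℝ u x‖ + (∑ a, ‖fderiv ℝ (gfield3 a u) x‖) +
    ∑ a, ∑ b, ‖fderiv ℝ (gfield3 a (gfield3 b u)) x‖

lemma abs_dirDeriv_le (u : EuclideanSpace ℝ (Fin 3) → ℝ) (v x : EuclideanSpace ℝ (Fin 3)) :
    |dirDeriv v u x| ≤ ‖fderiv ℝ u x‖ * ‖v‖ :=
  (fderiv ℝ u x).le_opNorm v

lemma gradSum_nonneg (u : EuclideanSpace ℝ (Fin 3) → ℝ) (x : EuclideanSpace ℝ (Fin 3)) :
    0 ≤ gradSum u x :=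
  add_nonneg (add_nonneg (norm_nonneg _) (Finset.sum_nonneg fun _ _ => norm_nonneg _))
    (Finset.sum_nonneg fun _ _ => Finset.sum_nonneg fun _ _ => norm_nonneg _)

lemma norm_fderiv_le_gradSum (u : EuclideanSpace ℝ (Fin 3) → ℝ) (x : EuclideanSpace ℝ (Fin 3)) :
    ‖fderiv ℝ u x‖ ≤ gradSum u x := by
  have h1 : 0 ≤ ∑ a, ‖fderiv ℝ (gfield3 a u) x‖ := Finset.sum_nonneg fun _ _ => norm_nonneg _
  have h2 : 0 ≤ ∑ a, ∑ b, ‖fderiv ℝ (gfield3 a (gfield3 b u)) x‖ :=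
    Finset.sum_nonneg fun _ _ => Finset.sum_nonneg fun _ _ => norm_nonneg _
  unfold gradSum
  linarith

lemma norm_fderiv_gfield3_le_gradSum (u : EuclideanSpace ℝ (Fin 3) → ℝ) (a : FieldIndex)
    (x : EuclideanSpace ℝ (Fin 3)) : ‖fderiv ℝ (gfield3 a u) x‖ ≤ gradSum u x := by
  have h1 := Finset.single_le_sum (f := fun a => ‖fderiv ℝ (gfield3 a u) x‖)
    (fun _ _ => norm_nonneg _) (Finset.mem_univ a)
  have h2 : 0 ≤ ∑ a, ∑ b, ‖fderiv ℝ (gfield3 a (gfield3 b u)) x‖ :=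
    Finset.sum_nonneg fun _ _ => Finset.sum_nonneg fun _ _ => norm_nonneg _
  have h3 := norm_nonneg (fderiv ℝ u x)
  unfold gradSum
  linarith

lemma norm_fderiv_gfield3_gfield3_le_gradSum (u : EuclideanSpace ℝ (Fin 3) → ℝ)
    (a b : FieldIndex) (x : EuclideanSpace ℝ (Fin 3)) :
    ‖fderiv ℝ (gfield3 a (gfield3 b u)) x‖ ≤ gradSum u x := by
  have h0 := Finset.single_le_sum (f := fun b => ‖fderiv ℝ (gfield3 a (gfield3 b u)) x‖)
    (fun _ _ => norm_nonneg _) (Finset.mem_univ b)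
  have h1 := Finset.single_le_sum (f := fun a => ∑ b, ‖fderiv ℝ (gfield3 a (gfield3 b u)) x‖)
    (fun _ _ => Finset.sum_nonneg fun _ _ => norm_nonneg _) (Finset.mem_univ a)
  have h2 : 0 ≤ ∑ a, ‖fderiv ℝ (gfield3 a u) x‖ := Finset.sum_nonneg fun _ _ => norm_nonneg _
  have h3 := norm_nonneg (fderiv ℝ u x)
  unfold gradSum
  linarith

lemma abs_gfield3_dirDeriv_le {u : EuclideanSpace ℝ (Fin 3) → ℝ} (hu : ContDiff ℝ (⊤ : ℕ∞) u)
    (a : FieldIndex) (v x : EuclideanSpace ℝ (Fin 3)) :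
    |gfield3 a (dirDeriv v u) x| ≤ 9 * ‖v‖ * gradSum u x := by
  rw [gfield3_dirDeriv hu]
  have h1 := abs_dirDeriv_le (gfield3 a u) v x
  have h2 := abs_dirDeriv_le u (fieldLin a v) x
  have h3 := mul_le_mul (norm_fderiv_gfield3_le_gradSum u a x) le_rfl (norm_nonneg v)
    (gradSum_nonneg u x)
  have h4 := mul_le_mul (norm_fderiv_le_gradSum u x) (norm_fieldLin_le a v) (norm_nonneg _)
    (gradSum_nonneg u x)
  have h5 := mul_nonneg (norm_nonneg v) (gradSum_nonneg u x)
  refine (abs_sub _ _).trans ?_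
  linarith

lemma abs_gfield3_gfield3_dirDeriv_le {u : EuclideanSpace ℝ (Fin 3) → ℝ}
    (hu : ContDiff ℝ (⊤ : ℕ∞) u) (a b : FieldIndex) (v x : EuclideanSpace ℝ (Fin 3)) :
    |gfield3 b (gfield3 a (dirDeriv v u)) x| ≤ 9 * ‖v‖ * gradSum u x := by
  rw [gfield3_gfield3_dirDeriv hu]
  have h1 := (abs_dirDeriv_le (gfield3 b (gfield3 a u)) v x).trans
    (mul_le_mul (norm_fderiv_gfield3_gfield3_le_gradSum u b a x) le_rfl (norm_nonneg v)
    (gradSum_nonneg u x))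
  have h2 := (abs_dirDeriv_le (gfield3 a u) (fieldLin b v) x).trans
    (mul_le_mul (norm_fderiv_gfield3_le_gradSum u a x) (norm_fieldLin_le b v) (norm_nonneg _)
    (gradSum_nonneg u x))
  have h3 := (abs_dirDeriv_le (gfield3 b u) (fieldLin a v) x).trans
    (mul_le_mul (norm_fderiv_gfield3_le_gradSum u b x) (norm_fieldLin_le a v) (norm_nonneg _)
    (gradSum_nonneg u x))
  have h4 := (abs_dirDeriv_le u (fieldLin b (fieldLin a v)) x).trans
    (mul_le_mul (norm_fderiv_le_gradSum u x)
      ((norm_fieldLin_le b _).trans (mul_le_mul_of_nonneg_left (norm_fieldLin_le a v) zero_le_two))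
      (norm_nonneg _) (gradSum_nonneg u x))
  simp only [Pi.sub_apply]
  rw [abs_le] at *
  constructor <;> linarith

lemma continuous_gradSum {u : EuclideanSpace ℝ (Fin 3) → ℝ} (hu : ContDiff ℝ (⊤ : ℕ∞) u) :
    Continuous (gradSum u) := by
  have h {f : EuclideanSpace ℝ (Fin 3) → ℝ} (hf : ContDiff ℝ (⊤ : ℕ∞) f) :
      Continuous fun x => ‖fderiv ℝ f x‖ := (hf.continuous_fderiv (by simp)).norm
  exact ((h hu).add (continuous_finsetSum _ fun a _ => h (hu.gfield3 a))).add
    (continuous_finsetSum _ fun a _ => continuous_finsetSum _ fun b _ =>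
      h ((hu.gfield3 b).gfield3 a))

lemma gradL2_nonneg_s10 (f : EuclideanSpace ℝ (Fin 3) → ℝ) : 0 ≤ gradL2 f :=
  Real.rpow_nonneg (integral_nonneg fun x => by positivity) _

lemma eLpNorm_norm_fderiv {f : EuclideanSpace ℝ (Fin 3) → ℝ} (hf : ContDiff ℝ (⊤ : ℕ∞) f)
    (hc : HasCompactSupport f) :
    eLpNorm (fun x => ‖fderiv ℝ f x‖) 2 volume = ENNReal.ofReal (gradL2 f) := by
  have hm : MemLp (fderiv ℝ f) 2 (volume : Measure (EuclideanSpace ℝ (Fin 3))) :=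
    (hf.continuous_fderiv (by simp)).memLp_of_hasCompactSupport (hc.fderiv (𝕜 := ℝ))
  rw [eLpNorm_norm, hm.eLpNorm_eq_integral_rpow_norm (by simp) (by simp)]
  simp [gradL2]

lemma eLpNorm_gradSum_le {u : EuclideanSpace ℝ (Fin 3) → ℝ} (hu : ContDiff ℝ (⊤ : ℕ∞) u)
    (hc : HasCompactSupport u) :
    eLpNorm (gradSum u) 2 volume ≤ ENNReal.ofReal (gradL2 u + (∑ a, gradL2 (gfield3 a u)) +
            ∑ a, ∑ b, gradL2 (gfield3 a (gfield3 b u))) := by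
  have hn := gradL2_nonneg_s10
  have hm {f : EuclideanSpace ℝ (Fin 3) → ℝ} (hf : ContDiff ℝ (⊤ : ℕ∞) f) :
      AEStronglyMeasurable (fun x => ‖fderiv ℝ f x‖) volume :=
    (hf.continuous_fderiv (by simp)).norm.aestronglyMeasurable
  have hm1 : AEStronglyMeasurable (∑ a, fun x => ‖fderiv ℝ (gfield3 a u) x‖) volume :=
    Finset.aestronglyMeasurable_sum _ fun a _ => hm (hu.gfield3 a)
  have hm2 (a : FieldIndex) : AEStronglyMeasurable
      (∑ b, fun x => ‖fderiv ℝ (gfield3 a (gfield3 b u)) x‖) volume :=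
    Finset.aestronglyMeasurable_sum _ fun b _ => hm ((hu.gfield3 b).gfield3 a)
  have hS : gradSum u = (fun x => ‖fderiv ℝ u x‖) + (∑ a, fun x => ‖fderiv ℝ (gfield3 a u) x‖) +
      ∑ a, ∑ b, fun x => ‖fderiv ℝ (gfield3 a (gfield3 b u)) x‖ := by
    ext x
    simp [gradSum]
  rw [hS, ENNReal.ofReal_add (add_nonneg (hn _) (Finset.sum_nonneg fun _ _ => hn _))
    (Finset.sum_nonneg fun _ _ => Finset.sum_nonneg fun _ _ => hn _),
    ENNReal.ofReal_add (hn _) (Finset.sum_nonneg fun _ _ => hn _),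
    ENNReal.ofReal_sum_of_nonneg fun _ _ => hn _,
    ENNReal.ofReal_sum_of_nonneg fun _ _ => Finset.sum_nonneg fun _ _ => hn _]
  refine (eLpNorm_add_le ((hm hu).add hm1)
    (Finset.aestronglyMeasurable_sum _ fun a _ => hm2 a) (by norm_num)).trans ?_
  refine add_le_add ((eLpNorm_add_le (hm hu) hm1 (by norm_num)).trans ?_) ?_
  · refine add_le_add (eLpNorm_norm_fderiv hu hc).le ?_
    refine (eLpNorm_sum_le (fun a _ => hm (hu.gfield3 a)) (by norm_num)).trans ?_
    exact Finset.sum_le_sum fun a _ => (eLpNorm_norm_fderiv (hu.gfield3 a) (hc.gfield3 a)).le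
  · refine (eLpNorm_sum_le (fun a _ => hm2 a) (by norm_num)).trans ?_
    refine Finset.sum_le_sum fun a _ => ?_
    rw [ENNReal.ofReal_sum_of_nonneg fun _ _ => hn _]
    refine (eLpNorm_sum_le (fun b _ => hm ((hu.gfield3 b).gfield3 a)) (by norm_num)).trans ?_
    exact Finset.sum_le_sum fun b _ =>
      (eLpNorm_norm_fderiv ((hu.gfield3 b).gfield3 a) ((hc.gfield3 b).gfield3 a)).le

open Set in
lemma abs_le_integral_of_hasDerivAt {g g₁ g₂ φ : ℝ → ℝ}
    (hg : ∀ t ∈ Icc (0 : ℝ) 1, HasDerivAt g (g₁ t) t)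
    (hg₁ : ∀ t ∈ Icc (0 : ℝ) 1, HasDerivAt g₁ (g₂ t) t)
    (hφ : ContinuousOn φ (Icc 0 1)) (b₀ : ∀ t ∈ Icc (0 : ℝ) 1, |g t| ≤ φ t)
    (b₁ : ∀ t ∈ Icc (0 : ℝ) 1, |g₁ t| ≤ φ t) (b₂ : ∀ t ∈ Icc (0 : ℝ) 1, |g₂ t| ≤ φ t) :
    |g 0| ≤ ∫ t in (0 : ℝ)..1, 7 * (t * φ t) := by
  have hH : ∀ t ∈ Icc (0 : ℝ) 1, HasDerivAt (fun t => t * (1 - t) ^ 2 * g₁ t - (1 - t ^ 2) * g t)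
      (t * (1 - t) ^ 2 * g₂ t - 4 * t * (1 - t) * g₁ t + 2 * t * g t) t := by
    intro t ht
    have h1 : HasDerivAt (fun t : ℝ => t * (1 - t) ^ 2)
        (1 * (1 - t) ^ 2 + t * (2 * (1 - t) * (-1))) t := by
      simpa using (hasDerivAt_id' t).fun_mul (((hasDerivAt_id' t).const_sub 1).fun_pow 2)
    have h2 : HasDerivAt (fun t : ℝ => 1 - t ^ 2) (-(2 * t)) t := by
      simpa using (hasDerivAt_pow 2 t).const_sub 1
    convert! (h1.mul (hg₁ t ht)).sub (h2.mul (hg t ht)) using 1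
    ring
  have hb : ∀ t ∈ Icc (0 : ℝ) 1,
      |t * (1 - t) ^ 2 * g₂ t - 4 * t * (1 - t) * g₁ t + 2 * t * g t| ≤ 7 * (t * φ t) := by
    intro t ht
    have ht0 : 0 ≤ t := ht.1
    have ht1 : 0 ≤ 1 - t := sub_nonneg.2 ht.2
    have hφ0 : 0 ≤ φ t := (abs_nonneg _).trans (b₀ t ht)
    have e1 : |t * (1 - t) ^ 2 * g₂ t| ≤ t * φ t := by
      rw [abs_mul, abs_of_nonneg (by positivity)]
      have : (1 - t) ^ 2 ≤ 1 := by nlinarith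
      calc t * (1 - t) ^ 2 * |g₂ t| ≤ t * 1 * φ t := by gcongr; exact b₂ t ht
        _ = _ := by ring
    have e2 : |4 * t * (1 - t) * g₁ t| ≤ 4 * (t * φ t) := by
      rw [abs_mul, abs_of_nonneg (by positivity)]
      calc 4 * t * (1 - t) * |g₁ t| ≤ 4 * t * 1 * φ t := by
            gcongr
            · linarith
            · exact b₁ t ht
        _ = _ := by ring
    have e3 : |2 * t * g t| ≤ 2 * (t * φ t) := by
      rw [abs_mul, abs_of_nonneg (by positivity)]
      calc 2 * t * |g t| ≤ 2 * t * φ t := by gcongr; exact b₀ t ht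
        _ = _ := by ring
    rw [abs_le] at *
    constructor <;> linarith
  have hi : IntegrableOn (fun t => 7 * (t * φ t)) (Icc 0 1) :=
    (continuousOn_const.mul (continuousOn_id.mul hφ)).integrableOn_compact isCompact_Icc
  have k1 := intervalIntegral.sub_le_integral_of_hasDeriv_right_of_le zero_le_one
    (fun t ht => (hH t ht).continuousAt.continuousWithinAt)
    (fun t ht => (hH t (Ioo_subset_Icc_self ht)).hasDerivWithinAt) hi
    (fun t ht => (abs_le.1 (hb t (Ioo_subset_Icc_self ht))).2)
  have k2 := intervalIntegral.sub_le_integral_of_hasDeriv_right_of_le zero_le_one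
    (fun t ht => (hH t ht).neg.continuousAt.continuousWithinAt)
    (fun t ht => (hH t (Ioo_subset_Icc_self ht)).neg.hasDerivWithinAt) hi
    (fun t ht => neg_le.1 (abs_le.1 (hb t (Ioo_subset_Icc_self ht))).1)
  norm_num at k1 k2
  norm_num
  rw [abs_le]
  constructor <;> linarith

open Set in
lemma sq_le_integral_sq {c : ℝ} {φ : ℝ → ℝ} (hφ : ContinuousOn φ (Icc 0 1)) (hc : 0 ≤ c)
    (h : c ≤ ∫ t in (0 : ℝ)..1, φ t) : c ^ 2 ≤ ∫ t in (0 : ℝ)..1, φ t ^ 2 := by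
  have hφ' : ContinuousOn φ (uIcc 0 1) := by rwa [uIcc_of_le zero_le_one]
  have h0 : (0 : ℝ) ≤ ∫ t in (0 : ℝ)..1, (φ t - c) ^ 2 :=
    intervalIntegral.integral_nonneg zero_le_one fun t _ => sq_nonneg _
  have h1 : ∫ t in (0 : ℝ)..1, (φ t - c) ^ 2 =
      (∫ t in (0 : ℝ)..1, φ t ^ 2) - 2 * c * (∫ t in (0 : ℝ)..1, φ t) + c ^ 2 := by
    have : ∀ t, (φ t - c) ^ 2 = φ t ^ 2 - 2 * c * φ t + c ^ 2 := fun t => by ring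
    simp_rw [this]
    rw [intervalIntegral.integral_add, intervalIntegral.integral_sub,
      intervalIntegral.integral_const_mul]
    · simp
    · exact (hφ'.pow 2).intervalIntegrable
    · exact (continuousOn_const.mul hφ').intervalIntegrable
    · exact ((hφ'.pow 2).sub (continuousOn_const.mul hφ')).intervalIntegrable
    · exact intervalIntegrable_const
  nlinarith

lemma hasDerivAt_comp_of_field {f : EuclideanSpace ℝ (Fin 3) → ℝ} (hf : ContDiff ℝ (⊤ : ℕ∞) f)
    {γ : ℝ → EuclideanSpace ℝ (Fin 3)} {δ : FieldIndex → ℝ} {t : ℝ}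
    (hγ : HasDerivAt γ (∑ a, δ a • fieldVec a (γ t)) t) :
    HasDerivAt (fun s => f (γ s)) (∑ a, δ a * gfield3 a f (γ t)) t := by
  have h := ((hf.differentiable (by simp) (γ t)).hasFDerivAt).comp_hasDerivAt t hγ
  simp only [map_sum, map_smul, smul_eq_mul, ← gfield3_apply] at h
  exact h

open Set in
/-- A curve along which the velocity is a controlled combination of the fields bounds the value
of `∂_v u` at its starting point by the weighted energy density along the curve. -/
lemma sq_dirDeriv_le_integral {u : EuclideanSpace ℝ (Fin 3) → ℝ} (hu : ContDiff ℝ (⊤ : ℕ∞) u)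
    (v : EuclideanSpace ℝ (Fin 3)) {γ : ℝ → EuclideanSpace ℝ (Fin 3)}
    {δ δ' : FieldIndex → ℝ → ℝ} {M : ℝ}
    (hγ : ∀ t ∈ Icc (0 : ℝ) 1, HasDerivAt γ (∑ a, δ a t • fieldVec a (γ t)) t)
    (hδ : ∀ a, ∀ t ∈ Icc (0 : ℝ) 1, HasDerivAt (δ a) (δ' a t) t)
    (hM : ∀ a, ∀ t ∈ Icc (0 : ℝ) 1, |δ a t| ≤ M) (hM' : ∀ a, ∀ t ∈ Icc (0 : ℝ) 1, |δ' a t| ≤ M) :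
    dirDeriv v u (γ 0) ^ 2 ≤
      (63 * ‖v‖ * (1 + 6 * M + 36 * M ^ 2)) ^ 2 *
        ∫ t in (0 : ℝ)..1, t ^ 2 * gradSum u (γ t) ^ 2 := by
  have hcard : (Finset.univ : Finset FieldIndex).card = 6 := by decide
  set K : ℝ := 9 * ‖v‖ * (1 + 6 * M + 36 * M ^ 2) with hK
  have hM0 : 0 ≤ M := (abs_nonneg _).trans (hM (Sum.inl 0) 0 (by simp))
  have hγc : ContinuousOn γ (Icc 0 1) := fun t ht => (hγ t ht).continuousAt.continuousWithinAt
  have hSc : ContinuousOn (fun t => gradSum u (γ t)) (Icc 0 1) :=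
    (continuous_gradSum hu).comp_continuousOn hγc
  have hw := hu.dirDeriv v
  have hS (y) := gradSum_nonneg u y
  have hbd : ∀ (δ : FieldIndex → ℝ) (F : FieldIndex → ℝ) (B : ℝ), (∀ a, |δ a| ≤ M) →
      (∀ a, |F a| ≤ B) → |∑ a, δ a * F a| ≤ 6 * (M * B) := by
    intro δ F B h1 h2
    refine (Finset.abs_sum_le_sum_abs _ _).trans ?_
    refine (Finset.sum_le_card_nsmul _ _ (M * B) fun a _ => ?_).trans (by rw [hcard]; simp)
    rw [abs_mul]
    exact mul_le_mul (h1 a) (h2 a) (abs_nonneg _) hM0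
  have hg : ∀ t ∈ Icc (0 : ℝ) 1, HasDerivAt (fun s => dirDeriv v u (γ s))
      (∑ a, δ a t * gfield3 a (dirDeriv v u) (γ t)) t := fun t ht =>
    hasDerivAt_comp_of_field hw (hγ t ht)
  have hg₁ : ∀ t ∈ Icc (0 : ℝ) 1,
      HasDerivAt (fun t => ∑ a, δ a t * gfield3 a (dirDeriv v u) (γ t))
      (∑ a, (δ' a t * gfield3 a (dirDeriv v u) (γ t) +
        δ a t * ∑ b, δ b t * gfield3 b (gfield3 a (dirDeriv v u)) (γ t))) t := fun t ht =>
    HasDerivAt.fun_sum fun a _ => (hδ a t ht).mul (hasDerivAt_comp_of_field (hw.gfield3 a) (hγ t ht))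
  have key := abs_le_integral_of_hasDerivAt hg hg₁ (φ := fun t => K * gradSum u (γ t))
    (continuousOn_const.mul hSc) ?_ ?_ ?_
  · have h2 := sq_le_integral_sq (continuousOn_const.mul (continuousOn_id.mul
      (continuousOn_const.mul hSc))) (abs_nonneg _) key
    rw [sq_abs] at h2
    refine h2.trans_eq ?_
    rw [← intervalIntegral.integral_const_mul]
    congr 1
    ext t
    simp only [Pi.mul_apply, id]
    ring
  · intro t ht
    have h1 := (abs_dirDeriv_le u v (γ t)).trans
      (mul_le_mul_of_nonneg_right (norm_fderiv_le_gradSum u _) (norm_nonneg v))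
    have h2 : 0 ≤ ‖v‖ * gradSum u (γ t) := mul_nonneg (norm_nonneg _) (hS _)
    have h3 : 0 ≤ (8 + 54 * M + 324 * M ^ 2) * (‖v‖ * gradSum u (γ t)) := by positivity
    rw [hK]
    linarith
  · intro t ht
    refine (hbd _ _ _ (fun a => hM a t ht) fun a => abs_gfield3_dirDeriv_le hu a v _).trans ?_
    have h2 : 0 ≤ ‖v‖ * gradSum u (γ t) := mul_nonneg (norm_nonneg _) (hS _)
    have h3 : 0 ≤ (9 + 324 * M ^ 2) * (‖v‖ * gradSum u (γ t)) := by positivity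
    rw [hK]
    linarith
  · intro t ht
    rw [Finset.sum_add_distrib]
    have h1 := hbd _ _ _ (fun a => hM' a t ht) fun a => abs_gfield3_dirDeriv_le hu a v (γ t)
    have h2 := hbd _ _ _ (fun a => hM a t ht) fun a => hbd _ _ _ (fun b => hM b t ht)
      fun b => abs_gfield3_gfield3_dirDeriv_le hu a b v (γ t)
    have h4 : 0 ≤ ‖v‖ * gradSum u (γ t) := mul_nonneg (norm_nonneg _) (hS _)
    refine (abs_add_le _ _).trans ((add_le_add h1 h2).trans ?_)
    rw [hK]
    linarith

open Set in
lemma lintegral_comp_le_of_hasDerivWithinAt {s T : Set ℝ} {f f' m : ℝ → ℝ} (hs : MeasurableSet s)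
    (hf : ∀ x ∈ s, HasDerivWithinAt f (f' x) s x) (hinj : InjOn f s) (hT : MapsTo f s T)
    (hm : ∀ x ∈ s, m x ≤ |f' x|) (Φ : ℝ → ENNReal) :
    ∫⁻ x in s, ENNReal.ofReal (m x) * Φ (f x) ≤ ∫⁻ y in T, Φ y :=
  calc ∫⁻ x in s, ENNReal.ofReal (m x) * Φ (f x)
      ≤ ∫⁻ x in s, ENNReal.ofReal |f' x| * Φ (f x) :=
        setLIntegral_mono' hs fun x hx => by gcongr; exact hm x hx
    _ = ∫⁻ y in f '' s, Φ y := (lintegral_image_eq_lintegral_abs_deriv_mul hs hf hinj Φ).symm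
    _ ≤ ∫⁻ y in T, Φ y := lintegral_mono_set hT.image_subset

open Set in
lemma lintegral_comp_mul_le {ρ c : ℝ} (hc : 0 ≤ c) (hcρ : c ≤ ρ) (Φ : ℝ → ENNReal) :
    ∫⁻ a in Icc (0 : ℝ) (1 / 2), ENNReal.ofReal c * Φ (c * a) ≤ ∫⁻ p in Icc (0 : ℝ) (ρ / 2), Φ p := by
  rcases hc.eq_or_lt with rfl | hc
  · simp
  · refine lintegral_comp_le_of_hasDerivWithinAt (f := fun a => c * a) (f' := fun _ => c)
      (m := fun _ => c) measurableSet_Icc (fun x _ => ?_) (fun x _ y _ h => ?_) (fun x hx => ?_)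
      (fun _ _ => le_abs_self c) Φ
    · simpa using ((hasDerivAt_id x).const_mul c).hasDerivWithinAt
    · exact mul_left_cancel₀ hc.ne' h
    · exact ⟨mul_nonneg hc.le hx.1, by nlinarith [hx.1, hx.2]⟩

/-- The height over the tangent plane of the sphere of radius `ρ + t` tangent to it at `t = 0`. -/
noncomputable def sphereHeight (ρ t p q : ℝ) : ℝ := Real.sqrt ((ρ + t) ^ 2 - p ^ 2 - q ^ 2)

lemma sphereHeight_arg_ge {ρ t p q : ℝ} (ht : 0 ≤ t) (hp : 0 ≤ p) (hp' : p ≤ ρ / 2)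
    (hq : 0 ≤ q) (hq' : q ≤ ρ / 2) : (ρ / 2) ^ 2 ≤ (ρ + t) ^ 2 - p ^ 2 - q ^ 2 := by
  nlinarith

open Set in
lemma lintegral_comp_sphereHeight_le {ρ p q : ℝ} (hρ : 1 ≤ ρ) (hp : p ∈ Icc 0 (ρ / 2))
    (hq : q ∈ Icc 0 (ρ / 2)) (Φ : ℝ → ENNReal) :
    ∫⁻ t in Icc (0 : ℝ) 1, Φ (sphereHeight ρ t p q) ≤ ∫⁻ z, Φ z := by
  have hpos : ∀ t ∈ Icc (0 : ℝ) 1, 0 < (ρ + t) ^ 2 - p ^ 2 - q ^ 2 := fun t ht =>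
    lt_of_lt_of_le (by positivity) (sphereHeight_arg_ge ht.1 hp.1 hp.2 hq.1 hq.2)
  have := lintegral_comp_le_of_hasDerivWithinAt (s := Icc (0 : ℝ) 1) (T := univ)
    (f := fun t => sphereHeight ρ t p q) (f' := fun t => (ρ + t) / sphereHeight ρ t p q)
    (m := fun _ => 1) measurableSet_Icc (fun t ht => ?_) (fun t ht s hs h => ?_) (mapsTo_univ _ _)
    (fun t ht => ?_) Φ
  · simpa using this
  · have h1 : HasDerivAt (fun t => (ρ + t) ^ 2 - p ^ 2 - q ^ 2) (2 * (ρ + t)) t := by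
      simpa using ((((hasDerivAt_id t).const_add ρ).pow 2).sub_const (p ^ 2)).sub_const (q ^ 2)
    convert! (h1.sqrt (hpos t ht).ne').hasDerivWithinAt using 1
    unfold sphereHeight
    rw [mul_div_mul_left _ _ two_ne_zero]
  · have h1 := (Real.sqrt_inj (hpos t ht).le (hpos s hs).le).1 h
    have h2 : (ρ + t) ^ 2 = (ρ + s) ^ 2 := by linarith
    have h3 := (sq_eq_sq₀ (by linarith [ht.1]) (by linarith [hs.1])).1 h2
    linarith
  · have h0 : 0 ≤ ρ + t := by linarith [ht.1]
    rw [sphereHeight, abs_of_nonneg (div_nonneg h0 (Real.sqrt_nonneg _)),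
      one_le_div (Real.sqrt_pos.2 (hpos t ht))]
    exact Real.sqrt_le_iff.2 ⟨h0, by nlinarith⟩

open Set in
lemma lintegral_cone_le {ρ : ℝ} (hρ : 1 ≤ ρ) {F : ℝ × ℝ × ℝ → ENNReal} (hF : Measurable F) :
    ∫⁻ a in Icc (0 : ℝ) (1 / 2), ∫⁻ b in Icc (0 : ℝ) (1 / 2), ∫⁻ t in Icc (0 : ℝ) 1,
      ENNReal.ofReal ((ρ * t) ^ 2) *
        F (ρ * t * a, ρ * t * b, sphereHeight ρ t (ρ * t * a) (ρ * t * b) - 1) ≤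
    ∫⁻ p, ∫⁻ q, ∫⁻ z, F (p, q, z) := by
  have hm : Measurable fun x : ℝ × ℝ × ℝ => sphereHeight ρ x.1 x.2.1 x.2.2 := by
    unfold sphereHeight
    fun_prop
  have hm' : Measurable fun x : ℝ × ℝ × ℝ =>
      F (x.2.1, x.2.2, sphereHeight ρ x.1 x.2.1 x.2.2 - 1) := hF.comp (by fun_prop)
  set G : ℝ → ℝ → ℝ → ENNReal := fun t p q => F (p, q, sphereHeight ρ t p q - 1) with hG
  have hGm {α : Type} [MeasurableSpace α] {f g h : α → ℝ} (hf : Measurable f) (hg : Measurable g)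
      (hh : Measurable h) : Measurable fun x => G (f x) (g x) (h x) :=
    hm'.comp (hf.prodMk (hg.prodMk hh))
  calc ∫⁻ a in Icc (0 : ℝ) (1 / 2), ∫⁻ b in Icc (0 : ℝ) (1 / 2), ∫⁻ t in Icc (0 : ℝ) 1,
        ENNReal.ofReal ((ρ * t) ^ 2) * G t (ρ * t * a) (ρ * t * b)
      = ∫⁻ a in Icc (0 : ℝ) (1 / 2), ∫⁻ t in Icc (0 : ℝ) 1, ∫⁻ b in Icc (0 : ℝ) (1 / 2),
        ENNReal.ofReal ((ρ * t) ^ 2) * G t (ρ * t * a) (ρ * t * b) := by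
        refine lintegral_congr fun a => lintegral_lintegral_swap ?_
        exact (Measurable.mul (by fun_prop)
          (hGm (by fun_prop) (by fun_prop) (by fun_prop))).aemeasurable
    _ = ∫⁻ t in Icc (0 : ℝ) 1, ∫⁻ a in Icc (0 : ℝ) (1 / 2), ∫⁻ b in Icc (0 : ℝ) (1 / 2),
        ENNReal.ofReal ((ρ * t) ^ 2) * G t (ρ * t * a) (ρ * t * b) := by
        refine lintegral_lintegral_swap (Measurable.aemeasurable ?_)
        refine Measurable.lintegral_prod_right' (f := fun x : (ℝ × ℝ) × ℝ =>
          ENNReal.ofReal ((ρ * x.1.2) ^ 2) * G x.1.2 (ρ * x.1.2 * x.1.1) (ρ * x.1.2 * x.2)) ?_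
        exact Measurable.mul (by fun_prop) (hGm (by fun_prop) (by fun_prop) (by fun_prop))
    _ ≤ ∫⁻ t in Icc (0 : ℝ) 1, ∫⁻ p in Icc (0 : ℝ) (ρ / 2), ∫⁻ q in Icc (0 : ℝ) (ρ / 2),
        G t p q := by
        refine setLIntegral_mono' measurableSet_Icc fun t ht => ?_
        have hc : 0 ≤ ρ * t := mul_nonneg (by linarith) ht.1
        have hcρ : ρ * t ≤ ρ := mul_le_of_le_one_right (by linarith) ht.2
        refine le_trans ?_ (lintegral_comp_mul_le hc hcρ
          fun p => ∫⁻ q in Icc (0 : ℝ) (ρ / 2), G t p q)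
        refine lintegral_mono fun a => ?_
        have hb := lintegral_comp_mul_le hc hcρ fun q => G t (ρ * t * a) q
        calc _ = ENNReal.ofReal (ρ * t) * ∫⁻ b in Icc (0 : ℝ) (1 / 2),
              ENNReal.ofReal (ρ * t) * G t (ρ * t * a) (ρ * t * b) := by
              rw [← lintegral_const_mul' _ _ ENNReal.ofReal_ne_top]
              refine lintegral_congr fun b => ?_
              rw [sq, ENNReal.ofReal_mul hc, mul_assoc]
          _ ≤ _ := by gcongr
    _ = ∫⁻ p in Icc (0 : ℝ) (ρ / 2), ∫⁻ t in Icc (0 : ℝ) 1, ∫⁻ q in Icc (0 : ℝ) (ρ / 2),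
        G t p q := by
        refine lintegral_lintegral_swap (Measurable.aemeasurable ?_)
        refine Measurable.lintegral_prod_right' (f := fun x : (ℝ × ℝ) × ℝ => G x.1.1 x.1.2 x.2) ?_
        exact hGm (by fun_prop) (by fun_prop) (by fun_prop)
    _ = ∫⁻ p in Icc (0 : ℝ) (ρ / 2), ∫⁻ q in Icc (0 : ℝ) (ρ / 2), ∫⁻ t in Icc (0 : ℝ) 1,
        G t p q := by
        refine lintegral_congr fun p => lintegral_lintegral_swap ?_
        exact (hGm (by fun_prop) (by fun_prop) (by fun_prop)).aemeasurable
    _ ≤ ∫⁻ p in Icc (0 : ℝ) (ρ / 2), ∫⁻ q in Icc (0 : ℝ) (ρ / 2), ∫⁻ z, F (p, q, z) := by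
        refine setLIntegral_mono' measurableSet_Icc fun p hp => ?_
        refine setLIntegral_mono' measurableSet_Icc fun q hq => ?_
        refine (lintegral_comp_sphereHeight_le hρ hp hq fun z => F (p, q, z - 1)).trans_eq ?_
        exact lintegral_sub_right_eq_self (fun z => F (p, q, z)) 1
    _ ≤ ∫⁻ p, ∫⁻ q, ∫⁻ z, F (p, q, z) :=
        (setLIntegral_le_lintegral _ _).trans (lintegral_mono fun p => setLIntegral_le_lintegral _ _)

/-- The coefficients of the affine field `y ↦ (⟪y, e⟫ + 1) f - ⟪y, f⟫ e` in the fields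
`∂₁, ∂₂, ∂₃, Ω₁₂, Ω₁₃, Ω₂₃`. -/
noncomputable def fieldCoeff (e f : EuclideanSpace ℝ (Fin 3)) (a : FieldIndex) : ℝ :=
  match a with
  | Sum.inl i => f i
  | Sum.inr p => e p.val.1 * f p.val.2 - e p.val.2 * f p.val.1

lemma sum_fieldIndex {A : Type*} [AddCommMonoid A] (h : FieldIndex → A) :
    ∑ a, h a = (h (Sum.inl 0) + h (Sum.inl 1) + h (Sum.inl 2)) +
      (h (Sum.inr ⟨(0, 1), by decide⟩) + h (Sum.inr ⟨(0, 2), by decide⟩) +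
        h (Sum.inr ⟨(1, 2), by decide⟩)) := by
  have hu : (Finset.univ : Finset {p : Fin 3 × Fin 3 // p.1 < p.2}) =
      {⟨(0, 1), by decide⟩, ⟨(0, 2), by decide⟩, ⟨(1, 2), by decide⟩} := by decide
  rw [Fintype.sum_sum_type, Fin.sum_univ_three, hu, Finset.sum_insert (by decide),
    Finset.sum_insert (by decide), Finset.sum_singleton, add_assoc (h (Sum.inr _))]

lemma sum_fieldCoeff (e f y : EuclideanSpace ℝ (Fin 3)) :
    ∑ a, fieldCoeff e f a • fieldVec a y = (inner ℝ y e + 1) • f - inner ℝ y f • e := by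
  rw [sum_fieldIndex]
  ext k
  fin_cases k <;>
    simp [fieldCoeff, fieldVec, PiLp.inner_apply, Fin.sum_univ_three] <;> ring

lemma abs_fieldCoeff_le {e f : EuclideanSpace ℝ (Fin 3)} (he : ‖e‖ ≤ 1) (hf : ‖f‖ ≤ 1)
    (a : FieldIndex) : |fieldCoeff e f a| ≤ 2 := by
  have h1 (i : Fin 3) : |e i| ≤ 1 := (PiLp.norm_apply_le e i).trans he
  have h2 (i : Fin 3) : |f i| ≤ 1 := (PiLp.norm_apply_le f i).trans hf
  rcases a with i | p
  · exact (h2 i).trans one_le_two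
  · refine (abs_sub _ _).trans ?_
    rw [abs_mul, abs_mul]
    have h3 := mul_le_one₀ (h1 p.val.1) (abs_nonneg _) (h2 p.val.2)
    have h4 := mul_le_one₀ (h1 p.val.2) (abs_nonneg _) (h2 p.val.1)
    linarith

/-- The curve on which the point with tangential coordinates `(ρ t a, ρ t b)` sits on the
sphere of radius `ρ + t` about `-B 2`. -/
noncomputable def coneCurve (B : OrthonormalBasis (Fin 3) ℝ (EuclideanSpace ℝ (Fin 3)))
    (ρ a b t : ℝ) : EuclideanSpace ℝ (Fin 3) :=
  (ρ * t * a) • B 0 + (ρ * t * b) • B 1 +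
    (sphereHeight ρ t (ρ * t * a) (ρ * t * b) - 1) • B 2

open Set in
lemma exists_coneCurve_field (B : OrthonormalBasis (Fin 3) ℝ (EuclideanSpace ℝ (Fin 3)))
    {ρ a b : ℝ} (hρ : 1 ≤ ρ) (ha : a ∈ Icc (0 : ℝ) (1 / 2)) (hb : b ∈ Icc (0 : ℝ) (1 / 2)) :
    ∃ δ δ' : FieldIndex → ℝ → ℝ,
      (∀ t ∈ Icc (0 : ℝ) 1, HasDerivAt (coneCurve B ρ a b)
        (∑ i, δ i t • fieldVec i (coneCurve B ρ a b t)) t) ∧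
      (∀ i, ∀ t ∈ Icc (0 : ℝ) 1, HasDerivAt (δ i) (δ' i t) t) ∧
      (∀ i, ∀ t ∈ Icc (0 : ℝ) 1, |δ i t| ≤ 100) ∧
      (∀ i, ∀ t ∈ Icc (0 : ℝ) 1, |δ' i t| ≤ 100) := by
  obtain ⟨ha0, ha1⟩ := ha
  obtain ⟨hb0, hb1⟩ := hb
  have hρ0 : 0 < ρ := by linarith
  set Z : ℝ → ℝ := fun t => sphereHeight ρ t (ρ * t * a) (ρ * t * b) with hZ
  set N : ℝ → ℝ := fun t => ρ + t - ρ ^ 2 * t * (a ^ 2 + b ^ 2) with hN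
  have harg : ∀ t ∈ Icc (0 : ℝ) 1,
      (ρ / 2) ^ 2 ≤ (ρ + t) ^ 2 - (ρ * t * a) ^ 2 - (ρ * t * b) ^ 2 := by
    rintro t ⟨ht0, ht1⟩
    have h1 : ρ * t ≤ ρ := mul_le_of_le_one_right hρ0.le ht1
    have h2 : 0 ≤ ρ * t := by positivity
    exact sphereHeight_arg_ge ht0 (by positivity) (by nlinarith) (by positivity) (by nlinarith)
  have hZge : ∀ t ∈ Icc (0 : ℝ) 1, ρ / 2 ≤ Z t := fun t ht => Real.le_sqrt_of_sq_le (harg t ht)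
  have hZpos : ∀ t ∈ Icc (0 : ℝ) 1, 0 < Z t := fun t ht =>
    lt_of_lt_of_le (by positivity) (hZge t ht)
  have hZ' : ∀ t ∈ Icc (0 : ℝ) 1, HasDerivAt Z (N t / Z t) t := by
    intro t ht
    have hl (c : ℝ) : HasDerivAt (fun t => (ρ * t * c) ^ 2) (2 * (ρ * t * c) * (ρ * c)) t := by
      simpa using (((hasDerivAt_id' t).const_mul ρ).mul_const c).fun_pow 2
    have hq : HasDerivAt (fun t => (ρ + t) ^ 2) (2 * (ρ + t)) t := by
      simpa using ((hasDerivAt_id' t).const_add ρ).fun_pow 2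
    convert! ((hq.fun_sub (hl a)).fun_sub (hl b)).sqrt
      (lt_of_lt_of_le (by positivity) (harg t ht)).ne' using 1
    rw [← mul_div_mul_left _ _ (two_ne_zero (α := ℝ))]
    congr 1
    simp only [hN]
    ring
  have hNb : ∀ t ∈ Icc (0 : ℝ) 1, |N t / Z t| ≤ 4 * ρ := by
    intro t ht
    have h1 : a ^ 2 + b ^ 2 ≤ 1 / 2 := by nlinarith
    have h2 : 0 ≤ ρ ^ 2 * t * (a ^ 2 + b ^ 2) := mul_nonneg (mul_nonneg (sq_nonneg _) ht.1)
      (by positivity)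
    have h3 : ρ ^ 2 * t * (a ^ 2 + b ^ 2) ≤ ρ ^ 2 * 1 * (1 / 2) := by
      have := ht.1
      gcongr
      exact ht.2
    have h4 := hZge t ht
    rw [abs_div, abs_of_pos (hZpos t ht), div_le_iff₀ (hZpos t ht)]
    have h5 : 4 * ρ * (ρ / 2) ≤ 4 * ρ * Z t := by gcongr
    refine le_trans ?_ h5
    rw [abs_le]
    simp only [hN]
    constructor <;> nlinarith [ht.1, ht.2]
  set c : ℝ → ℝ → ℝ := fun k t => ρ * k / Z t with hc
  set c' : ℝ → ℝ → ℝ := fun k t => -(ρ * k * (N t / Z t)) / Z t ^ 2 with hc'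
  have hcd (k : ℝ) : ∀ t ∈ Icc (0 : ℝ) 1, HasDerivAt (c k) (c' k t) t := by
    intro t ht
    convert! (hasDerivAt_const t (ρ * k)).fun_div (hZ' t ht) (hZpos t ht).ne' using 1
    simp [hc']
  have hdd : ∀ t ∈ Icc (0 : ℝ) 1, HasDerivAt (fun t => (ρ + t) / Z t)
      ((1 * Z t - (ρ + t) * (N t / Z t)) / Z t ^ 2) t := fun t ht =>
    ((hasDerivAt_id' t).const_add ρ).fun_div (hZ' t ht) (hZpos t ht).ne'
  have hcb {k : ℝ} (hk : k ∈ Icc (0 : ℝ) (1 / 2)) : ∀ t ∈ Icc (0 : ℝ) 1, |c k t| ≤ 1 := by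
    intro t ht
    have := hk.1
    rw [abs_of_nonneg (div_nonneg (by positivity) (hZpos t ht).le), div_le_one (hZpos t ht)]
    nlinarith [hZge t ht, hk.2]
  have hZsq : ∀ t ∈ Icc (0 : ℝ) 1, ρ ^ 2 / 4 ≤ Z t ^ 2 := fun t ht => by
    nlinarith [hZge t ht]
  have hcb' {k : ℝ} (hk : k ∈ Icc (0 : ℝ) (1 / 2)) : ∀ t ∈ Icc (0 : ℝ) 1, |c' k t| ≤ 8 := by
    intro t ht
    have hp := hZpos t ht
    have := hk.1
    rw [abs_div, abs_neg, abs_mul, abs_of_pos (pow_pos hp 2), div_le_iff₀ (pow_pos hp 2),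
      abs_of_nonneg (a := ρ * k) (by positivity)]
    calc ρ * k * |N t / Z t| ≤ ρ * (1 / 2) * (4 * ρ) := by
          gcongr
          · exact hk.2
          · exact hNb t ht
      _ ≤ 8 * Z t ^ 2 := by nlinarith [hZsq t ht]
  have hdb : ∀ t ∈ Icc (0 : ℝ) 1, |(ρ + t) / Z t| ≤ 4 := by
    intro t ht
    rw [abs_of_nonneg (div_nonneg (by linarith [ht.1]) (hZpos t ht).le), div_le_iff₀ (hZpos t ht)]
    linarith [hZge t ht, ht.2]
  have hdb' : ∀ t ∈ Icc (0 : ℝ) 1, |(1 * Z t - (ρ + t) * (N t / Z t)) / Z t ^ 2| ≤ 34 := by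
    intro t ht
    have hp := hZpos t ht
    have hr : 0 ≤ ρ + t := by linarith [ht.1]
    rw [abs_div, abs_of_pos (pow_pos hp 2), div_le_iff₀ (pow_pos hp 2)]
    refine (abs_sub _ _).trans ?_
    rw [one_mul, abs_of_pos hp, abs_mul, abs_of_nonneg hr]
    have h1 : (ρ + t) * |N t / Z t| ≤ 2 * ρ * (4 * ρ) :=
      mul_le_mul (by linarith [ht.2]) (hNb t ht) (abs_nonneg _) (by positivity)
    nlinarith [hZsq t ht, hZge t ht]
  refine ⟨fun i t => c a t * fieldCoeff (B 2) (B 0) i + c b t * fieldCoeff (B 2) (B 1) i +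
      (ρ + t) / Z t * fieldCoeff 0 (B 2) i,
    fun i t => c' a t * fieldCoeff (B 2) (B 0) i + c' b t * fieldCoeff (B 2) (B 1) i +
      (1 * Z t - (ρ + t) * (N t / Z t)) / Z t ^ 2 * fieldCoeff 0 (B 2) i, ?_, ?_, ?_, ?_⟩
  · intro t ht
    have hp := hZpos t ht
    have hin (i j : Fin 3) : inner ℝ (B i) (B j) = if i = j then (1 : ℝ) else 0 :=
      orthonormal_iff_ite.1 B.orthonormal i j
    have hi0 : inner ℝ (coneCurve B ρ a b t) (B 0) = ρ * t * a := by
      simp [coneCurve, inner_add_left, inner_smul_left, hin]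
    have hi1 : inner ℝ (coneCurve B ρ a b t) (B 1) = ρ * t * b := by
      simp [coneCurve, inner_add_left, inner_smul_left, hin]
    have hi2 : inner ℝ (coneCurve B ρ a b t) (B 2) = Z t - 1 := by
      simp [coneCurve, inner_add_left, inner_smul_left, hin, hZ]
    have hl (k : ℝ) : HasDerivAt (fun t => ρ * t * k) (ρ * k) t := by
      simpa using ((hasDerivAt_id' t).const_mul ρ).mul_const k
    have hd : HasDerivAt (coneCurve B ρ a b)
        ((ρ * a) • B 0 + (ρ * b) • B 1 + (N t / Z t) • B 2) t :=
      (((hl a).smul_const (B 0)).fun_add ((hl b).smul_const (B 1))).fun_add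
        (((hZ' t ht).sub_const 1).smul_const (B 2))
    convert! hd using 1
    simp only [add_smul, mul_smul, Finset.sum_add_distrib, ← Finset.smul_sum, sum_fieldCoeff,
      hi0, hi1, hi2, smul_zero, inner_zero_right, sub_zero, zero_add, one_smul, hc, hN,
      sub_add_cancel]
    match_scalars <;> field_simp
    ring
  · intro i t ht
    exact (((hcd a t ht).mul_const _).fun_add ((hcd b t ht).mul_const _)).fun_add
      ((hdd t ht).mul_const _)
  all_goals
    intro i t ht
    have k0 := abs_fieldCoeff_le (B.orthonormal.1 2).le (B.orthonormal.1 0).le i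
    have k1 := abs_fieldCoeff_le (B.orthonormal.1 2).le (B.orthonormal.1 1).le i
    have k2 := abs_fieldCoeff_le (e := 0) (by simp) (B.orthonormal.1 2).le i
    refine (abs_add_le _ _).trans ((add_le_add_left (abs_add_le _ _) _).trans ?_)
    rw [abs_mul, abs_mul, abs_mul]
  · have j0 := mul_le_mul (hcb ⟨ha0, ha1⟩ t ht) k0 (abs_nonneg _) zero_le_one
    have j1 := mul_le_mul (hcb ⟨hb0, hb1⟩ t ht) k1 (abs_nonneg _) zero_le_one
    have j2 := mul_le_mul (hdb t ht) k2 (abs_nonneg _) (by norm_num)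
    linarith
  · have j0 := mul_le_mul (hcb' ⟨ha0, ha1⟩ t ht) k0 (abs_nonneg _) (by norm_num)
    have j1 := mul_le_mul (hcb' ⟨hb0, hb1⟩ t ht) k1 (abs_nonneg _) (by norm_num)
    have j2 := mul_le_mul (hdb' t ht) k2 (abs_nonneg _) (by norm_num)
    linarith

lemma lintegral_orthonormalBasis (B : OrthonormalBasis (Fin 3) ℝ (EuclideanSpace ℝ (Fin 3)))
    {F : EuclideanSpace ℝ (Fin 3) → ENNReal} (hF : Measurable F) :
    ∫⁻ p : ℝ, ∫⁻ q : ℝ, ∫⁻ z : ℝ, F (p • B 0 + q • B 1 + z • B 2) = ∫⁻ y, F y := by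
  set e := (MeasurableEquiv.piFinSuccAbove (fun _ : Fin 3 => ℝ) 0).symm
  set G : (Fin 3 → ℝ) → ENNReal := fun y => F (B.repr.symm (WithLp.toLp 2 y)) with hG
  have hGm : Measurable G := hF.comp (by fun_prop)
  have e1 : ∫⁻ y, G y = ∫⁻ y, F y := (B.measurePreserving_repr_symm.comp
    (PiLp.volume_preserving_toLp (Fin 3))).lintegral_comp hF
  have e2 : ∫⁻ x, G (e x) = ∫⁻ y, G y :=
    ((volume_preserving_piFinSuccAbove (fun _ : Fin 3 => ℝ) 0).symm).lintegral_comp hGm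
  have e3 (p : ℝ) : ∫⁻ x : ℝ × ℝ, G (e (p, MeasurableEquiv.finTwoArrow.symm x)) =
      ∫⁻ y, G (e (p, y)) :=
    ((volume_preserving_finTwoArrow ℝ).symm).lintegral_comp
      (f := fun y => G (e (p, y))) (hGm.comp (e.measurable.comp (by fun_prop)))
  rw [← e1, ← e2, Measure.volume_eq_prod,
    lintegral_prod (fun x => G (e x)) (hGm.comp e.measurable).aemeasurable]
  refine lintegral_congr fun p => ?_
  rw [← e3 p, Measure.volume_eq_prod, lintegral_prod
    (fun x : ℝ × ℝ => G (e (p, MeasurableEquiv.finTwoArrow.symm x)))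
    (hGm.comp (e.measurable.comp (by fun_prop))).aemeasurable]
  refine lintegral_congr fun q => lintegral_congr fun z => ?_
  simp only [hG]
  rw [← B.sum_repr_symm, Fin.sum_univ_three]
  rfl

open Set in
lemma dirDeriv_decay {u : EuclideanSpace ℝ (Fin 3) → ℝ} (hu : ContDiff ℝ (⊤ : ℕ∞) u)
    (v : EuclideanSpace ℝ (Fin 3)) (B : OrthonormalBasis (Fin 3) ℝ (EuclideanSpace ℝ (Fin 3)))
    {r T : ℝ} (hr : 0 ≤ r) (hT0 : 0 ≤ T) (hT : eLpNorm (gradSum u) 2 volume ≤ ENNReal.ofReal T) :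
    (1 + r) * |dirDeriv v u (r • B 2)| ≤ 2 * (63 * ‖v‖ * (1 + 6 * 100 + 36 * 100 ^ 2)) * T := by
  set ρ := 1 + r with hρ
  have hρ1 : 1 ≤ ρ := by linarith
  set K : ℝ := 63 * ‖v‖ * (1 + 6 * 100 + 36 * 100 ^ 2) with hK
  have hK0 : 0 ≤ K := by positivity
  set w := dirDeriv v u (r • B 2) with hw
  have hScont := continuous_gradSum hu
  set F : EuclideanSpace ℝ (Fin 3) → ENNReal := fun y => ENNReal.ofReal (gradSum u y ^ 2) with hF
  have hFm : Measurable F := by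
    have := hScont.measurable
    fun_prop
  have hcurve : ∀ a ∈ Icc (0 : ℝ) (1 / 2), ∀ b ∈ Icc (0 : ℝ) (1 / 2),
      ENNReal.ofReal ((ρ * w) ^ 2) ≤ ENNReal.ofReal (K ^ 2) * ∫⁻ t in Icc (0 : ℝ) 1,
        ENNReal.ofReal ((ρ * t) ^ 2) * F (coneCurve B ρ a b t) := by
    intro a ha b hb
    obtain ⟨δ, δ', h1, h2, h3, h4⟩ := exists_coneCurve_field B hρ1 ha hb
    have key := sq_dirDeriv_le_integral hu v h1 h2 h3 h4
    have h0 : coneCurve B ρ a b 0 = r • B 2 := by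
      simp [coneCurve, sphereHeight, ρ,
        Real.sqrt_sq (add_nonneg zero_le_one hr)]
    rw [h0, ← hw, ← hK] at key
    have hint : IntegrableOn (fun t => (ρ * t) ^ 2 * gradSum u (coneCurve B ρ a b t) ^ 2)
        (Icc 0 1) := by
      refine ContinuousOn.integrableOn_compact isCompact_Icc ?_
      have hc : ContinuousOn (coneCurve B ρ a b) (Icc 0 1) := fun t ht =>
        (h1 t ht).continuousAt.continuousWithinAt
      exact ((continuous_const.mul continuous_id).pow 2).continuousOn.mul
        ((hScont.comp_continuousOn hc).pow 2)
    have h5 : (ρ * w) ^ 2 ≤ K ^ 2 *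
        ∫ t in Icc (0 : ℝ) 1, (ρ * t) ^ 2 * gradSum u (coneCurve B ρ a b t) ^ 2 := by
      rw [intervalIntegral.integral_of_le zero_le_one, ← integral_Icc_eq_integral_Ioc] at key
      have h6 := mul_le_mul_of_nonneg_left key (sq_nonneg ρ)
      simp only [mul_pow, mul_assoc]
      rw [integral_const_mul]
      linarith
    refine (ENNReal.ofReal_le_ofReal h5).trans_eq ?_
    rw [ENNReal.ofReal_mul (sq_nonneg K),
      ofReal_integral_eq_lintegral_ofReal hint (Filter.Eventually.of_forall fun t => by positivity)]
    congr 1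
    refine lintegral_congr fun t => ?_
    rw [ENNReal.ofReal_mul (sq_nonneg _)]
  have hvol : volume (Icc (0 : ℝ) (1 / 2)) = ENNReal.ofReal (1 / 2) := by simp
  have h7 : ENNReal.ofReal ((ρ * w) ^ 2 * (1 / 2) * (1 / 2)) ≤ ENNReal.ofReal (K ^ 2) * ∫⁻ y, F y :=
    calc ENNReal.ofReal ((ρ * w) ^ 2 * (1 / 2) * (1 / 2))
        = ∫⁻ _ in Icc (0 : ℝ) (1 / 2), ∫⁻ _ in Icc (0 : ℝ) (1 / 2),
            ENNReal.ofReal ((ρ * w) ^ 2) := by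
          rw [setLIntegral_const, setLIntegral_const, hvol, ← ENNReal.ofReal_mul (by positivity),
            ← ENNReal.ofReal_mul (by positivity)]
      _ ≤ ∫⁻ a in Icc (0 : ℝ) (1 / 2), ∫⁻ b in Icc (0 : ℝ) (1 / 2),
            ENNReal.ofReal (K ^ 2) * ∫⁻ t in Icc (0 : ℝ) 1,
              ENNReal.ofReal ((ρ * t) ^ 2) * F (coneCurve B ρ a b t) :=
          setLIntegral_mono' measurableSet_Icc fun a ha =>
            setLIntegral_mono' measurableSet_Icc fun b hb => hcurve a ha b hb
      _ = ENNReal.ofReal (K ^ 2) * ∫⁻ a in Icc (0 : ℝ) (1 / 2), ∫⁻ b in Icc (0 : ℝ) (1 / 2),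
            ∫⁻ t in Icc (0 : ℝ) 1, ENNReal.ofReal ((ρ * t) ^ 2) * F (coneCurve B ρ a b t) := by
          simp_rw [lintegral_const_mul' _ _ ENNReal.ofReal_ne_top]
      _ ≤ ENNReal.ofReal (K ^ 2) * ∫⁻ p : ℝ, ∫⁻ q : ℝ, ∫⁻ z : ℝ,
            F (p • B 0 + q • B 1 + z • B 2) := by
          refine mul_le_mul_right ?_ _
          exact lintegral_cone_le hρ1
            (F := fun x : ℝ × ℝ × ℝ => F (x.1 • B 0 + x.2.1 • B 1 + x.2.2 • B 2))
            (hFm.comp (by fun_prop))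
      _ = ENNReal.ofReal (K ^ 2) * ∫⁻ y, F y := by rw [lintegral_orthonormalBasis B hFm]
  have h8 : ∫⁻ y, F y ≤ ENNReal.ofReal (T ^ 2) := by
    have h9 := pow_le_pow_left' hT 2
    rw [← ENNReal.ofReal_pow hT0] at h9
    refine le_trans (le_of_eq ?_) h9
    have h10 := eLpNorm_nnreal_pow_eq_lintegral (f := gradSum u)
      (μ := (volume : Measure (EuclideanSpace ℝ (Fin 3)))) (p := 2) (by simp)
    norm_num at h10
    rw [h10]
    refine lintegral_congr fun y => ?_
    simp only [hF]
    rw [ENNReal.ofReal_pow (gradSum_nonneg u y),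
      Real.enorm_eq_ofReal (gradSum_nonneg u y)]
  have h11 := h7.trans (mul_le_mul_right h8 _)
  rw [← ENNReal.ofReal_mul (sq_nonneg K), ENNReal.ofReal_le_ofReal_iff (by positivity)] at h11
  have h12 : |ρ * w| ≤ 2 * K * T := abs_le_of_sq_le_sq (by linarith) (by positivity)
  rwa [abs_mul, abs_of_nonneg (by linarith : 0 ≤ ρ)] at h12

lemma exists_orthonormalBasis_eq_norm_smul (x : EuclideanSpace ℝ (Fin 3)) :
    ∃ B : OrthonormalBasis (Fin 3) ℝ (EuclideanSpace ℝ (Fin 3)), x = ‖x‖ • B 2 := by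
  by_cases hx : x = 0
  · exact ⟨EuclideanSpace.basisFun (Fin 3) ℝ, by simp [hx]⟩
  · have hn : ‖x‖ ≠ 0 := norm_ne_zero_iff.2 hx
    obtain ⟨B, hB⟩ := Orthonormal.exists_orthonormalBasis_extension_of_card_eq (𝕜 := ℝ)
      (E := EuclideanSpace ℝ (Fin 3)) (ι := Fin 3) (by simp) (v := fun _ => ‖x‖⁻¹ • x) (s := {2})
      ⟨fun i => by simp [Set.domRestrict, norm_smul, hn],
        fun i j h => (h (Subsingleton.elim i j)).elim⟩
    refine ⟨B, ?_⟩
    rw [hB 2 rfl, smul_smul, mul_inv_cancel₀ hn, one_smul]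

/-- Weighted Sobolev decay: `⟨|x|⟩ |∂u(x)| ≤ C Σ_{|α|≤2} ‖∂ Γ^α u‖_{L²}`
with `Γ^α` products of at most two of `(∂₁, ∂₂, ∂₃, Ω₁₂, Ω₁₃, Ω₂₃)`. -/
theorem stmt_10 :
    ∃ C : ℝ, 0 < C ∧ ∀ u : EuclideanSpace ℝ (Fin 3) → ℝ,
      ContDiff ℝ (⊤ : ℕ∞) u → HasCompactSupport u →
      ∀ x : EuclideanSpace ℝ (Fin 3),
        Real.sqrt (1 + ‖x‖ ^ 2) * ‖fderiv ℝ u x‖ ≤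
          C * (gradL2 u + (∑ a, gradL2 (gfield3 a u)) +
            ∑ a, ∑ b, gradL2 (gfield3 a (gfield3 b u))) := by
  refine ⟨2 * (63 * (1 + 6 * 100 + 36 * 100 ^ 2)), by norm_num, fun u hu hc x => ?_⟩
  have hn := gradL2_nonneg_s10
  have hT := eLpNorm_gradSum_le hu hc
  have hT0 : 0 ≤ gradL2 u + (∑ a, gradL2 (gfield3 a u)) +
      ∑ a, ∑ b, gradL2 (gfield3 a (gfield3 b u)) :=
    add_nonneg (add_nonneg (hn _) (Finset.sum_nonneg fun _ _ => hn _))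
      (Finset.sum_nonneg fun _ _ => Finset.sum_nonneg fun _ _ => hn _)
  obtain ⟨B, hB⟩ := exists_orthonormalBasis_eq_norm_smul x
  have hx := norm_nonneg x
  have hsqrt : Real.sqrt (1 + ‖x‖ ^ 2) ≤ 1 + ‖x‖ :=
    Real.sqrt_le_iff.2 ⟨by positivity, by nlinarith⟩
  refine (mul_le_mul_of_nonneg_right hsqrt (norm_nonneg _)).trans ?_
  rw [← le_div_iff₀' (by positivity)]
  refine ContinuousLinearMap.opNorm_le_bound _ (by positivity) fun v => ?_
  have h := dirDeriv_decay hu v B hx hT0 hT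
  rw [← hB] at h
  rw [div_mul_eq_mul_div, le_div_iff₀' (by positivity)]
  refine h.trans_eq ?_
  ring
end

section
/- Localized Sobolev estimate away from the origin: there is a constant C (depending on n) such that for every r ≥ 2 and every smooth f : ℝⁿ → ℝ, r^{(n−1)/2} sup_{ω ∈ S^{n−1}} |f(rω)| ≤ C Σ_{|α| + |β| ≤ n/2 + 1} ‖∂^α Ω^β f‖_{L²(r−1 < |x| < r+1)}. -/
open MeasureTheory

/-- Spatial partial derivative `∂_i` on `ℝⁿ`. -/
noncomputable def pdn (n : ℕ) (i : Fin n) (u : EuclideanSpace ℝ (Fin n) → ℝ) :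
    EuclideanSpace ℝ (Fin n) → ℝ :=
  fun x => fderiv ℝ u x (EuclideanSpace.single i 1)

/-- Rotation vector field `Ω_{ij} = xⁱ ∂_j - xʲ ∂_i` on `ℝⁿ`. -/
noncomputable def rotn (n : ℕ) (i j : Fin n) (u : EuclideanSpace ℝ (Fin n) → ℝ) :
    EuclideanSpace ℝ (Fin n) → ℝ :=
  fun x => x i * pdn n j u x - x j * pdn n i u x

/-- Iterated spatial derivative `∂^α` for a multi-index `α` of length `k`. -/
noncomputable def applyD (n : ℕ) : ∀ {k : ℕ}, (Fin k → Fin n) →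
    (EuclideanSpace ℝ (Fin n) → ℝ) → EuclideanSpace ℝ (Fin n) → ℝ :=
  fun {k} α u => (List.ofFn α).foldr (fun i v => pdn n i v) u

/-- Iterated rotations `Ω^β` for a multi-index `β` of rotation indices (ordered pairs). -/
noncomputable def applyR (n : ℕ) : ∀ {k : ℕ}, (Fin k → {p : Fin n × Fin n // p.1 < p.2}) →
    (EuclideanSpace ℝ (Fin n) → ℝ) → EuclideanSpace ℝ (Fin n) → ℝ :=
  fun {k} β u => (List.ofFn β).foldr (fun p v => rotn n p.val.1 p.val.2 v) u

/-- `L²` norm over the unit-width annulus `{r - 1 < |x| < r + 1}`. -/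
noncomputable def annL2 (n : ℕ) (r : ℝ) (u : EuclideanSpace ℝ (Fin n) → ℝ) : ℝ :=
  (∫ x in {x : EuclideanSpace ℝ (Fin n) | r - 1 < ‖x‖ ∧ ‖x‖ < r + 1}, (u x) ^ 2)
    ^ ((1 : ℝ) / 2)

section Sobolev

open scoped FourierTransform LineDeriv ContDiff
open SchwartzMap

variable {n : ℕ}

theorem contDiff_pdn {u : EuclideanSpace ℝ (Fin n) → ℝ} (hu : ContDiff ℝ ∞ u) (i : Fin n) :
    ContDiff ℝ ∞ (pdn n i u) :=
  (hu.fderiv_right (m := ∞) (by simp)).clm_apply contDiff_const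

theorem contDiff_iterate_pdn {u : EuclideanSpace ℝ (Fin n) → ℝ} (hu : ContDiff ℝ ∞ u)
    (i : Fin n) (k : ℕ) : ContDiff ℝ ∞ ((pdn n i)^[k] u) := by
  induction k with
  | zero => exact hu
  | succ _ ih => rw [Function.iterate_succ_apply']; exact contDiff_pdn ih i

theorem iterate_lineDeriv_ofReal {u : EuclideanSpace ℝ (Fin n) → ℝ} (hu : ContDiff ℝ ∞ u)
    (U : 𝓢(EuclideanSpace ℝ (Fin n), ℂ)) (hU : ∀ x, U x = u x) (i : Fin n) (k : ℕ) :
    ∀ x, (∂_{(EuclideanSpace.single i (1 : ℝ))}^[k] U) x = (((pdn n i)^[k] u x : ℝ) : ℂ) := by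
  induction k with
  | zero => exact hU
  | succ k ih =>
    intro x
    rw [Function.iterate_succ_apply', Function.iterate_succ_apply', SchwartzMap.lineDerivOp_apply_eq_fderiv]
    have h1 : (⇑(∂_{(EuclideanSpace.single i (1 : ℝ))}^[k] U)) =
        fun x => Complex.ofRealCLM ((pdn n i)^[k] u x) := funext ih
    have h2 : DifferentiableAt ℝ ((pdn n i)^[k] u) x :=
      ((contDiff_iterate_pdn hu i k).differentiable (by simp)) x
    have h3 := (Complex.ofRealCLM.hasFDerivAt.comp x h2.hasFDerivAt).fderiv
    rw [h1]
    erw [h3]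
    rfl

theorem norm_fourier_iterate_lineDeriv (U : 𝓢(EuclideanSpace ℝ (Fin n), ℂ)) (i : Fin n) (k : ℕ)
    (ξ : EuclideanSpace ℝ (Fin n)) :
    ‖𝓕 (∂_{(EuclideanSpace.single i (1 : ℝ))}^[k] U) ξ‖ = (2 * Real.pi * |ξ i|) ^ k * ‖𝓕 U ξ‖ := by
  induction k with
  | zero => simp
  | succ k ih =>
    have : (inner ℝ · (EuclideanSpace.single i (1 : ℝ)) :
      EuclideanSpace ℝ (Fin n) → ℝ).HasTemperateGrowth := by fun_prop
    rw [Function.iterate_succ_apply', fourier_lineDerivOp_eq, smul_apply,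
      SchwartzMap.smulLeftCLM_apply_apply this, norm_smul, norm_smul, ih]
    simp [EuclideanSpace.inner_single_right, abs_of_pos Real.pi_pos]
    ring

theorem one_add_norm_pow_le {m : ℕ} (hm : m ≠ 0) (ξ : EuclideanSpace ℝ (Fin n)) :
    (1 + ‖ξ‖) ^ (2 * m) ≤
      2 ^ (2 * m) * (n + 1) ^ m * (1 + ∑ i, (2 * Real.pi * |ξ i|) ^ (2 * m)) := by
  obtain ⟨k, rfl⟩ := Nat.exists_eq_succ_of_ne_zero hm
  have h1 : (1 + ‖ξ‖) ^ (2 * (k + 1)) ≤ 2 ^ (2 * (k + 1)) * (1 + ‖ξ‖ ^ 2) ^ (k + 1) := by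
    rw [pow_mul, pow_mul, ← mul_pow]
    gcongr
    nlinarith [sq_nonneg (1 - ‖ξ‖), sq_nonneg (1 + ‖ξ‖)]
  have h2 : (1 + ‖ξ‖ ^ 2) ^ (k + 1) ≤ (n + 1) ^ k * (1 + ∑ i, (ξ i) ^ (2 * (k + 1))) := by
    have h3 := pow_sum_div_card_le_sum_pow (s := (Finset.univ : Finset (Option (Fin n))))
      (f := fun o => o.elim 1 (fun i => ξ i ^ 2)) (by rintro (_ | i) - <;> simp [sq_nonneg]) k
    simp only [Fintype.sum_option, Option.elim, Finset.card_univ, Fintype.card_option,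
      Fintype.card_fin, one_pow, ← pow_mul] at h3
    rw [div_le_iff₀ (by positivity)] at h3
    rw [EuclideanSpace.real_norm_sq_eq, mul_comm]
    exact_mod_cast h3
  have h4 : ∀ i, (ξ i) ^ (2 * (k + 1)) ≤ (2 * Real.pi * |ξ i|) ^ (2 * (k + 1)) := by
    intro i
    rw [← (even_two_mul (k + 1)).pow_abs]
    refine pow_le_pow_left₀ (abs_nonneg _) ?_ _
    nlinarith [Real.pi_gt_three, abs_nonneg (ξ i)]
  calc _ ≤ _ := h1
    _ ≤ 2 ^ (2 * (k + 1)) * ((n + 1) ^ k * (1 + ∑ i, (ξ i) ^ (2 * (k + 1)))) := by gcongr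
    _ ≤ 2 ^ (2 * (k + 1)) * ((n + 1) ^ (k + 1) *
        (1 + ∑ i, (2 * Real.pi * |ξ i|) ^ (2 * (k + 1)))) := by
      have h5 := Finset.sum_le_sum fun i (_ : i ∈ Finset.univ) => h4 i
      have h6 : ((n : ℝ) + 1) ^ k ≤ (n + 1) ^ (k + 1) := pow_le_pow_right₀ (by simp) (by simp)
      have h7 : 0 ≤ ∑ i, (ξ i) ^ (2 * (k + 1)) :=
        Finset.sum_nonneg fun i _ => (even_two_mul _).pow_nonneg _
      gcongr
    _ = _ := by rw [mul_assoc]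

theorem sq_integral_le_of_mul_weight {α : Type*} [MeasurableSpace α] {μ : Measure α} {g w : α → ℝ}
    (hw : ∀ x, 0 < w x) (hg : Integrable g μ) (hwi : Integrable (fun x => (w x)⁻¹) μ)
    (hgw : Integrable (fun x => w x * g x ^ 2) μ) :
    (∫ x, g x ∂μ) ^ 2 ≤ (∫ x, (w x)⁻¹ ∂μ) * ∫ x, w x * g x ^ 2 ∂μ := by
  have key : ∀ t : ℝ, 0 ≤ (∫ x, w x * g x ^ 2 ∂μ) * (t * t) + (-2 * ∫ x, g x ∂μ) * t
      + ∫ x, (w x)⁻¹ ∂μ := by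
    intro t
    rw [← integral_mul_const, ← integral_const_mul, ← integral_mul_const,
      ← integral_add (hgw.mul_const _) ((hg.const_mul _).mul_const _), ← integral_add _ hwi]
    · refine integral_nonneg fun x => ?_
      have : w x * g x ^ 2 * (t * t) + -2 * g x * t + (w x)⁻¹ = (w x)⁻¹ * (w x * g x * t - 1) ^ 2 := by
        have := (hw x).ne'
        field_simp
        ring
      simp only [Pi.zero_apply, this]
      have := hw x
      positivity
    · exact (hgw.mul_const _).add ((hg.const_mul _).mul_const _)
  have := discrim_le_zero key
  rw [discrim] at this
  nlinarith

/-- Sobolev embedding of `H^m` into the bounded functions, using pure derivatives only. -/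
theorem exists_sq_le_integral_iterate_pdn {m : ℕ} (hm : n < 2 * m) :
    ∃ C : ℝ, 0 ≤ C ∧ ∀ u : EuclideanSpace ℝ (Fin n) → ℝ, ContDiff ℝ ∞ u → HasCompactSupport u →
      ∀ x, (u x) ^ 2 ≤ C * ((∫ y, (u y) ^ 2) + ∑ i, ∫ y, ((pdn n i)^[m] u y) ^ 2) := by
  have hm0 : m ≠ 0 := by omega
  set w : EuclideanSpace ℝ (Fin n) → ℝ := fun ξ => 1 + ∑ i, (2 * Real.pi * |ξ i|) ^ (2 * m) with hw
  have hwpos : ∀ ξ, 0 < w ξ := fun ξ => by positivity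
  have hwc : Continuous w := by fun_prop
  have hwi : Integrable (fun ξ => (w ξ)⁻¹) := by
    have h1 : Integrable (fun ξ : EuclideanSpace ℝ (Fin n) => (1 + ‖ξ‖) ^ (-((2 * m : ℕ) : ℝ))) :=
      integrable_one_add_norm (by rw [finrank_euclideanSpace_fin]; exact_mod_cast hm)
    refine (h1.const_mul (2 ^ (2 * m) * (n + 1) ^ m)).mono'
      (hwc.inv₀ fun x => (hwpos x).ne').aestronglyMeasurable (.of_forall fun ξ => ?_)
    rw [Real.norm_of_nonneg (by have := hwpos ξ; positivity), Real.rpow_neg (by positivity),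
      Real.rpow_natCast]
    have := one_add_norm_pow_le hm0 ξ
    rw [← div_eq_mul_inv, inv_le_comm₀ (hwpos ξ) (by positivity), inv_div, div_le_iff₀ (by positivity)]
    rw [mul_comm (w ξ)]
    exact this
  refine ⟨∫ ξ, (w ξ)⁻¹, integral_nonneg fun ξ => by have := hwpos ξ; positivity, ?_⟩
  intro u hu huc x
  have hUs : ContDiff ℝ ∞ (fun x => (u x : ℂ)) := Complex.ofRealCLM.contDiff.comp hu
  have hUc : HasCompactSupport (fun x => (u x : ℂ)) := huc.comp_left (g := fun t : ℝ => (t : ℂ)) rfl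
  set U : 𝓢(EuclideanSpace ℝ (Fin n), ℂ) := hUc.toSchwartzMap hUs with hUdef
  have hU : ∀ x, U x = u x := fun x => rfl
  have hL2 : ∀ V : 𝓢(EuclideanSpace ℝ (Fin n), ℂ), Integrable (fun ξ => ‖V ξ‖ ^ 2) := fun V =>
    (V.memLp 2).integrable_norm_pow (by simp)
  have hpl : ∀ i, ∫ ξ, (2 * Real.pi * |ξ i|) ^ (2 * m) * ‖𝓕 U ξ‖ ^ 2 =
      ∫ y, ((pdn n i)^[m] u y) ^ 2 := by
    intro i
    have := integral_norm_sq_fourier (∂_{(EuclideanSpace.single i (1 : ℝ))}^[m] U)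
    simp_rw [norm_fourier_iterate_lineDeriv, iterate_lineDeriv_ofReal hu U hU] at this
    simpa [mul_pow, ← pow_mul, mul_comm m 2] using this
  have hpi : ∀ i, Integrable fun ξ => (2 * Real.pi * |ξ i|) ^ (2 * m) * ‖𝓕 U ξ‖ ^ 2 := by
    intro i
    have := hL2 (𝓕 (∂_{(EuclideanSpace.single i (1 : ℝ))}^[m] U))
    simp_rw [norm_fourier_iterate_lineDeriv] at this
    convert this using 2 with ξ
    ring
  have hp0 : ∫ ξ, ‖𝓕 U ξ‖ ^ 2 = ∫ y, (u y) ^ 2 := by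
    have := integral_norm_sq_fourier U
    simpa [hU] using this
  have hwU : (fun ξ => w ξ * ‖𝓕 U ξ‖ ^ 2) = fun ξ => ‖𝓕 U ξ‖ ^ 2 +
      ∑ i, (2 * Real.pi * |ξ i|) ^ (2 * m) * ‖𝓕 U ξ‖ ^ 2 := by
    ext ξ
    rw [hw, add_mul, one_mul, Finset.sum_mul]
  have hsum : ∫ ξ, w ξ * ‖𝓕 U ξ‖ ^ 2 = (∫ y, (u y) ^ 2) + ∑ i, ∫ y, ((pdn n i)^[m] u y) ^ 2 := by
    rw [hwU, integral_add (hL2 _) (integrable_finsetSum _ fun i _ => hpi i),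
      integral_finsetSum _ fun i _ => hpi i, hp0]
    simp_rw [hpl]
  have hint : Integrable (fun ξ => ‖𝓕 U ξ‖) := (𝓕 U).integrable.norm
  have hpt : |u x| ≤ ∫ ξ, ‖𝓕 U ξ‖ := by
    have hinv : 𝓕⁻ (𝓕 U) = U := FourierTransform.fourierInv_fourier_eq U
    have h1 : U x = 𝓕⁻ (fun y => (𝓕 U : 𝓢(EuclideanSpace ℝ (Fin n), ℂ)) y) x := by
      conv_lhs => rw [← hinv, fourierInv_coe]
    have h2 : |u x| = ‖U x‖ := by simp [hU]
    rw [h2, h1, Real.fourierInv_eq]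
    refine (norm_integral_le_integral_norm _).trans (le_of_eq ?_)
    simp
  calc (u x) ^ 2 = |u x| ^ 2 := (sq_abs _).symm
    _ ≤ (∫ ξ, ‖𝓕 U ξ‖) ^ 2 := by gcongr
    _ ≤ _ := sq_integral_le_of_mul_weight hwpos hint hwi (by
        rw [hwU]; exact (hL2 _).add (integrable_finsetSum _ fun i _ => hpi i))
    _ = _ := by rw [hsum]

end Sobolev

section ShellMap

open scoped ContDiff

variable {n : ℕ}

/-- The open shell `1/2 < |x| < 3/2`. -/
def unitShell (n : ℕ) : Set (EuclideanSpace ℝ (Fin n)) := {x | 1 / 2 < ‖x‖ ∧ ‖x‖ < 3 / 2}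

/-- The annulus `r - 1 < |x| < r + 1`. -/
def annulus (n : ℕ) (r : ℝ) : Set (EuclideanSpace ℝ (Fin n)) := {x | r - 1 < ‖x‖ ∧ ‖x‖ < r + 1}

/-- The radial map sending the sphere of radius `ρ` to the sphere of radius `ρ + r - 1`. -/
noncomputable def shellMap (r : ℝ) (x : EuclideanSpace ℝ (Fin n)) : EuclideanSpace ℝ (Fin n) :=
  (1 + (r - 1) * ‖x‖⁻¹) • x

/-- The derivative of `shellMap`. -/
noncomputable def shellMapDeriv (r : ℝ) (x : EuclideanSpace ℝ (Fin n)) :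
    EuclideanSpace ℝ (Fin n) →L[ℝ] EuclideanSpace ℝ (Fin n) :=
  (1 + (r - 1) * ‖x‖⁻¹) • ContinuousLinearMap.id ℝ _ +
    ((-(r - 1) * (‖x‖⁻¹) ^ 3) • innerSL ℝ x).smulRight x

theorem ne_zero_of_mem_unitShell {x : EuclideanSpace ℝ (Fin n)} (hx : x ∈ unitShell n) : x ≠ 0 :=
  norm_pos_iff.mp ((by norm_num : (0 : ℝ) < 1 / 2).trans hx.1)

theorem isOpen_unitShell : IsOpen (unitShell n) :=
  (isOpen_lt continuous_const continuous_norm).inter (isOpen_lt continuous_norm continuous_const)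

theorem hasFDerivAt_shellMap (r : ℝ) {x : EuclideanSpace ℝ (Fin n)} (hx : x ≠ 0) :
    HasFDerivAt (shellMap r) (shellMapDeriv r x) x := by
  have hx' : ‖x‖ ≠ 0 := norm_ne_zero_iff.mpr hx
  have h1 : HasFDerivAt (fun y : EuclideanSpace ℝ (Fin n) => ‖y‖) (‖x‖⁻¹ • innerSL ℝ x) x := by
    have h2 := ((hasStrictFDerivAt_norm_sq x).hasFDerivAt.sqrt (by positivity))
    simp only [Real.sqrt_sq (norm_nonneg _)] at h2
    refine h2.congr_fderiv ?_
    rw [← Nat.cast_smul_eq_nsmul ℝ, smul_smul]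
    congr 1
    push_cast
    field_simp
  have h3 : HasFDerivAt (fun y : EuclideanSpace ℝ (Fin n) => 1 + (r - 1) * ‖y‖⁻¹)
      ((-(r - 1) * (‖x‖⁻¹) ^ 3) • innerSL ℝ x) x := by
    have h4 := (((hasDerivAt_inv hx').comp_hasFDerivAt x h1).const_mul (r - 1)).const_add 1
    refine h4.congr_fderiv ?_
    rw [smul_smul, smul_smul]
    congr 1
    field_simp
  exact h3.smul (hasFDerivAt_id x)

theorem norm_shellMap {r : ℝ} (hr : 1 ≤ r) {x : EuclideanSpace ℝ (Fin n)} (hx : x ≠ 0) :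
    ‖shellMap r x‖ = ‖x‖ + (r - 1) := by
  have hx' : 0 < ‖x‖ := norm_pos_iff.mpr hx
  have : 0 ≤ r - 1 := by linarith
  rw [shellMap, norm_smul, Real.norm_of_nonneg (by positivity)]
  field_simp

theorem injOn_shellMap {r : ℝ} (hr : 1 ≤ r) : Set.InjOn (shellMap r) (unitShell n) := by
  intro x hx y hy hxy
  have hx0 := ne_zero_of_mem_unitShell hx
  have hn : ‖x‖ = ‖y‖ := by
    have := congrArg norm hxy
    rw [norm_shellMap hr hx0, norm_shellMap hr (ne_zero_of_mem_unitShell hy)] at this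
    linarith
  have hx' : 0 < ‖x‖ := norm_pos_iff.mpr hx0
  have : 0 ≤ r - 1 := by linarith
  rw [shellMap, shellMap, ← hn] at hxy
  exact smul_right_injective _ (by positivity : (1 + (r - 1) * ‖x‖⁻¹) ≠ 0) hxy

theorem det_shellMapDeriv {r : ℝ} (hr : 1 ≤ r) {x : EuclideanSpace ℝ (Fin n)} (hx : x ≠ 0)
    (hn : n ≠ 0) : (shellMapDeriv r x).det = (1 + (r - 1) * ‖x‖⁻¹) ^ (n - 1) := by
  have hx' : 0 < ‖x‖ := norm_pos_iff.mpr hx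
  have hr' : 0 ≤ r - 1 := by linarith
  set ψ := 1 + (r - 1) * ‖x‖⁻¹ with hψ
  have hψ0 : 0 < ψ := by positivity
  have h1 : ((shellMapDeriv r x : EuclideanSpace ℝ (Fin n) →L[ℝ] EuclideanSpace ℝ (Fin n)) :
      EuclideanSpace ℝ (Fin n) →ₗ[ℝ] EuclideanSpace ℝ (Fin n)) = ψ • LinearMap.transvection
      ((ψ⁻¹ * (-(r - 1) * (‖x‖⁻¹) ^ 3)) • (innerSL ℝ x : EuclideanSpace ℝ (Fin n) →ₗ[ℝ] ℝ)) x := by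
    ext v : 1
    simp only [shellMapDeriv, LinearMap.transvection.apply, LinearMap.smul_apply,
      ContinuousLinearMap.coe_coe, add_apply, smul_apply,
      ContinuousLinearMap.smulRight_apply, ContinuousLinearMap.id_apply, smul_add, smul_smul,
      smul_eq_mul, ← mul_assoc, ← hψ, mul_inv_cancel₀ hψ0.ne', one_mul]
  rw [ContinuousLinearMap.det, h1, LinearMap.det_smul, LinearMap.transvection.det,
    finrank_euclideanSpace_fin]
  obtain ⟨k, rfl⟩ := Nat.exists_eq_succ_of_ne_zero hn
  have h2 : 1 + ((ψ⁻¹ * (-(r - 1) * (‖x‖⁻¹) ^ 3)) •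
      (innerSL ℝ x : EuclideanSpace ℝ (Fin (k + 1)) →ₗ[ℝ] ℝ)) x = ψ⁻¹ := by
    simp only [LinearMap.smul_apply, ContinuousLinearMap.coe_coe, innerSL_apply_apply,
      real_inner_self_eq_norm_sq, smul_eq_mul]
    rw [hψ]
    have : ‖x‖ + (r - 1) ≠ 0 := by positivity
    field_simp
    ring
  rw [h2]
  simp only [Nat.succ_eq_add_one, pow_succ, Nat.add_sub_cancel]
  field_simp

theorem shellMap_image_subset {r : ℝ} (hr : 1 ≤ r) : shellMap r '' unitShell n ⊆ annulus n r := by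
  rintro _ ⟨x, hx, rfl⟩
  have := norm_shellMap hr (ne_zero_of_mem_unitShell hx)
  obtain ⟨h1, h2⟩ := hx
  constructor <;> rw [this] <;> linarith

/-- The squared `L²` norm over the annulus. -/
noncomputable def annulusEnergy (r : ℝ) (u : EuclideanSpace ℝ (Fin n) → ℝ) : ℝ :=
  ∫ x in annulus n r, (u x) ^ 2

theorem annulusEnergy_nonneg (r : ℝ) (u : EuclideanSpace ℝ (Fin n) → ℝ) :
    0 ≤ annulusEnergy r u :=
  integral_nonneg fun _ => sq_nonneg _

theorem integrableOn_annulus (r : ℝ) {g : EuclideanSpace ℝ (Fin n) → ℝ} (hg : Continuous g) :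
    IntegrableOn g (annulus n r) :=
  (hg.continuousOn.integrableOn_compact
    (isCompact_closedBall (0 : EuclideanSpace ℝ (Fin n)) (r + 1))).mono_set fun x hx => by
      simpa using hx.2.le

theorem setIntegral_unitShell_shellMap_le {r : ℝ} (hr : 2 ≤ r) (hn : n ≠ 0)
    {h : EuclideanSpace ℝ (Fin n) → ℝ} (hh : Continuous h) :
    IntegrableOn (fun x => h (shellMap r x) ^ 2) (unitShell n) ∧
    ∫ x in unitShell n, h (shellMap r x) ^ 2 ≤
      2 ^ (n - 1) * (r ^ (n - 1))⁻¹ * annulusEnergy r h := by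
  have hr1 : 1 ≤ r := by linarith
  have hm : MeasurableSet (unitShell n) := isOpen_unitShell.measurableSet
  have hder : ∀ x ∈ unitShell n, HasFDerivWithinAt (shellMap r) (shellMapDeriv r x) (unitShell n) x :=
    fun x hx => (hasFDerivAt_shellMap r (ne_zero_of_mem_unitShell hx)).hasFDerivWithinAt
  have hI : IntegrableOn (fun x => h x ^ 2) (annulus n r) := integrableOn_annulus r (hh.pow 2)
  have hJ := (integrableOn_image_iff_integrableOn_abs_det_fderiv_smul volume hm hder
    (injOn_shellMap hr1) (fun x => h x ^ 2)).mp (hI.mono_set (shellMap_image_subset hr1))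
  have hcv := integral_image_eq_integral_abs_det_fderiv_smul volume hm hder
    (injOn_shellMap hr1) (fun x => h x ^ 2)
  have hpt : ∀ x ∈ unitShell n, h (shellMap r x) ^ 2 ≤ 2 ^ (n - 1) * (r ^ (n - 1))⁻¹ *
      (|(shellMapDeriv r x).det| • h (shellMap r x) ^ 2) := by
    intro x hx
    have hx0 := ne_zero_of_mem_unitShell hx
    have hx' : 0 < ‖x‖ := norm_pos_iff.mpr hx0
    have hψ : r / 2 ≤ 1 + (r - 1) * ‖x‖⁻¹ := by
      have : (2 : ℝ) / 3 ≤ ‖x‖⁻¹ := by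
        rw [le_inv_comm₀ (by norm_num) hx']
        have := hx.2
        norm_num
        linarith
      nlinarith
    have hp := pow_le_pow_left₀ (by positivity) hψ (n - 1)
    rw [det_shellMapDeriv hr1 hx0 hn, abs_of_nonneg (le_trans (by positivity) hp), smul_eq_mul,
      ← mul_assoc]
    refine le_mul_of_one_le_left (sq_nonneg _) ?_
    calc (1 : ℝ) = 2 ^ (n - 1) * (r ^ (n - 1))⁻¹ * (r / 2) ^ (n - 1) := by
          rw [div_pow]; field_simp
      _ ≤ _ := by gcongr
  have hcont : ContinuousOn (fun x => h (shellMap r x) ^ 2) (unitShell n) := fun x hx =>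
    ((hh.continuousAt.comp (hasFDerivAt_shellMap r (ne_zero_of_mem_unitShell hx)).continuousAt).pow
      2).continuousWithinAt
  have hint : IntegrableOn (fun x => h (shellMap r x) ^ 2) (unitShell n) := by
    refine (hJ.const_mul (2 ^ (n - 1) * (r ^ (n - 1))⁻¹)).mono' (hcont.aestronglyMeasurable hm) ?_
    filter_upwards [ae_restrict_mem hm] with x hx
    rw [Real.norm_of_nonneg (sq_nonneg _)]
    exact hpt x hx
  refine ⟨hint, ?_⟩
  calc ∫ x in unitShell n, h (shellMap r x) ^ 2
      ≤ ∫ x in unitShell n, 2 ^ (n - 1) * (r ^ (n - 1))⁻¹ *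
      (|(shellMapDeriv r x).det| • h (shellMap r x) ^ 2) :=
        setIntegral_mono_on hint (hJ.const_mul _) hm hpt
    _ = 2 ^ (n - 1) * (r ^ (n - 1))⁻¹ * ∫ x in shellMap r '' unitShell n, h x ^ 2 := by
        rw [integral_const_mul, hcv]
    _ ≤ _ := by
        have : 0 ≤ r := by linarith
        refine mul_le_mul_of_nonneg_left ?_ (by positivity)
        exact setIntegral_mono_set hI (.of_forall fun _ => sq_nonneg _)
          (shellMap_image_subset hr1).eventuallyLE

/-- Smooth functions with closed support in the unit shell. -/
structure IsShellCutoff (c : EuclideanSpace ℝ (Fin n) → ℝ) : Prop where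
  contDiff : ContDiff ℝ ∞ c
  tsupport_subset : tsupport c ⊆ unitShell n

namespace IsShellCutoff

variable {c : EuclideanSpace ℝ (Fin n) → ℝ}

theorem hasCompactSupport (hc : IsShellCutoff c) : HasCompactSupport c :=
  HasCompactSupport.of_support_subset_isCompact
    (isCompact_closedBall (0 : EuclideanSpace ℝ (Fin n)) (3 / 2)) fun x hx => by
      simpa using (hc.tsupport_subset (subset_tsupport c hx)).2.le

theorem contDiff_mul (hc : IsShellCutoff c) {a : EuclideanSpace ℝ (Fin n) → ℝ}
    (ha : ∀ x, x ≠ 0 → ContDiffAt ℝ ∞ a x) : ContDiff ℝ ∞ fun x => c x * a x := by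
  rw [contDiff_iff_contDiffAt]
  intro x
  by_cases hx : x ∈ tsupport c
  · exact hc.contDiff.contDiffAt.mul (ha x (ne_zero_of_mem_unitShell (hc.tsupport_subset hx)))
  · refine (contDiffAt_const (c := (0 : ℝ))).congr_of_eventuallyEq ?_
    filter_upwards [notMem_tsupport_iff_eventuallyEq.mp hx] with y hy
    simp [hy]

theorem mul (hc : IsShellCutoff c) {a : EuclideanSpace ℝ (Fin n) → ℝ}
    (ha : ∀ x, x ≠ 0 → ContDiffAt ℝ ∞ a x) : IsShellCutoff fun x => c x * a x :=
  ⟨hc.contDiff_mul ha, (tsupport_mul_subset_left).trans hc.tsupport_subset⟩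

theorem partialDeriv (hc : IsShellCutoff c) (i : Fin n) : IsShellCutoff (pdn n i c) :=
  ⟨contDiff_pdn hc.contDiff i,
    (closure_mono fun x hx => by
      refine support_fderiv_subset ℝ (f := c) ?_
      intro h
      exact hx (by simp [pdn, h])).trans ((isClosed_tsupport c).closure_subset.trans hc.tsupport_subset)⟩

theorem contDiffAt_comp_shellMap (r : ℝ) {h : EuclideanSpace ℝ (Fin n) → ℝ} (hh : ContDiff ℝ ∞ h)
    {x : EuclideanSpace ℝ (Fin n)} (hx : x ≠ 0) : ContDiffAt ℝ ∞ (fun y => h (shellMap r y)) x := by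
  have h1 : ContDiffAt ℝ ∞ (fun y : EuclideanSpace ℝ (Fin n) => 1 + (r - 1) * ‖y‖⁻¹) x :=
    contDiffAt_const.add (contDiffAt_const.mul ((contDiffAt_norm ℝ hx).inv (norm_ne_zero_iff.mpr hx)))
  exact hh.contDiffAt.comp x (h1.smul contDiffAt_id)

theorem contDiff_mul_comp (hc : IsShellCutoff c) (r : ℝ) {h : EuclideanSpace ℝ (Fin n) → ℝ}
    (hh : ContDiff ℝ ∞ h) : ContDiff ℝ ∞ fun x => c x * h (shellMap r x) :=
  hc.contDiff_mul fun _ hx => contDiffAt_comp_shellMap r hh hx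

theorem exists_integral_sq_le (hc : IsShellCutoff c) (hn : n ≠ 0) :
    ∃ C : ℝ, 0 ≤ C ∧ ∀ r : ℝ, 2 ≤ r → ∀ h : EuclideanSpace ℝ (Fin n) → ℝ, ContDiff ℝ ∞ h →
      ∫ x, (c x * h (shellMap r x)) ^ 2 ≤ C * ((r ^ (n - 1))⁻¹ * annulusEnergy r h) := by
  obtain ⟨M, hM⟩ := hc.hasCompactSupport.exists_bound_of_continuous hc.contDiff.continuous
  refine ⟨M ^ 2 * 2 ^ (n - 1), by positivity, fun r hr h hh => ?_⟩
  obtain ⟨hint, hle⟩ := setIntegral_unitShell_shellMap_le hr hn hh.continuous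
  have hm : MeasurableSet (unitShell n) := isOpen_unitShell.measurableSet
  rw [← setIntegral_eq_integral_of_forall_compl_eq_zero (s := unitShell n) (fun x hx => by
    rw [image_eq_zero_of_notMem_tsupport fun h => hx (hc.tsupport_subset h)]; simp)]
  calc ∫ x in unitShell n, (c x * h (shellMap r x)) ^ 2
      ≤ ∫ x in unitShell n, M ^ 2 * h (shellMap r x) ^ 2 := by
        refine integral_mono_of_nonneg (.of_forall fun _ => sq_nonneg _) (hint.const_mul _)
          (.of_forall fun x => ?_)
        have := hM x
        simp only [mul_pow]
        gcongr ?_ * _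
        exact sq_le_sq' (by linarith [neg_abs_le (c x), Real.norm_eq_abs (c x)]) ((le_abs_self _).trans this)
    _ ≤ M ^ 2 * (2 ^ (n - 1) * (r ^ (n - 1))⁻¹ * annulusEnergy r h) := by
        rw [integral_const_mul]
        gcongr
    _ = _ := by ring

end IsShellCutoff

end ShellMap

section Chain

open scoped ContDiff

variable {n : ℕ}

/-- The identity, the partial derivatives and the rotations, as a single finite family. -/
noncomputable def vectorField (o : Option (Fin n ⊕ Fin n × Fin n))
    (u : EuclideanSpace ℝ (Fin n) → ℝ) : EuclideanSpace ℝ (Fin n) → ℝ :=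
  match o with
  | none => u
  | some (Sum.inl k) => pdn n k u
  | some (Sum.inr p) => rotn n p.1 p.2 u

theorem contDiff_rotn {u : EuclideanSpace ℝ (Fin n) → ℝ} (hu : ContDiff ℝ ∞ u) (i j : Fin n) :
    ContDiff ℝ ∞ (rotn n i j u) := by
  have h1 := contDiff_pdn hu i
  have h2 := contDiff_pdn hu j
  unfold rotn
  fun_prop

theorem contDiff_vectorField {u : EuclideanSpace ℝ (Fin n) → ℝ} (hu : ContDiff ℝ ∞ u)
    (o : Option (Fin n ⊕ Fin n × Fin n)) : ContDiff ℝ ∞ (vectorField o u) :=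
  match o with
  | none => hu
  | some (Sum.inl k) => contDiff_pdn hu k
  | some (Sum.inr p) => contDiff_rotn hu p.1 p.2

/-- The coefficients arising when `∂_i` is applied to `c · (h ∘ shellMap r)`. -/
noncomputable def shellCoeff (c : EuclideanSpace ℝ (Fin n) → ℝ) (i : Fin n)
    (o : Option (Fin n ⊕ Fin n × Fin n)) : EuclideanSpace ℝ (Fin n) → ℝ :=
  match o with
  | none => pdn n i c
  | some (Sum.inl k) => fun x => c x * (x i * x k * ‖x‖⁻¹ ^ 2)
  | some (Sum.inr p) => fun x => c x * (if p.2 = i then x p.1 * ‖x‖⁻¹ ^ 2 else 0)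

theorem isShellCutoff_shellCoeff {c : EuclideanSpace ℝ (Fin n) → ℝ} (hc : IsShellCutoff c)
    (i : Fin n) (o : Option (Fin n ⊕ Fin n × Fin n)) : IsShellCutoff (shellCoeff c i o) := by
  have hinv : ∀ x : EuclideanSpace ℝ (Fin n), x ≠ 0 → ContDiffAt ℝ ∞ (fun y => ‖y‖⁻¹ ^ 2) x :=
    fun x hx => ((contDiffAt_norm ℝ hx).inv (norm_ne_zero_iff.mpr hx)).pow 2
  have hcoord : ∀ (k : Fin n) (x : EuclideanSpace ℝ (Fin n)),
      ContDiffAt ℝ ∞ (fun y : EuclideanSpace ℝ (Fin n) => y k) x := fun k x => by fun_prop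
  match o with
  | none => exact hc.partialDeriv i
  | some (Sum.inl k) =>
    exact hc.mul fun x hx => ((hcoord i x).mul (hcoord k x)).mul (hinv x hx)
  | some (Sum.inr p) =>
    refine hc.mul fun x hx => ?_
    split_ifs
    · exact (hcoord p.1 x).mul (hinv x hx)
    · exact contDiffAt_const

theorem fderiv_apply_eq_sum_pdn (u : EuclideanSpace ℝ (Fin n) → ℝ)
    (x v : EuclideanSpace ℝ (Fin n)) : fderiv ℝ u x v = ∑ k, v k * pdn n k u x := by
  conv_lhs => rw [← (EuclideanSpace.basisFun (Fin n) ℝ).sum_repr v]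
  simp [map_sum, pdn]

theorem pdn_eq_zero_of_notMem_tsupport {c : EuclideanSpace ℝ (Fin n) → ℝ}
    {x : EuclideanSpace ℝ (Fin n)} (hx : x ∉ tsupport c) (i : Fin n) : pdn n i c x = 0 := by
  rw [pdn, (notMem_tsupport_iff_eventuallyEq.mp hx).fderiv_eq]
  simp

theorem pdn_mul_comp_shellMap {c h : EuclideanSpace ℝ (Fin n) → ℝ} (hc : IsShellCutoff c)
    (hh : ContDiff ℝ ∞ h) (r : ℝ) (i : Fin n) :
    pdn n i (fun x => c x * h (shellMap r x)) =
      fun x => ∑ o, shellCoeff c i o x * vectorField o h (shellMap r x) := by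
  ext x
  by_cases hx : x ∈ tsupport c
  · have hx0 := ne_zero_of_mem_unitShell (hc.tsupport_subset hx)
    have hx' : ‖x‖ ≠ 0 := norm_ne_zero_iff.mpr hx0
    have hd1 : HasFDerivAt h (fderiv ℝ h (shellMap r x)) (shellMap r x) :=
      (hh.differentiable (by simp) _).hasFDerivAt
    have hd2 : HasFDerivAt c (fderiv ℝ c x) x := (hc.contDiff.differentiable (by simp) _).hasFDerivAt
    have hd := (hd2.mul (hd1.comp x (hasFDerivAt_shellMap r hx0))).fderiv
    have hL : pdn n i (fun x => c x * h (shellMap r x)) x =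
        c x * fderiv ℝ h (shellMap r x) (shellMapDeriv r x (EuclideanSpace.single i 1)) +
          h (shellMap r x) * pdn n i c x := by
      rw [pdn]
      erw [hd]
      simp [pdn]
    have hS : fderiv ℝ h (shellMap r x) (shellMapDeriv r x (EuclideanSpace.single i 1)) =
        (1 + (r - 1) * ‖x‖⁻¹) * pdn n i h (shellMap r x) +
          (-(r - 1) * ‖x‖⁻¹ ^ 3) * x i * ∑ k, x k * pdn n k h (shellMap r x) := by
      rw [← fderiv_apply_eq_sum_pdn]
      simp [shellMapDeriv, pdn, EuclideanSpace.inner_single_right]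
    have hnorm : ∑ k, x k * x k = ‖x‖ ^ 2 := by
      rw [EuclideanSpace.real_norm_sq_eq]
      simp [sq]
    have hrot : ∑ j, x j * rotn n j i h (shellMap r x) = (1 + (r - 1) * ‖x‖⁻¹) *
        (‖x‖ ^ 2 * pdn n i h (shellMap r x) - x i * ∑ k, x k * pdn n k h (shellMap r x)) := by
      rw [← hnorm, Finset.sum_mul, Finset.mul_sum, ← Finset.sum_sub_distrib, Finset.mul_sum]
      refine Finset.sum_congr rfl fun j _ => ?_
      simp only [rotn, shellMap, PiLp.smul_apply, smul_eq_mul]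
      ring
    have hR1 : ∑ k, c x * (x i * x k * ‖x‖⁻¹ ^ 2) * pdn n k h (shellMap r x) =
        c x * x i * ‖x‖⁻¹ ^ 2 * ∑ k, x k * pdn n k h (shellMap r x) := by
      rw [Finset.mul_sum]
      exact Finset.sum_congr rfl fun j _ => by ring
    have hR2 : ∑ j, c x * (x j * ‖x‖⁻¹ ^ 2) * rotn n j i h (shellMap r x) =
        c x * ‖x‖⁻¹ ^ 2 * ∑ j, x j * rotn n j i h (shellMap r x) := by
      rw [Finset.mul_sum]
      exact Finset.sum_congr rfl fun j _ => by ring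
    rw [hL, hS]
    simp only [Fintype.sum_option, Fintype.sum_sum_type, Fintype.sum_prod_type, shellCoeff,
      vectorField, mul_ite, ite_mul, mul_zero, zero_mul, Finset.sum_ite_eq', Finset.mem_univ,
      if_true]
    rw [hR1, hR2, hrot]
    field_simp
    ring
  · have hc0 : c x = 0 := image_eq_zero_of_notMem_tsupport hx
    rw [pdn_eq_zero_of_notMem_tsupport fun h' => hx (tsupport_mul_subset_left h')]
    symm
    refine Finset.sum_eq_zero fun o _ => ?_
    match o with
    | none => simp [shellCoeff, pdn_eq_zero_of_notMem_tsupport hx]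
    | some (Sum.inl k) => simp [shellCoeff, hc0]
    | some (Sum.inr p) => simp [shellCoeff, hc0]

theorem pdn_sum {ι : Type*} (s : Finset ι) {u : ι → EuclideanSpace ℝ (Fin n) → ℝ}
    (hu : ∀ o, ContDiff ℝ ∞ (u o)) (i : Fin n) :
    pdn n i (fun x => ∑ o ∈ s, u o x) = fun x => ∑ o ∈ s, pdn n i (u o) x := by
  ext x
  simp only [pdn]
  rw [fderiv_fun_sum fun o _ => (hu o).differentiable (by simp) x]
  simp

theorem iterate_pdn_sum {ι : Type*} (s : Finset ι) {u : ι → EuclideanSpace ℝ (Fin n) → ℝ}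
    (hu : ∀ o, ContDiff ℝ ∞ (u o)) (i : Fin n) (k : ℕ) :
    (pdn n i)^[k] (fun x => ∑ o ∈ s, u o x) = fun x => ∑ o ∈ s, (pdn n i)^[k] (u o) x := by
  induction k with
  | zero => rfl
  | succ k ih =>
    rw [Function.iterate_succ_apply', ih, pdn_sum s fun o => contDiff_iterate_pdn (hu o) i k]
    simp only [Function.iterate_succ_apply']

theorem hasCompactSupport_iterate_pdn {u : EuclideanSpace ℝ (Fin n) → ℝ} (hu : HasCompactSupport u)
    (i : Fin n) (k : ℕ) : HasCompactSupport ((pdn n i)^[k] u) := by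
  induction k with
  | zero => exact hu
  | succ k ih =>
    rw [Function.iterate_succ_apply']
    exact ih.mono' fun x hx => by_contra fun h => hx (pdn_eq_zero_of_notMem_tsupport h i)

theorem integrable_sq_of_hasCompactSupport {u : EuclideanSpace ℝ (Fin n) → ℝ} (hu : Continuous u)
    (hc : HasCompactSupport u) : Integrable fun x => u x ^ 2 := by
  refine (hu.pow 2).integrable_of_hasCompactSupport (hc.mono fun x hx => ?_)
  exact fun h => hx (by simp [h])

/-- The sum of the squared annulus norms of all words of length at most `k` in the vector fields. -/
noncomputable def wordEnergy (r : ℝ) : ℕ → (EuclideanSpace ℝ (Fin n) → ℝ) → ℝ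
  | 0, h => annulusEnergy r h
  | k + 1, h => ∑ o, wordEnergy r k (vectorField o h)

theorem wordEnergy_nonneg (r : ℝ) (k : ℕ) (h : EuclideanSpace ℝ (Fin n) → ℝ) :
    0 ≤ wordEnergy r k h := by
  induction k generalizing h with
  | zero => exact annulusEnergy_nonneg r h
  | succ k ih => exact Finset.sum_nonneg fun o _ => ih _

theorem exists_integral_iterate_pdn_mul_comp_sq_le (hn : n ≠ 0) (i : Fin n) (k : ℕ) :
    ∀ c : EuclideanSpace ℝ (Fin n) → ℝ, IsShellCutoff c →
    ∃ C : ℝ, 0 ≤ C ∧ ∀ r : ℝ, 2 ≤ r → ∀ h : EuclideanSpace ℝ (Fin n) → ℝ, ContDiff ℝ ∞ h →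
      ∫ x, ((pdn n i)^[k] (fun y => c y * h (shellMap r y)) x) ^ 2 ≤
        C * ((r ^ (n - 1))⁻¹ * wordEnergy r k h) := by
  induction k with
  | zero => exact fun c hc => hc.exists_integral_sq_le hn
  | succ k ih =>
    intro c hc
    choose C hC0 hC using fun o => ih (shellCoeff c i o) (isShellCutoff_shellCoeff hc i o)
    set N : ℝ := ((Finset.univ : Finset (Option (Fin n ⊕ Fin n × Fin n))).card : ℝ) with hN
    refine ⟨N * ∑ o, C o, mul_nonneg (by positivity) (Finset.sum_nonneg fun o _ => hC0 o), ?_⟩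
    intro r hr h hh
    have hr0 : 0 ≤ r := by linarith
    set v : Option (Fin n ⊕ Fin n × Fin n) → EuclideanSpace ℝ (Fin n) → ℝ :=
      fun o x => shellCoeff c i o x * vectorField o h (shellMap r x) with hv
    have hvs : ∀ o, ContDiff ℝ ∞ (v o) := fun o =>
      (isShellCutoff_shellCoeff hc i o).contDiff_mul_comp r (contDiff_vectorField hh o)
    have hvc : ∀ o, HasCompactSupport (v o) := fun o =>
      (isShellCutoff_shellCoeff hc i o).hasCompactSupport.mul_right
    have hint : ∀ o, Integrable fun x => ((pdn n i)^[k] (v o) x) ^ 2 := fun o =>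
      integrable_sq_of_hasCompactSupport (contDiff_iterate_pdn (hvs o) i k).continuous
        (hasCompactSupport_iterate_pdn (hvc o) i k)
    rw [Function.iterate_succ_apply, pdn_mul_comp_shellMap hc hh, iterate_pdn_sum _ hvs]
    calc ∫ x, (∑ o, (pdn n i)^[k] (v o) x) ^ 2
        ≤ ∫ x, N * ∑ o, ((pdn n i)^[k] (v o) x) ^ 2 := by
          refine integral_mono_of_nonneg (.of_forall fun _ => sq_nonneg _)
            ((integrable_finsetSum _ fun o _ => hint o).const_mul _) (.of_forall fun x => ?_)
          exact sq_sum_le_card_mul_sum_sq (f := fun o => (pdn n i)^[k] (v o) x)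
      _ = N * ∑ o, ∫ x, ((pdn n i)^[k] (v o) x) ^ 2 := by
          rw [integral_const_mul, integral_finsetSum _ fun o _ => hint o]
      _ ≤ N * ∑ o, C o * ((r ^ (n - 1))⁻¹ * wordEnergy r (k + 1) h) := by
          gcongr with o
          refine (hC o r hr _ (contDiff_vectorField hh o)).trans ?_
          have h1 : wordEnergy r k (vectorField o h) ≤ wordEnergy r (k + 1) h :=
            Finset.single_le_sum (f := fun o => wordEnergy r k (vectorField o h))
              (fun o _ => wordEnergy_nonneg r k _) (Finset.mem_univ o)
          have := hC0 o
          gcongr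
      _ = _ := by rw [← Finset.sum_mul, mul_assoc]

end Chain

section Ordering

open scoped ContDiff

variable {n : ℕ}

/-- The space of smooth functions. -/
def smoothFunctions (n : ℕ) : Submodule ℝ (EuclideanSpace ℝ (Fin n) → ℝ) where
  carrier := {u | ContDiff ℝ ∞ u}
  add_mem' {u v} (hu : ContDiff ℝ ∞ u) (hv : ContDiff ℝ ∞ v) := ContDiff.add hu hv
  zero_mem' := (contDiff_const : ContDiff ℝ ∞ fun _ => (0 : ℝ))
  smul_mem' c u (hu : ContDiff ℝ ∞ u) := ContDiff.const_smul c hu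

theorem pdn_add {u v : EuclideanSpace ℝ (Fin n) → ℝ} (hu : ContDiff ℝ ∞ u) (hv : ContDiff ℝ ∞ v)
    (i : Fin n) : pdn n i (u + v) = pdn n i u + pdn n i v := by
  ext x
  simp [pdn, fderiv_add (hu.differentiable (by simp) x) (hv.differentiable (by simp) x)]

theorem pdn_smul {u : EuclideanSpace ℝ (Fin n) → ℝ} (hu : ContDiff ℝ ∞ u) (c : ℝ) (i : Fin n) :
    pdn n i (c • u) = c • pdn n i u := by
  ext x
  simp [pdn, fderiv_const_smul (hu.differentiable (by simp) x)]

/-- `∂_i` as an operator on smooth functions. -/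
noncomputable def pdnEnd (i : Fin n) : Module.End ℝ (smoothFunctions n) where
  toFun u := ⟨pdn n i u, contDiff_pdn u.2 i⟩
  map_add' u v := Subtype.ext (pdn_add u.2 v.2 i)
  map_smul' c u := Subtype.ext (pdn_smul u.2 c i)

/-- `Ω_{ij}` as an operator on smooth functions. -/
noncomputable def rotnEnd (i j : Fin n) : Module.End ℝ (smoothFunctions n) where
  toFun u := ⟨rotn n i j u, contDiff_rotn u.2 i j⟩
  map_add' u v := by
    ext x
    simp only [rotn, Submodule.coe_add, pdn_add u.2 v.2, Pi.add_apply]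
    ring
  map_smul' c u := by
    ext x
    simp only [rotn, Submodule.coe_smul, pdn_smul u.2, Pi.smul_apply, smul_eq_mul, RingHom.id_apply]
    ring

theorem coe_pdnEnd (i : Fin n) (u : smoothFunctions n) :
    (pdnEnd i u : EuclideanSpace ℝ (Fin n) → ℝ) = pdn n i u := rfl

theorem coe_rotnEnd (i j : Fin n) (u : smoothFunctions n) :
    (rotnEnd i j u : EuclideanSpace ℝ (Fin n) → ℝ) = rotn n i j u := rfl

theorem pdn_comm {u : EuclideanSpace ℝ (Fin n) → ℝ} (hu : ContDiff ℝ ∞ u) (i j : Fin n)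
    (x : EuclideanSpace ℝ (Fin n)) : pdn n i (pdn n j u) x = pdn n j (pdn n i u) x := by
  have hd : DifferentiableAt ℝ (fderiv ℝ u) x :=
    (hu.fderiv_right (m := ∞) (by simp)).differentiable (by simp) x
  have key : ∀ k l : Fin n, pdn n k (pdn n l u) x =
      fderiv ℝ (fderiv ℝ u) x (EuclideanSpace.single k 1) (EuclideanSpace.single l 1) := by
    intro k l
    have h1 : pdn n l u = fun y => fderiv ℝ u y (EuclideanSpace.single l 1) := rfl
    rw [pdn, h1, fderiv_clm_apply hd (differentiableAt_const _)]
    simp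
  rw [key, key]
  exact (hu.contDiffAt.isSymmSndFDerivAt (by simpa using WithTop.coe_le_coe.mpr (le_top : (2 : ℕ∞) ≤ ⊤))) _ _

theorem pdn_coord_mul {u : EuclideanSpace ℝ (Fin n) → ℝ} (hu : ContDiff ℝ ∞ u) (a i : Fin n)
    (x : EuclideanSpace ℝ (Fin n)) :
    pdn n a (fun y => y i * u y) x = x i * pdn n a u x + (if a = i then u x else 0) := by
  have h1 : HasFDerivAt (fun y : EuclideanSpace ℝ (Fin n) => y i)
    (EuclideanSpace.proj i : EuclideanSpace ℝ (Fin n) →L[ℝ] ℝ) x :=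
    (EuclideanSpace.proj i : EuclideanSpace ℝ (Fin n) →L[ℝ] ℝ).hasFDerivAt
  have h2 := (h1.mul (hu.differentiable (by simp) x).hasFDerivAt).fderiv
  rw [pdn]
  erw [h2]
  simp [pdn, eq_comm]

theorem rotnEnd_mul_pdnEnd (i j a : Fin n) :
    rotnEnd i j * pdnEnd a = pdnEnd a * rotnEnd i j
      + (-1 : ℝ) • (if a = i then pdnEnd j else 0) + (if a = j then pdnEnd i else 0) := by
  ext u x
  have hsub : ∀ v w : EuclideanSpace ℝ (Fin n) → ℝ, ContDiff ℝ ∞ v → ContDiff ℝ ∞ w →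
      pdn n a (fun y => v y - w y) x = pdn n a v x - pdn n a w x := by
    intro v w hv hw
    simp [pdn, fderiv_fun_sub (hv.differentiable (by simp) x) (hw.differentiable (by simp) x)]
  have hpi := contDiff_pdn u.2 i
  have hpj := contDiff_pdn u.2 j
  have hrot : pdn n a (rotn n i j u) x = x i * pdn n a (pdn n j u) x +
      (if a = i then pdn n j u x else 0) - (x j * pdn n a (pdn n i u) x +
        (if a = j then pdn n i u x else 0)) := by
    unfold rotn
    rw [hsub _ _ (by fun_prop) (by fun_prop), pdn_coord_mul hpj, pdn_coord_mul hpi]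
  have hi : ((if a = i then pdnEnd j else 0 : Module.End ℝ (smoothFunctions n)) u :
      EuclideanSpace ℝ (Fin n) → ℝ) x = if a = i then pdn n j u x else 0 := by
    split_ifs <;> rfl
  have hj : ((if a = j then pdnEnd i else 0 : Module.End ℝ (smoothFunctions n)) u :
      EuclideanSpace ℝ (Fin n) → ℝ) x = if a = j then pdn n i u x else 0 := by
    split_ifs <;> rfl
  simp only [Module.End.mul_apply, LinearMap.add_apply, LinearMap.smul_apply, Submodule.coe_add,
    Submodule.coe_smul, Pi.add_apply, Pi.smul_apply, smul_eq_mul, hi, hj, coe_pdnEnd, coe_rotnEnd, hrot]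
  rw [rotn, pdn_comm u.2 j a, pdn_comm u.2 i a]
  ring

theorem rotnEnd_self (i : Fin n) : rotnEnd i i = 0 := by
  ext u x
  simp [coe_rotnEnd, rotn]

theorem rotnEnd_swap (i j : Fin n) : rotnEnd i j = (-1 : ℝ) • rotnEnd j i := by
  ext u x
  simp [coe_rotnEnd, rotn]

/-- The product `∂^α Ω^β` of operators. -/
noncomputable def orderedWord (l : List (Fin n)) (q : List {p : Fin n × Fin n // p.1 < p.2}) :
    Module.End ℝ (smoothFunctions n) :=
  (l.map pdnEnd).prod * (q.map fun p => rotnEnd p.val.1 p.val.2).prod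

/-- The span of the operators `∂^α Ω^β` with `|α| + |β| ≤ m`. -/
noncomputable def orderedSpan (n m : ℕ) : Submodule ℝ (Module.End ℝ (smoothFunctions n)) :=
  Submodule.span ℝ {T | ∃ l q, l.length + q.length ≤ m ∧ T = orderedWord (n := n) l q}

theorem orderedWord_mem {l : List (Fin n)} {q : List {p : Fin n × Fin n // p.1 < p.2}} {m : ℕ}
    (h : l.length + q.length ≤ m) : orderedWord l q ∈ orderedSpan n m :=
  Submodule.subset_span ⟨l, q, h, rfl⟩

theorem orderedSpan_mono {m k : ℕ} (h : m ≤ k) : orderedSpan n m ≤ orderedSpan n k :=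
  Submodule.span_mono fun _ ⟨l, q, hlq, hT⟩ => ⟨l, q, hlq.trans h, hT⟩

theorem mul_mem_of_orderedWord {A : Module.End ℝ (smoothFunctions n)} {m k : ℕ}
    (h : ∀ l q, l.length + q.length ≤ m → A * orderedWord l q ∈ orderedSpan n k)
    {T : Module.End ℝ (smoothFunctions n)} (hT : T ∈ orderedSpan n m) : A * T ∈ orderedSpan n k := by
  induction hT using Submodule.span_induction with
  | mem T hT =>
    obtain ⟨l, q, hlq, rfl⟩ := hT
    exact h l q hlq
  | zero => simp
  | add S T _ _ hS hT => rw [mul_add]; exact add_mem hS hT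
  | smul c T _ hT => rw [mul_smul_comm]; exact Submodule.smul_mem _ _ hT

theorem pdnEnd_mul_mem {m : ℕ} (a : Fin n) {T : Module.End ℝ (smoothFunctions n)}
    (hT : T ∈ orderedSpan n m) : pdnEnd a * T ∈ orderedSpan n (m + 1) := by
  refine mul_mem_of_orderedWord (fun l q hlq => ?_) hT
  have : pdnEnd a * orderedWord l q = orderedWord (a :: l) q := by
    simp [orderedWord, mul_assoc]
  rw [this]
  exact orderedWord_mem (by simp; omega)

theorem rotnEnd_mul_orderedWord_mem (i j : Fin n) (l : List (Fin n))
    (q : List {p : Fin n × Fin n // p.1 < p.2}) :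
    rotnEnd i j * orderedWord l q ∈ orderedSpan n (l.length + q.length + 1) := by
  induction l with
  | nil =>
    have key : ∀ i j : Fin n, i < j →
        rotnEnd i j * orderedWord [] q ∈ orderedSpan n (([] : List (Fin n)).length + q.length + 1) := by
      intro i j hij
      have : rotnEnd i j * orderedWord [] q = orderedWord [] (⟨(i, j), hij⟩ :: q) := by
        simp [orderedWord]
      rw [this]
      exact orderedWord_mem (by simp)
    rcases lt_trichotomy i j with hij | rfl | hij
    · exact key i j hij
    · rw [rotnEnd_self, zero_mul]; exact zero_mem _
    · rw [rotnEnd_swap, smul_mul_assoc]; exact Submodule.smul_mem _ _ (key j i hij)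
  | cons a l ih =>
    have h1 : orderedWord (a :: l) q = pdnEnd a * orderedWord l q := by
      simp [orderedWord, mul_assoc]
    have h2 : ∀ k, pdnEnd k * orderedWord l q ∈
        orderedSpan n ((a :: l).length + q.length + 1) := fun k =>
      orderedSpan_mono (by simp only [List.length_cons]; omega) (pdnEnd_mul_mem k (orderedWord_mem le_rfl))
    have h3 : pdnEnd a * (rotnEnd i j * orderedWord l q) ∈
        orderedSpan n ((a :: l).length + q.length + 1) :=
      orderedSpan_mono (by simp only [List.length_cons]; omega) (pdnEnd_mul_mem a ih)
    rw [h1, ← mul_assoc, rotnEnd_mul_pdnEnd, add_mul, add_mul, mul_assoc, smul_mul_assoc]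
    refine add_mem (add_mem h3 (Submodule.smul_mem _ _ ?_)) ?_
    · split_ifs
      · exact h2 j
      · simp
    · split_ifs
      · exact h2 i
      · simp

theorem rotnEnd_mul_mem {m : ℕ} (i j : Fin n) {T : Module.End ℝ (smoothFunctions n)}
    (hT : T ∈ orderedSpan n m) : rotnEnd i j * T ∈ orderedSpan n (m + 1) :=
  mul_mem_of_orderedWord (fun l q hlq =>
    orderedSpan_mono (by omega) (rotnEnd_mul_orderedWord_mem i j l q)) hT

theorem one_mem_orderedSpan (m : ℕ) : 1 ∈ orderedSpan n m := by
  have : (1 : Module.End ℝ (smoothFunctions n)) = orderedWord [] [] := by simp [orderedWord]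
  rw [this]
  exact orderedWord_mem (by simp)

/-- The sum of the annulus norms of `∂^α Ω^β f` over `|α| + |β| ≤ m`. -/
noncomputable def orderedNormSum (r : ℝ) (m : ℕ) (f : EuclideanSpace ℝ (Fin n) → ℝ) : ℝ :=
  ∑ j ∈ Finset.range (m + 1), ∑ k ∈ Finset.range (m + 1 - j),
    ∑ α : Fin j → Fin n, ∑ β : Fin k → {p : Fin n × Fin n // p.1 < p.2},
      annL2 n r (applyD n α (applyR n β f))

theorem annL2_nonneg (r : ℝ) (u : EuclideanSpace ℝ (Fin n) → ℝ) : 0 ≤ annL2 n r u :=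
  Real.rpow_nonneg (annulusEnergy_nonneg r u) _

theorem annL2_sq (r : ℝ) (u : EuclideanSpace ℝ (Fin n) → ℝ) :
    annL2 n r u ^ 2 = annulusEnergy r u := by
  have := annulusEnergy_nonneg r u
  change (annulusEnergy r u ^ ((1 : ℝ) / 2)) ^ 2 = _
  rw [← Real.sqrt_eq_rpow, Real.sq_sqrt this]

theorem orderedNormSum_nonneg (r : ℝ) (m : ℕ) (f : EuclideanSpace ℝ (Fin n) → ℝ) :
    0 ≤ orderedNormSum r m f :=
  Finset.sum_nonneg fun _ _ => Finset.sum_nonneg fun _ _ => Finset.sum_nonneg fun _ _ =>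
    Finset.sum_nonneg fun _ _ => annL2_nonneg _ _

theorem annL2_le_orderedNormSum (r : ℝ) {m j k : ℕ} (hjk : j + k ≤ m) (α : Fin j → Fin n)
    (β : Fin k → {p : Fin n × Fin n // p.1 < p.2}) (f : EuclideanSpace ℝ (Fin n) → ℝ) :
    annL2 n r (applyD n α (applyR n β f)) ≤ orderedNormSum r m f := by
  have h0 := fun (j k : ℕ) (α : Fin j → Fin n) (β : Fin k → {p : Fin n × Fin n // p.1 < p.2}) =>
    annL2_nonneg r (applyD n α (applyR n β f))
  have h1 := fun (j k : ℕ) (α : Fin j → Fin n) => Finset.sum_nonneg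
    fun (β : Fin k → {p : Fin n × Fin n // p.1 < p.2}) (_ : β ∈ Finset.univ) => h0 j k α β
  have h2 := fun (j k : ℕ) => Finset.sum_nonneg
    fun (α : Fin j → Fin n) (_ : α ∈ Finset.univ) => h1 j k α
  have h3 := fun (j : ℕ) => Finset.sum_nonneg
    fun (k : ℕ) (_ : k ∈ Finset.range (m + 1 - j)) => h2 j k
  refine le_trans ?_ (Finset.single_le_sum (fun j _ => h3 j)
    (Finset.mem_range.mpr (by omega : j < m + 1)))
  refine le_trans ?_ (Finset.single_le_sum (fun k _ => h2 j k)
    (Finset.mem_range.mpr (by omega : k < m + 1 - j)))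
  refine le_trans ?_ (Finset.single_le_sum (fun α _ => h1 j k α) (Finset.mem_univ α))
  exact Finset.single_le_sum (fun β _ => h0 j k α β) (Finset.mem_univ β)

theorem coe_orderedWord (l : List (Fin n)) (q : List {p : Fin n × Fin n // p.1 < p.2})
    (f : smoothFunctions n) : (orderedWord l q f : EuclideanSpace ℝ (Fin n) → ℝ) =
      applyD n l.get (applyR n q.get f) := by
  have hq : ((q.map fun p => rotnEnd p.val.1 p.val.2).prod f : EuclideanSpace ℝ (Fin n) → ℝ) =
      applyR n q.get f := by
    simp only [applyR, List.ofFn_get]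
    induction q with
    | nil => rfl
    | cons p q ih =>
      rw [List.map_cons, List.prod_cons, Module.End.mul_apply, coe_rotnEnd, ih, List.foldr_cons]
  rw [orderedWord, Module.End.mul_apply, ← hq]
  generalize (q.map fun p => rotnEnd p.val.1 p.val.2).prod f = g
  simp only [applyD, List.ofFn_get]
  induction l with
  | nil => rfl
  | cons a l ih =>
    rw [List.map_cons, List.prod_cons, Module.End.mul_apply, coe_pdnEnd, ih, List.foldr_cons]

theorem annulusEnergy_add_le (r : ℝ) {u v : EuclideanSpace ℝ (Fin n) → ℝ} (hu : Continuous u)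
    (hv : Continuous v) :
    annulusEnergy r (u + v) ≤ 2 * (annulusEnergy r u + annulusEnergy r v) := by
  have h1 : IntegrableOn (fun x => u x ^ 2) (annulus n r) := integrableOn_annulus r (hu.pow 2)
  have h2 : IntegrableOn (fun x => v x ^ 2) (annulus n r) := integrableOn_annulus r (hv.pow 2)
  unfold annulusEnergy
  rw [← integral_add h1 h2, ← integral_const_mul]
  refine integral_mono_of_nonneg (.of_forall fun _ => sq_nonneg _) ((h1.add h2).const_mul 2)
    (.of_forall fun x => ?_)
  simp only [Pi.add_apply]
  nlinarith [sq_nonneg (u x - v x)]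

theorem annulusEnergy_smul (r c : ℝ) (u : EuclideanSpace ℝ (Fin n) → ℝ) :
    annulusEnergy r (c • u) = c ^ 2 * annulusEnergy r u := by
  simp only [annulusEnergy, Pi.smul_apply, smul_eq_mul, mul_pow, integral_const_mul]

theorem exists_annulusEnergy_le {m : ℕ} {T : Module.End ℝ (smoothFunctions n)}
    (hT : T ∈ orderedSpan n m) : ∃ C : ℝ, 0 ≤ C ∧ ∀ (r : ℝ) (f : smoothFunctions n),
      annulusEnergy r (T f : EuclideanSpace ℝ (Fin n) → ℝ) ≤ C * orderedNormSum r m (f : EuclideanSpace ℝ (Fin n) → ℝ) ^ 2 := by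
  induction hT using Submodule.span_induction with
  | mem T hT =>
    obtain ⟨l, q, hlq, rfl⟩ := hT
    refine ⟨1, zero_le_one, fun r f => ?_⟩
    rw [coe_orderedWord, ← annL2_sq, one_mul]
    exact pow_le_pow_left₀ (annL2_nonneg _ _) (annL2_le_orderedNormSum r hlq _ _ _) 2
  | zero => exact ⟨0, le_rfl, fun r f => by simp [annulusEnergy]⟩
  | add S T _ _ hS hT =>
    obtain ⟨C, hC0, hC⟩ := hS
    obtain ⟨D, hD0, hD⟩ := hT
    refine ⟨2 * (C + D), by positivity, fun r f => ?_⟩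
    have := annulusEnergy_add_le r (ContDiff.continuous (n := ∞) (S f).2)
      (ContDiff.continuous (n := ∞) (T f).2)
    rw [LinearMap.add_apply, Submodule.coe_add]
    linarith [hC r f, hD r f]
  | smul c T _ hT =>
    obtain ⟨C, hC0, hC⟩ := hT
    refine ⟨c ^ 2 * C, by positivity, fun r f => ?_⟩
    rw [LinearMap.smul_apply, Submodule.coe_smul, annulusEnergy_smul, mul_assoc]
    exact mul_le_mul_of_nonneg_left (hC r f) (sq_nonneg c)

/-- `vectorField o` as an operator on smooth functions. -/
noncomputable def vectorFieldEnd (o : Option (Fin n ⊕ Fin n × Fin n)) :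
    Module.End ℝ (smoothFunctions n) :=
  match o with
  | none => 1
  | some (Sum.inl k) => pdnEnd k
  | some (Sum.inr p) => rotnEnd p.1 p.2

theorem coe_vectorFieldEnd (o : Option (Fin n ⊕ Fin n × Fin n)) (u : smoothFunctions n) :
    (vectorFieldEnd o u : EuclideanSpace ℝ (Fin n) → ℝ) = vectorField o u :=
  match o with
  | none => rfl
  | some (Sum.inl _) => rfl
  | some (Sum.inr _) => rfl

theorem vectorFieldEnd_mul_mem {m : ℕ} (o : Option (Fin n ⊕ Fin n × Fin n))
    {T : Module.End ℝ (smoothFunctions n)} (hT : T ∈ orderedSpan n m) :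
    vectorFieldEnd o * T ∈ orderedSpan n (m + 1) :=
  match o with
  | none => by rw [vectorFieldEnd, one_mul]; exact orderedSpan_mono m.le_succ hT
  | some (Sum.inl k) => pdnEnd_mul_mem k hT
  | some (Sum.inr p) => rotnEnd_mul_mem p.1 p.2 hT

theorem exists_wordEnergy_le (k : ℕ) : ∀ (m : ℕ) (T : Module.End ℝ (smoothFunctions n)),
    T ∈ orderedSpan n m → ∃ C : ℝ, 0 ≤ C ∧ ∀ (r : ℝ) (f : smoothFunctions n),
      wordEnergy r k (T f : EuclideanSpace ℝ (Fin n) → ℝ) ≤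
        C * orderedNormSum r (m + k) (f : EuclideanSpace ℝ (Fin n) → ℝ) ^ 2 := by
  induction k with
  | zero => exact fun m T hT => exists_annulusEnergy_le hT
  | succ k ih =>
    intro m T hT
    choose C hC0 hC using fun o => ih (m + 1) (vectorFieldEnd o * T) (vectorFieldEnd_mul_mem o hT)
    refine ⟨∑ o, C o, Finset.sum_nonneg fun o _ => hC0 o, fun r f => ?_⟩
    rw [wordEnergy, Finset.sum_mul]
    refine Finset.sum_le_sum fun o _ => ?_
    have := hC o r f
    rw [Module.End.mul_apply, coe_vectorFieldEnd] at this
    rwa [show m + (k + 1) = m + 1 + k by omega]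

end Ordering

section Main

open scoped ContDiff

theorem exists_shellCutoff (n : ℕ) : ∃ c : EuclideanSpace ℝ (Fin n) → ℝ,
    IsShellCutoff c ∧ ∀ x, ‖x‖ = 1 → c x = 1 := by
  let b : ContDiffBump (1 : ℝ) := ⟨1 / 4, 1 / 2, by norm_num, by norm_num⟩
  refine ⟨fun x => b (‖x‖ ^ 2), ⟨b.contDiff.comp (contDiff_norm_sq ℝ), ?_⟩, fun x hx => ?_⟩
  · have hcl : IsClosed {x : EuclideanSpace ℝ (Fin n) | ‖x‖ ^ 2 ∈ Metric.closedBall (1 : ℝ) (1 / 2)} :=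
      Metric.isClosed_closedBall.preimage (by fun_prop)
    refine (closure_minimal (fun x hx => ?_) hcl).trans fun x hx => ?_
    · have : ‖x‖ ^ 2 ∈ Function.support b := hx
      rw [b.support_eq] at this
      exact Metric.ball_subset_closedBall this
    · simp only [Set.mem_ofPred_eq, Metric.mem_closedBall, Real.dist_eq, abs_le] at hx
      constructor <;> nlinarith [norm_nonneg x, hx.1, hx.2]
  · simp only [hx, one_pow]
    exact b.one_of_mem_closedBall (Metric.mem_closedBall_self (by norm_num [b]))

theorem shellMap_of_norm_eq_one {n : ℕ} (r : ℝ) {y : EuclideanSpace ℝ (Fin n)} (hy : ‖y‖ = 1) :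
    shellMap r y = r • y := by
  simp [shellMap, hy]

theorem exists_pow_mul_sq_le {n m : ℕ} (hn : n ≠ 0) (hm : n < 2 * m) :
    ∃ C : ℝ, 0 ≤ C ∧ ∀ r : ℝ, 2 ≤ r → ∀ f : EuclideanSpace ℝ (Fin n) → ℝ, ContDiff ℝ ∞ f →
      ∀ y : EuclideanSpace ℝ (Fin n), ‖y‖ = 1 →
        r ^ (n - 1) * f (r • y) ^ 2 ≤ C * orderedNormSum r m f ^ 2 := by
  obtain ⟨c, hc, hc1⟩ := exists_shellCutoff n
  obtain ⟨S, hS0, hS⟩ := exists_sq_le_integral_iterate_pdn hm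
  obtain ⟨A, hA0, hA⟩ := hc.exists_integral_sq_le hn
  choose B hB0 hB using fun i => exists_integral_iterate_pdn_mul_comp_sq_le hn i m c hc
  obtain ⟨D, hD0, hD⟩ := exists_annulusEnergy_le (one_mem_orderedSpan (n := n) m)
  obtain ⟨F, hF0, hF⟩ := exists_wordEnergy_le m 0 _ (one_mem_orderedSpan (n := n) 0)
  refine ⟨S * (A * D + ∑ i, B i * F), mul_nonneg hS0 (add_nonneg (mul_nonneg hA0 hD0)
    (Finset.sum_nonneg fun i _ => mul_nonneg (hB0 i) hF0)), fun r hr f hf y hy => ?_⟩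
  have hr0 : 0 < r := by linarith
  have hu := hS _ (hc.contDiff_mul_comp r hf) hc.hasCompactSupport.mul_right y
  simp only [hc1 y hy, one_mul, shellMap_of_norm_eq_one r hy] at hu
  set Q := orderedNormSum r m f ^ 2
  have hD' : annulusEnergy r f ≤ D * Q := hD r ⟨f, hf⟩
  have hF' : wordEnergy r m f ≤ F * Q := by simpa using hF r ⟨f, hf⟩
  have h0 : ∫ x, (c x * f (shellMap r x)) ^ 2 ≤ A * ((r ^ (n - 1))⁻¹ * (D * Q)) :=
    (hA r hr f hf).trans (by gcongr)
  have h1 : ∀ i, ∫ x, ((pdn n i)^[m] (fun y => c y * f (shellMap r y)) x) ^ 2 ≤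
      B i * ((r ^ (n - 1))⁻¹ * (F * Q)) := fun i =>
    (hB i r hr f hf).trans (by have := hB0 i; gcongr)
  calc r ^ (n - 1) * f (r • y) ^ 2 ≤ r ^ (n - 1) * (S * (A * ((r ^ (n - 1))⁻¹ * (D * Q)) +
        ∑ i, B i * ((r ^ (n - 1))⁻¹ * (F * Q)))) := by
        refine mul_le_mul_of_nonneg_left (hu.trans ?_) (by positivity)
        exact mul_le_mul_of_nonneg_left (add_le_add h0 (Finset.sum_le_sum fun i _ => h1 i)) hS0
    _ = _ := by
        rw [← Finset.sum_mul, ← Finset.sum_mul]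
        field_simp

end Main

/-- Localized Sobolev estimate away from the origin: for `r ≥ 2` and smooth `f`,
`r^{(n-1)/2} sup_{|ω|=1} |f(rω)| ≤ C Σ_{|α|+|β| ≤ ⌈n/2⌉+1} ‖∂^α Ω^β f‖_{L²(r-1<|x|<r+1)}`. -/
theorem stmt_12 (n : ℕ) (hn : 2 ≤ n) :
    ∃ C : ℝ, 0 < C ∧ ∀ r : ℝ, 2 ≤ r → ∀ f : EuclideanSpace ℝ (Fin n) → ℝ,
      ContDiff ℝ (⊤ : ℕ∞) f → ∀ ω : EuclideanSpace ℝ (Fin n), ‖ω‖ = 1 →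
      r ^ (((n : ℝ) - 1) / 2) * |f (r • ω)| ≤
        C * ∑ j ∈ Finset.range ((n + 1) / 2 + 2),
              ∑ k ∈ Finset.range ((n + 1) / 2 + 2 - j),
                ∑ α : Fin j → Fin n, ∑ β : Fin k → {p : Fin n × Fin n // p.1 < p.2},
                  annL2 n r (applyD n α (applyR n β f)) := by
  obtain ⟨C, hC0, hC⟩ := exists_pow_mul_sq_le (n := n) (m := (n + 1) / 2 + 1) (by omega) (by omega)
  refine ⟨Real.sqrt C + 1, by positivity, fun r hr f hf ω hω => ?_⟩
  have hr0 : 0 ≤ r := by linarith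
  have hQ := orderedNormSum_nonneg r ((n + 1) / 2 + 1) f
  change _ ≤ _ * orderedNormSum r ((n + 1) / 2 + 1) f
  have hpow : (r ^ (((n : ℝ) - 1) / 2)) ^ 2 = r ^ (n - 1) := by
    rw [← Real.rpow_natCast, ← Real.rpow_mul hr0, ← Real.rpow_natCast,
      Nat.cast_sub (by omega : 1 ≤ n)]
    congr 1
    push_cast
    ring
  have h1 : r ^ (((n : ℝ) - 1) / 2) * |f (r • ω)| ≤
      Real.sqrt C * orderedNormSum r ((n + 1) / 2 + 1) f := by
    refine le_of_sq_le_sq ?_ (by positivity)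
    rw [mul_pow, mul_pow, hpow, sq_abs, Real.sq_sqrt hC0]
    exact hC r hr f hf ω hω
  exact h1.trans (mul_le_mul_of_nonneg_right (by linarith) hQ)
end
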